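/- The only integer solutions (x₂, y₂) ∈ ℤ² of |x₂⁴ − 9x₂³y₂ − 21x₂²y₂² + 88x₂y₂³ + 48y₂⁴| ≤ 1 are, up to sign, (0,0), (1,0), (1,−2). -/

import Mathlib

open Polynomial in
theorem Polynomial.coeff_prod_sum_of_natDegree_le {R ι : Type*} [CommSemiring R] (s : Finset ι)
    (f : ι → R[X]) (d : ι → ℕ) (h : ∀ i ∈ s, (f i).natDegree ≤ d i) :
    (∏ i ∈ s, f i).coeff (∑ i ∈ s, d i) = ∏ i ∈ s, (f i).coeff (d i) := by
  classical
  induction s using Finset.induction_on with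
  | empty => simp
  | insert i s hi ih =>
    rw [Finset.prod_insert hi, Finset.sum_insert hi, Finset.prod_insert hi,
      coeff_mul_add_eq_of_natDegree_le (h i (Finset.mem_insert_self i s)),
      ih fun j hj ↦ h j (Finset.mem_insert_of_mem hj)]
    exact (natDegree_prod_le _ _).trans
      (Finset.sum_le_sum fun j hj ↦ h j (Finset.mem_insert_of_mem hj))

open Polynomial in
theorem exists_eval_ne_zero_of_box {F : Type*} [Field F] [CharZero F] {K l S₁ S₂ N : ℕ} {a b : F}
    (ha : Function.Injective fun n : ℕ ↦ a ^ n) (ha₀ : a ≠ 0) (hb₀ : b ≠ 0)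
    (p : Fin l → F[X]) (hp : p ≠ 0) (hdeg : ∀ j, (p j).natDegree ≤ K) (hN : S₁ ≤ N)
    (hS : l * K < S₁ * S₂) :
    ∃ s₁ < S₁ + l, ∃ s₂ < S₂,
      ∑ j, (p j).eval ((s₁ : F) - N * s₂) * (a ^ s₁ * b ^ s₂) ^ (j : ℕ) ≠ 0 := by
  classical
  by_contra! H
  set J : Finset (Fin l) := Finset.univ.filter fun j ↦ p j ≠ 0 with hJ
  set n := J.card with hn
  let e : Fin n ↪o Fin l := J.orderEmbOfFin rfl
  have he : ∀ c, p (e c) ≠ 0 := fun c ↦ by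
    exact (Finset.mem_filter.mp (J.orderEmbOfFin_mem rfl c)).2
  have hnl : n ≤ l := by simpa using J.card_le_univ
  have hn0 : 0 < n := by
    rw [hn, Finset.card_pos]
    obtain ⟨j, hj⟩ := Function.ne_iff.mp hp
    exact ⟨j, by simpa [hJ] using hj⟩
  let Q : Matrix (Fin n) (Fin n) F[X] := Matrix.of fun k c ↦
    (p (e c)).comp (X + C ((k : ℕ) : F)) * C (a ^ ((k : ℕ) * (e c : ℕ)))
  have hQdeg : ∀ k c, (Q k c).natDegree ≤ (p (e c)).natDegree := fun k c ↦ by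
    refine (natDegree_mul_C_le ((p (e c)).comp (X + C ((k : ℕ) : F))) _).trans (le_of_eq ?_)
    rw [natDegree_comp, natDegree_X_add_C, mul_one]
  have hQcoeff : ∀ k c, (Q k c).coeff (p (e c)).natDegree =
      (p (e c)).leadingCoeff * a ^ ((k : ℕ) * (e c : ℕ)) := fun k c ↦ by
    have h1 : ((p (e c)).comp (X + C ((k : ℕ) : F))).natDegree = (p (e c)).natDegree := by
      rw [natDegree_comp, natDegree_X_add_C, mul_one]
    have h2 : ((p (e c)).comp (X + C ((k : ℕ) : F))).leadingCoeff = (p (e c)).leadingCoeff := by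
      rw [leadingCoeff_comp (by rw [natDegree_X_add_C]; exact one_ne_zero),
        leadingCoeff_X_add_C, one_pow, mul_one]
    simp only [Q, Matrix.of_apply, coeff_mul_C]
    rw [← h2, leadingCoeff, h1]
  set d := ∑ c, (p (e c)).natDegree with hd
  have hdet : Q.det.coeff d ≠ 0 := by
    have : Q.det.coeff d = (Matrix.of fun k c : Fin n ↦
        (p (e c)).leadingCoeff * (a ^ (e c : ℕ)) ^ (k : ℕ)).det := by
      rw [Matrix.det_apply, Matrix.det_apply, finsetSum_coeff]
      refine Finset.sum_congr rfl fun σ _ ↦ ?_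
      rw [coeff_smul, hd, Polynomial.coeff_prod_sum_of_natDegree_le ]
      · congr 1
        refine Finset.prod_congr rfl fun c _ ↦ ?_
        rw [hQcoeff, Matrix.of_apply, ← pow_mul, mul_comm (e c : ℕ)]
      · exact fun c _ ↦ hQdeg _ _
    rw [this, ← Matrix.det_transpose]
    have h3 : (Matrix.of fun k c : Fin n ↦
        (p (e c)).leadingCoeff * (a ^ (e c : ℕ)) ^ (k : ℕ)).transpose =
        Matrix.diagonal (fun c ↦ (p (e c)).leadingCoeff) *
          Matrix.vandermonde fun c ↦ a ^ (e c : ℕ) := by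
      ext c k
      simp [Matrix.diagonal_mul, Matrix.vandermonde_apply]
    rw [h3, Matrix.det_mul, Matrix.det_diagonal]
    refine mul_ne_zero (Finset.prod_ne_zero_iff.mpr fun c _ ↦ by simpa using he c) ?_
    rw [Matrix.det_vandermonde_ne_zero_iff]
    intro c c' h
    exact e.injective (Fin.ext (ha h))
  have hdetdeg : Q.det.natDegree < Fintype.card (Fin S₁ × Fin S₂) := by
    have h1 : Q.det.natDegree ≤ d := by
      rw [Matrix.det_apply]
      refine natDegree_sum_le_of_forall_le _ _ fun σ _ ↦ ?_
      refine (natDegree_smul_le _ _).trans ((natDegree_prod_le _ _).trans ?_)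
      exact Finset.sum_le_sum fun c _ ↦ hQdeg _ _
    have h2 : d ≤ n * K := by
      simpa using Finset.sum_le_card_nsmul Finset.univ _ K fun c _ ↦ hdeg (e c)
    have h3 : n * K ≤ l * K := Nat.mul_le_mul_right _ hnl
    simp only [Fintype.card_prod, Fintype.card_fin]
    omega
  refine hdet ?_
  rw [eq_zero_of_natDegree_lt_card_of_eval_eq_zero Q.det
    (f := fun s : Fin S₁ × Fin S₂ ↦ ((s.1 : ℕ) : F) - N * ((s.2 : ℕ) : F)) ?_ ?_ hdetdeg]
  · simp
  · rintro ⟨s, t⟩ ⟨s', t'⟩ h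
    have h1 : ((s : ℤ) - N * (t : ℤ) : ℤ) = (s' : ℤ) - N * (t' : ℤ) := by
      have h' : (((s : ℤ) - N * (t : ℤ) : ℤ) : F) = (((s' : ℤ) - N * (t' : ℤ) : ℤ) : F) := by
        push_cast; exact h
      exact_mod_cast h'
    have hs := s.2
    have hs' := s'.2
    have h2 : (t : ℤ) = t' := by
      rcases lt_trichotomy (t : ℤ) t' with h2 | h2 | h2
      · nlinarith
      · exact h2
      · nlinarith
    have h3 : (s : ℤ) = s' := by rw [h2] at h1; linarith
    ext <;> simp <;> omega
  · rintro ⟨s, t⟩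
    set y := a ^ (s : ℕ) * b ^ (t : ℕ) with hy
    have hy0 : y ≠ 0 := mul_ne_zero (pow_ne_zero _ ha₀) (pow_ne_zero _ hb₀)
    rw [← coe_evalRingHom, RingHom.map_det, ← Matrix.exists_mulVec_eq_zero_iff]
    refine ⟨fun c ↦ y ^ (e c : ℕ), fun h ↦ ?_, ?_⟩
    · exact pow_ne_zero (e ⟨0, hn0⟩ : ℕ) hy0 (congrFun h ⟨0, hn0⟩)
    · ext k
      have hk := H (s + k) (by have := s.2; have := k.2; omega) t t.2
      rw [← Finset.sum_subset J.subset_univ] at hk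
      · have h4 : J = Finset.univ.map e.toEmbedding := (J.map_orderEmbOfFin_univ rfl).symm
        rw [h4, Finset.sum_map] at hk
        rw [Pi.zero_apply, ← hk]
        simp only [Matrix.mulVec, dotProduct]
        refine Finset.sum_congr rfl fun c _ ↦ ?_
        simp only [Q, RingHom.mapMatrix_apply, Matrix.map_apply, Matrix.of_apply,
          coe_evalRingHom, eval_mul, eval_comp, eval_add, eval_X, eval_C, hy,
          RelEmbedding.coe_toEmbedding]
        push_cast
        rw [show (s : F) - N * (t : F) + (k : F) = s + k - N * t by ring]
        ring
      · intro j _ hj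
        have : p j = 0 := by simpa [hJ] using hj
        simp [this]

theorem exists_int_forall_abs_sum_le {I M : Type*} [Fintype I] [Fintype M] (A : M → I → ℝ)
    (s r u : ℕ) (hA : ∀ n, (∑ i, |A n i|) * 2 ^ u ≤ 2 ^ s)
    (h : (s + r + 2) * Fintype.card M < u * Fintype.card I) :
    ∃ p : I → ℤ, p ≠ 0 ∧ (∀ i, |p i| ≤ 2 ^ u) ∧ ∀ n, |∑ i, A n i * p i| ≤ (1 / 2) ^ r := by
  classical
  let f : (I → Fin (2 ^ u)) → M → ℤ := fun p n ↦ ⌊(∑ i, A n i * (p i : ℕ)) * 2 ^ r⌋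
  let t : Finset (M → ℤ) := Fintype.piFinset fun _ ↦ Finset.Icc (-2 ^ (s + r)) (2 ^ (s + r))
  have hS : ∀ (p : I → Fin (2 ^ u)) (n : M), |∑ i, A n i * (p i : ℕ)| ≤ 2 ^ s := fun p n ↦ by
    refine ((Finset.abs_sum_le_sum_abs _ _).trans ?_).trans (hA n)
    rw [Finset.sum_mul]
    refine Finset.sum_le_sum fun i _ ↦ ?_
    rw [abs_mul, Nat.abs_cast]
    refine mul_le_mul_of_nonneg_left ?_ (abs_nonneg _)
    exact_mod_cast (p i).2.le
  have hft : ∀ p ∈ (Finset.univ : Finset (I → Fin (2 ^ u))), f p ∈ t := fun p _ ↦ by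
    rw [Fintype.mem_piFinset]
    intro n
    have h1 := abs_le.mp (hS p n)
    have h2 : (0 : ℝ) < 2 ^ r := by positivity
    rw [Finset.mem_Icc]
    constructor
    · rw [Int.le_floor]
      push_cast
      rw [pow_add, ← neg_mul]
      exact mul_le_mul_of_nonneg_right h1.1 h2.le
    · have : (((f p n : ℤ)) : ℝ) ≤ ((2 ^ (s + r) : ℤ) : ℝ) := by
        refine (Int.floor_le _).trans ?_
        push_cast
        rw [pow_add]
        exact mul_le_mul_of_nonneg_right h1.2 h2.le
      exact_mod_cast this
  have hcard : t.card < (Finset.univ : Finset (I → Fin (2 ^ u))).card := by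
    rw [Finset.card_univ, Fintype.card_fun, Fintype.card_fin, Fintype.card_piFinset,
      Finset.prod_const, Int.card_Icc, Finset.card_univ, ← pow_mul]
    have h1 : ((2 : ℤ) ^ (s + r) + 1 - -2 ^ (s + r)).toNat ≤ 2 ^ (s + r + 2) := by
      rw [Int.toNat_le]
      push_cast
      have : (1 : ℤ) ≤ 2 ^ (s + r) := one_le_pow₀ (by norm_num)
      rw [pow_add _ (s + r) 2]
      linarith
    refine (Nat.pow_le_pow_left h1 _).trans_lt ?_
    rw [← pow_mul]
    exact Nat.pow_lt_pow_right (by norm_num) h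
  obtain ⟨p, -, q, -, hpq, hf⟩ := Finset.exists_ne_map_eq_of_card_lt_of_maps_to hcard hft
  refine ⟨fun i ↦ ((p i : ℕ) : ℤ) - ((q i : ℕ) : ℤ), fun h0 ↦ hpq ?_, fun i ↦ ?_, fun n ↦ ?_⟩
  · ext i
    have := congrFun h0 i
    simp only [Pi.zero_apply] at this
    omega
  · have h1 : ((p i : ℕ) : ℤ) < 2 ^ u := by exact_mod_cast (p i).2
    have h2 : ((q i : ℕ) : ℤ) < 2 ^ u := by exact_mod_cast (q i).2
    rw [abs_le]
    constructor <;> linarith [Int.natCast_nonneg (p i : ℕ), Int.natCast_nonneg (q i : ℕ)]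
  · have h1 := Int.abs_sub_lt_one_of_floor_eq_floor (congrFun hf n)
    have h2 : (0 : ℝ) < 2 ^ r := by positivity
    rw [← sub_mul, abs_mul, abs_of_pos h2, ← Finset.sum_sub_distrib] at h1
    rw [one_div, inv_pow, ← one_div, le_div_iff₀ h2]
    refine le_of_eq_of_le ?_ h1.le
    congr 2
    refine Finset.sum_congr rfl fun i _ ↦ ?_
    push_cast
    ring

theorem Real.abs_exp_sub_sum_range_le {z E : ℝ} {T : ℕ} (hz : |z| ≤ E) (hT : 6 * E ≤ T) :
    |Real.exp z - ∑ t ∈ Finset.range T, z ^ t / t.factorial| ≤ 2 * (1 / 2) ^ T := by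
  have hE : 0 ≤ E := (abs_nonneg z).trans hz
  have h1 : ‖(z : ℂ)‖ / T.succ ≤ 1 / 2 := by
    rw [Complex.norm_real, Real.norm_eq_abs, div_le_iff₀ (by positivity)]
    push_cast
    linarith
  have h2 := Complex.exp_bound' h1
  rw [Complex.norm_real, Real.norm_eq_abs] at h2
  have h3 : ‖Complex.exp z - ∑ t ∈ Finset.range T, (z : ℂ) ^ t / t.factorial‖ =
      |Real.exp z - ∑ t ∈ Finset.range T, z ^ t / t.factorial| := by
    rw [← Real.norm_eq_abs, ← Complex.norm_real]
    push_cast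
    rfl
  rw [← h3]
  refine h2.trans ?_
  rw [mul_comm]
  refine mul_le_mul_of_nonneg_left ?_ (by norm_num)
  have h4 : (T : ℝ) ^ T / T.factorial ≤ 3 ^ T := by
    refine (Real.pow_div_factorial_le_exp _ (Nat.cast_nonneg _) T).trans ?_
    rw [← mul_one (T : ℝ), Real.exp_nat_mul]
    exact pow_le_pow_left₀ (Real.exp_pos _).le Real.exp_one_lt_three.le _
  have h5 : |z| ≤ T * (1 / 6) := by linarith
  calc |z| ^ T / T.factorial ≤ (T * (1 / 6)) ^ T / T.factorial := by gcongr
    _ = (T : ℝ) ^ T / T.factorial * (1 / 6) ^ T := by rw [mul_pow]; ring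
    _ ≤ 3 ^ T * (1 / 6) ^ T := by gcongr
    _ = (1 / 2) ^ T := by rw [← mul_pow]; norm_num

theorem one_le_pow_finrank_mul_norm {L : Type*} [Field L] [NumberField L] {x : L}
    (hx : IsIntegral ℤ x) (hx0 : x ≠ 0) {M : ℝ} (hM : 1 ≤ M) {D : ℕ}
    (hD : Module.finrank ℚ L ≤ D) (h : ∀ φ : L →ₐ[ℚ] ℂ, ‖φ x‖ ≤ M) (φ₀ : L →ₐ[ℚ] ℂ) :
    1 ≤ M ^ D * ‖φ₀ x‖ := by
  classical
  have h1 : IsIntegral ℤ (Algebra.norm ℚ x) := Algebra.isIntegral_norm ℚ hx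
  obtain ⟨n, hn⟩ := IsIntegrallyClosed.isIntegral_iff.mp h1
  have hn0 : n ≠ 0 := by
    rintro rfl
    rw [map_zero] at hn
    exact hx0 (Algebra.norm_eq_zero_iff.mp hn.symm)
  have h2 : (1 : ℝ) ≤ ‖algebraMap ℚ ℂ (Algebra.norm ℚ x)‖ := by
    rw [← hn]
    simp only [algebraMap_int_eq, eq_intCast, map_intCast, Complex.norm_intCast]
    exact_mod_cast Int.one_le_abs hn0
  rw [Algebra.norm_eq_prod_embeddings ℚ ℂ x, norm_prod,
    ← Finset.prod_erase_mul _ _ (Finset.mem_univ φ₀)] at h2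
  refine h2.trans (mul_le_mul_of_nonneg_right ?_ (norm_nonneg _))
  refine (Finset.prod_le_prod (fun _ _ ↦ norm_nonneg _) fun φ _ ↦ h φ).trans ?_
  rw [Finset.prod_const]
  refine pow_le_pow_right₀ hM ((Finset.card_le_univ _).trans ?_)
  rwa [AlgHom.card]

theorem Real.exp_four_mul_le (U : ℕ) : Real.exp (4 * U) ≤ 2 ^ (6 * U) := by
  have h : Real.exp 4 ≤ 2 ^ 6 := by
    have h1 : Real.exp 4 = Real.exp 1 ^ 4 := by rw [← Real.exp_nat_mul]; norm_num
    rw [h1]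
    have h2 : Real.exp 1 ≤ 2.719 := by linarith [Real.exp_one_lt_d9]
    calc Real.exp 1 ^ 4 ≤ 2.719 ^ 4 := pow_le_pow_left₀ (Real.exp_pos _).le h2 _
      _ ≤ 2 ^ 6 := by norm_num
  rw [mul_comm, Real.exp_nat_mul, pow_mul]
  exact pow_le_pow_left₀ (Real.exp_pos _).le h _

theorem exists_int_exp_poly_small {w : ℝ} {K l X U T r : ℕ} (hX1 : 1 ≤ X)
    (hw : l * |w| * X ≤ 4 * U) (hX : X ^ K ≤ 2 ^ U) (hKl : K * l ≤ 2 ^ U) (hT : 24 * U ≤ T)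
    (hbox : (9 * U + r + 2) * (K + T) < U * (K * l)) :
    ∃ p : Fin K → Fin l → ℤ, p ≠ 0 ∧ (∀ i j, |p i j| ≤ 2 ^ U) ∧
      ∀ (x : ℤ) (z : ℝ), |x| ≤ X → l * |z| ≤ 1 →
        |∑ i, ∑ j, (p i j : ℝ) * (x : ℝ) ^ (i : ℕ) * Real.exp (x * w + z) ^ (j : ℕ)| ≤
          (K + T) * (1 / 2) ^ r + 2 ^ (3 * U) * (2 * (1 / 2) ^ T) + 2 ^ (9 * U) * (2 * (l * |z|)) := by
  have hX0 : (0 : ℝ) < X := by exact_mod_cast hX1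
  have hXK : ∀ i : Fin K, (X : ℝ) ^ (i : ℕ) ≤ 2 ^ U := fun i ↦ by
    refine (pow_le_pow_right₀ (by exact_mod_cast hX1) i.2.le).trans ?_
    exact_mod_cast hX
  have hKl' : (K : ℝ) * l ≤ 2 ^ U := by exact_mod_cast hKl
  have hjw : ∀ j : Fin l, |(j : ℕ) * w| * X ≤ 4 * U := fun j ↦ by
    refine le_trans ?_ hw
    rw [abs_mul, Nat.abs_cast]
    have : ((j : ℕ) : ℝ) ≤ l := by exact_mod_cast j.2.le
    gcongr
  let A : Fin (K + T) → Fin K × Fin l → ℝ := fun n ij ↦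
    ∑ t ∈ Finset.range T, if (ij.1 : ℕ) + t = n then
      (X : ℝ) ^ ((ij.1 : ℕ) + t) * (((ij.2 : ℕ) * w) ^ t / t.factorial) else 0
  have hAb : ∀ n ij, |A n ij| ≤ 2 ^ (7 * U) := fun n ij ↦ by
    calc |A n ij| ≤ ∑ t ∈ Finset.range T,
          (X : ℝ) ^ (ij.1 : ℕ) * ((|(ij.2 : ℕ) * w| * X) ^ t / t.factorial) := by
          refine (Finset.abs_sum_le_sum_abs _ _).trans (Finset.sum_le_sum fun t _ ↦ ?_)
          split_ifs with h
          · rw [abs_mul, abs_div, abs_pow, abs_pow, Nat.abs_cast, Nat.abs_cast, pow_add, mul_pow]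
            apply le_of_eq
            ring
          · rw [abs_zero]
            positivity
      _ = (X : ℝ) ^ (ij.1 : ℕ) *
          ∑ t ∈ Finset.range T, (|(ij.2 : ℕ) * w| * X) ^ t / t.factorial := by
          rw [Finset.mul_sum]
      _ ≤ 2 ^ U * 2 ^ (6 * U) := by
          gcongr
          · exact hXK _
          · refine (Real.sum_le_exp_of_nonneg (by positivity) T).trans ?_
            exact (Real.exp_le_exp.mpr (hjw _)).trans (Real.exp_four_mul_le U)
      _ = 2 ^ (7 * U) := by rw [← pow_add]; congr 1; ring
  obtain ⟨p, hp0, hp, hsmall⟩ := exists_int_forall_abs_sum_le A (9 * U) r U (fun n ↦ by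
    calc (∑ ij, |A n ij|) * 2 ^ U ≤ (∑ ij : Fin K × Fin l, (2 : ℝ) ^ (7 * U)) * 2 ^ U := by
          gcongr with ij; exact hAb n ij
      _ = K * l * 2 ^ (8 * U) := by
          simp only [Finset.sum_const, Finset.card_univ, Fintype.card_prod, Fintype.card_fin,
            nsmul_eq_mul, Nat.cast_mul]
          rw [mul_assoc, ← pow_add]; congr 2; ring
      _ ≤ 2 ^ U * 2 ^ (8 * U) := by gcongr
      _ = 2 ^ (9 * U) := by rw [← pow_add]; congr 1; ring) (by simpa using hbox)
  refine ⟨fun i j ↦ p (i, j), fun h ↦ hp0 ?_, fun i j ↦ hp _, fun x z hx hz ↦ ?_⟩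
  · ext ij
    exact congrFun (congrFun h ij.1) ij.2
  have hx' : |(x : ℝ)| ≤ X := by exact_mod_cast hx
  have hpR : ∀ ij, |(p ij : ℝ)| ≤ 2 ^ U := fun ij ↦ by exact_mod_cast hp ij
  have hjx : ∀ j : Fin l, |(j : ℕ) * w * x| ≤ 4 * U := fun j ↦ by
    refine le_trans ?_ (hjw j)
    rw [abs_mul]
    gcongr
  have hxK : ∀ i : Fin K, |(x : ℝ)| ^ (i : ℕ) ≤ 2 ^ U := fun i ↦
    (pow_le_pow_left₀ (abs_nonneg _) hx' _).trans (hXK i)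
  have hjl : ∀ j : Fin l, ((j : ℕ) : ℝ) ≤ l := fun j ↦ by exact_mod_cast j.2.le
  have hterm : ∀ ij : Fin K × Fin l,
      |Real.exp (x * w + z) ^ (ij.2 : ℕ) - Real.exp ((ij.2 : ℕ) * w * x)| ≤
        2 ^ (6 * U) * (2 * (l * |z|)) := fun ij ↦ by
    have h1 : Real.exp (x * w + z) ^ (ij.2 : ℕ) =
        Real.exp ((ij.2 : ℕ) * w * x) * Real.exp ((ij.2 : ℕ) * z) := by
      rw [← Real.exp_nat_mul, ← Real.exp_add]; congr 1; ring
    have h2 : |(ij.2 : ℕ) * z| ≤ l * |z| := by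
      rw [abs_mul, Nat.abs_cast]
      exact mul_le_mul_of_nonneg_right (hjl _) (abs_nonneg _)
    rw [h1, ← mul_sub_one, abs_mul, abs_of_pos (Real.exp_pos _)]
    gcongr
    · exact (Real.exp_le_exp.mpr ((le_abs_self _).trans (hjx _))).trans (Real.exp_four_mul_le U)
    · refine (Real.abs_exp_sub_one_le (h2.trans hz)).trans ?_
      gcongr
  have hsum : ∀ n : Fin (K + T), |(x : ℝ)| ^ (n : ℕ) ≤ (X : ℝ) ^ (n : ℕ) := fun n ↦
    pow_le_pow_left₀ (abs_nonneg _) hx' _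
  have hmain : |∑ ij : Fin K × Fin l, (p ij : ℝ) * (x : ℝ) ^ (ij.1 : ℕ) *
      ∑ t ∈ Finset.range T, ((ij.2 : ℕ) * w * x) ^ t / t.factorial| ≤ (K + T) * (1 / 2) ^ r := by
    have h1 : ∑ ij : Fin K × Fin l, (p ij : ℝ) * (x : ℝ) ^ (ij.1 : ℕ) *
        ∑ t ∈ Finset.range T, ((ij.2 : ℕ) * w * x) ^ t / t.factorial =
        ∑ n : Fin (K + T), ((x : ℝ) / X) ^ (n : ℕ) * ∑ ij, A n ij * p ij := by
      simp only [Finset.mul_sum, A, Finset.sum_mul]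
      refine Eq.trans ?_ Finset.sum_comm
      refine Finset.sum_congr rfl fun ij _ ↦ ?_
      refine Eq.trans ?_ Finset.sum_comm
      refine Finset.sum_congr rfl fun t ht ↦ ?_
      have hlt : (ij.1 : ℕ) + t < K + T := by
        have := ij.1.2; have := Finset.mem_range.mp ht; omega
      rw [Finset.sum_eq_single ⟨(ij.1 : ℕ) + t, hlt⟩]
      · rw [if_pos rfl]
        simp only
        rw [div_pow, mul_pow, pow_add, pow_add]
        field_simp
      · intro n _ hn
        rw [if_neg fun h ↦ hn (Fin.ext h.symm)]
        simp
      · simp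
    rw [h1]
    calc _ ≤ ∑ n : Fin (K + T), 1 * (1 / 2 : ℝ) ^ r := by
          refine (Finset.abs_sum_le_sum_abs _ _).trans ?_
          refine Finset.sum_le_sum fun n _ ↦ ?_
          rw [abs_mul]
          refine mul_le_mul ?_ (hsmall n) (abs_nonneg _) zero_le_one
          rw [abs_pow, abs_div, Nat.abs_cast]
          exact pow_le_one₀ (by positivity) ((div_le_one hX0).mpr hx')
      _ = _ := by simp
  rw [← Fintype.sum_prod_type' (f := fun (i : Fin K) (j : Fin l) ↦
    (p (i, j) : ℝ) * (x : ℝ) ^ (i : ℕ) * Real.exp (x * w + z) ^ (j : ℕ))]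
  have hsplit : ∑ ij : Fin K × Fin l, (p (ij.1, ij.2) : ℝ) * (x : ℝ) ^ (ij.1 : ℕ) *
      Real.exp (x * w + z) ^ (ij.2 : ℕ) =
      (∑ ij : Fin K × Fin l, (p ij : ℝ) * (x : ℝ) ^ (ij.1 : ℕ) *
        ∑ t ∈ Finset.range T, ((ij.2 : ℕ) * w * x) ^ t / t.factorial) +
      (∑ ij : Fin K × Fin l, (p ij : ℝ) * (x : ℝ) ^ (ij.1 : ℕ) *
        (Real.exp ((ij.2 : ℕ) * w * x) -
          ∑ t ∈ Finset.range T, ((ij.2 : ℕ) * w * x) ^ t / t.factorial)) +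
      ∑ ij : Fin K × Fin l, (p ij : ℝ) * (x : ℝ) ^ (ij.1 : ℕ) *
        (Real.exp (x * w + z) ^ (ij.2 : ℕ) - Real.exp ((ij.2 : ℕ) * w * x)) := by
    rw [← Finset.sum_add_distrib, ← Finset.sum_add_distrib]
    refine Finset.sum_congr rfl fun ij _ ↦ ?_
    ring
  have hgen : ∀ (F : Fin K × Fin l → ℝ) (c : ℝ), (∀ ij, |F ij| ≤ c) →
      |∑ ij : Fin K × Fin l, (p ij : ℝ) * (x : ℝ) ^ (ij.1 : ℕ) * F ij| ≤ 2 ^ (3 * U) * c := by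
    intro F c hF
    calc _ ≤ ∑ ij : Fin K × Fin l, (2 : ℝ) ^ U * 2 ^ U * c := by
          refine (Finset.abs_sum_le_sum_abs _ _).trans ?_
          refine Finset.sum_le_sum fun ij _ ↦ ?_
          rw [abs_mul, abs_mul, abs_pow]
          exact mul_le_mul (mul_le_mul (hpR _) (hxK _) (by positivity) (by positivity)) (hF ij)
            (abs_nonneg _) (by positivity)
      _ = K * l * (2 ^ (2 * U) * c) := by
          simp only [Finset.sum_const, Finset.card_univ, Fintype.card_prod, Fintype.card_fin,
            nsmul_eq_mul, Nat.cast_mul]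
          rw [← pow_add, two_mul]
      _ ≤ 2 ^ U * (2 ^ (2 * U) * c) := by
          rcases isEmpty_or_nonempty (Fin K × Fin l) with he | ⟨⟨ij⟩⟩
          · have : (K : ℝ) * l = 0 := by
              have := Fintype.card_eq_zero (α := Fin K × Fin l)
              rw [Fintype.card_prod, Fintype.card_fin, Fintype.card_fin] at this
              exact_mod_cast this
            exfalso
            have h0 : K * l = 0 := by exact_mod_cast this
            rw [h0] at hbox
            omega
          · have hc : 0 ≤ c := (abs_nonneg _).trans (hF ij)
            gcongr
      _ = 2 ^ (3 * U) * c := by rw [← mul_assoc, ← pow_add]; congr 2; ring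
  rw [hsplit]
  refine (abs_add_three _ _ _).trans (add_le_add (add_le_add hmain ?_) ?_)
  · refine hgen _ _ fun ij ↦ Real.abs_exp_sub_sum_range_le (hjx _) ?_
    have : ((24 * U : ℕ) : ℝ) ≤ T := by exact_mod_cast hT
    push_cast at this
    linarith
  · refine (hgen _ _ hterm).trans (le_of_eq ?_)
    rw [← mul_assoc, ← pow_add]; congr 2; ring

theorem mul_le_two_pow_of_le {c n m : ℕ} (hm : c * m ≤ 2 ^ m) (hm0 : c ≤ 2 ^ m) (hn : m ≤ n) :
    c * n ≤ 2 ^ n := by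
  induction n, hn using Nat.le_induction with
  | base => exact hm
  | succ k hk ih =>
    have : 2 ^ m ≤ 2 ^ k := Nat.pow_le_pow_right (by norm_num) hk
    rw [pow_succ]
    nlinarith

theorem norm_sum_pow_mul_le {L : Type*} [Field L] [NumberField L] (φ : L →ₐ[ℚ] ℂ) {α β d : L}
    {h₁ h₂ K l S S₂ X U : ℕ} (hα : ‖φ α‖ ≤ 2 ^ h₁) (hd : ‖φ d‖ ≤ 2 ^ h₂)
    (hβ : ‖φ (d * β)‖ ≤ 2 ^ h₂) {p : Fin K → Fin l → ℤ} (hp : ∀ i j, |p i j| ≤ 2 ^ U)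
    (hX1 : 1 ≤ X) (hX : X ^ K ≤ 2 ^ U) (hKl : K * l ≤ 2 ^ U)
    (hS : S * l * h₁ ≤ 2 * U) (hS₂ : h₂ * (l * S₂) ≤ U) {x : ℤ} (hx : |x| ≤ X) {s₁ s₂ : ℕ}
    (hs₁ : s₁ ≤ S) (hs₂ : s₂ ≤ S₂) :
    ‖φ (∑ i, ∑ j, (p i j : L) * (x : L) ^ (i : ℕ) * (α ^ (s₁ * (j : ℕ)) * (d * β) ^ (s₂ * (j : ℕ)) *
      d ^ (l * S₂ - s₂ * (j : ℕ))))‖ ≤ 2 ^ (6 * U) := by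
  have hterm : ∀ (i : Fin K) (j : Fin l), ‖φ ((p i j : L) * (x : L) ^ (i : ℕ) *
      (α ^ (s₁ * (j : ℕ)) * (d * β) ^ (s₂ * (j : ℕ)) * d ^ (l * S₂ - s₂ * (j : ℕ))))‖ ≤
      2 ^ (5 * U) := fun i j ↦ by
    have e1 : ‖(p i j : ℂ)‖ ≤ 2 ^ U := by
      rw [Complex.norm_intCast]; exact_mod_cast hp i j
    have e2 : ‖(x : ℂ)‖ ^ (i : ℕ) ≤ 2 ^ U := by
      rw [Complex.norm_intCast]
      have h1 : |(x : ℝ)| ≤ X := by exact_mod_cast hx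
      refine (pow_le_pow_left₀ (abs_nonneg _) h1 _).trans ?_
      refine (pow_le_pow_right₀ (by exact_mod_cast hX1) i.2.le).trans ?_
      exact_mod_cast hX
    have e3 : ‖φ α‖ ^ (s₁ * (j : ℕ)) ≤ 2 ^ (2 * U) := by
      refine (pow_le_pow_left₀ (norm_nonneg _) hα _).trans ?_
      rw [← pow_mul]
      refine pow_le_pow_right₀ (by norm_num) (le_trans ?_ hS)
      rw [mul_comm]
      have := j.2.le
      gcongr
    have hjs : s₂ * (j : ℕ) ≤ l * S₂ := by
      rw [mul_comm l]; exact Nat.mul_le_mul hs₂ j.2.le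
    have e4 : ‖φ (d * β)‖ ^ (s₂ * (j : ℕ)) * ‖φ d‖ ^ (l * S₂ - s₂ * (j : ℕ)) ≤ 2 ^ U := by
      calc _ ≤ ((2 : ℝ) ^ h₂) ^ (s₂ * (j : ℕ)) * (2 ^ h₂) ^ (l * S₂ - s₂ * (j : ℕ)) := by gcongr
        _ = 2 ^ (h₂ * (l * S₂)) := by rw [← pow_add, Nat.add_sub_cancel' hjs, pow_mul 2 h₂]
        _ ≤ 2 ^ U := pow_le_pow_right₀ (by norm_num) hS₂
    rw [map_mul, map_mul, map_mul, map_mul, map_pow, map_pow, map_pow, map_pow, map_intCast,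
      map_intCast, norm_mul, norm_mul, norm_mul, norm_mul, norm_pow, norm_pow, norm_pow, norm_pow,
      mul_assoc (‖φ α‖ ^ _)]
    calc _ ≤ (2 : ℝ) ^ U * 2 ^ U * (2 ^ (2 * U) * 2 ^ U) := by gcongr
      _ = 2 ^ (5 * U) := by rw [← pow_add, ← pow_add, ← pow_add]; congr 1; ring
  rw [map_sum]
  simp only [map_sum]
  calc _ ≤ ∑ i : Fin K, ∑ j : Fin l, (2 : ℝ) ^ (5 * U) := by
        refine (norm_sum_le _ _).trans (Finset.sum_le_sum fun i _ ↦ ?_)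
        exact (norm_sum_le _ _).trans (Finset.sum_le_sum fun j _ ↦ hterm i j)
    _ = ((K * l : ℕ) : ℝ) * 2 ^ (5 * U) := by simp [mul_assoc]
    _ ≤ 2 ^ U * 2 ^ (5 * U) := by
        gcongr
        exact_mod_cast hKl
    _ = 2 ^ (6 * U) := by rw [← pow_add]; congr 1; ring

set_option maxHeartbeats 1000000 in
theorem two_pow_neg_lt_abs_linear_form_log {L : Type*} [Field L] [NumberField L]
    (φ₀ : L →ₐ[ℚ] ℝ) {D g h₁ h₂ N : ℕ} {α β d : L} (hD : Module.finrank ℚ L ≤ D)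
    (hα : IsIntegral ℤ α) (hd : IsIntegral ℤ d) (hβ : IsIntegral ℤ (d * β)) (hd0 : d ≠ 0)
    (hα0 : 0 < φ₀ α) (hα1 : φ₀ α ≠ 1) (hβ0 : 0 < φ₀ β)
    (hφα : ∀ φ : L →ₐ[ℚ] ℂ, ‖φ α‖ ≤ 2 ^ h₁) (hφd : ∀ φ : L →ₐ[ℚ] ℂ, ‖φ d‖ ≤ 2 ^ h₂)
    (hφβ : ∀ φ : L →ₐ[ℚ] ℂ, ‖φ (d * β)‖ ≤ 2 ^ h₂) (hlog : |Real.log (φ₀ β)| ≤ h₂)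
    (hh₁ : 1 ≤ h₁) (hh₂ : 1 ≤ h₂) (hg : 1000 * D ^ 2 ≤ g) (hN : g ^ 3 * h₂ ≤ N)
    (hX : 2 * N * (g ^ 3 * h₁) ≤ 2 ^ g) :
    (1 / 2) ^ (18 * D * (g ^ 5 * h₁ * h₂)) < |N * Real.log (φ₀ α) + Real.log (φ₀ β)| := by
  by_contra! hΛ
  have hD1 : 1 ≤ D := le_trans (Module.finrank_pos (R := ℚ) (M := L)) hD
  have hg1 : 1000 ≤ g := le_trans (by nlinarith) hg
  set w := Real.log (φ₀ α) with hw
  set v := Real.log (φ₀ β) with hv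
  set Λ := N * w + v with hΛdef
  set U := g ^ 5 * h₁ * h₂ with hU
  set S₂ := g ^ 3 * h₁ with hS₂
  set S₁ := g ^ 3 * h₂ with hS₁
  set K := g ^ 4 * h₁ * h₂ with hK
  set l := g ^ 2 with hl
  set X := 2 * N * S₂ with hXdef
  clear_value X K l S₁ S₂ U Λ w v
  have hg0 : 0 < g := by omega
  have hgU : g ≤ U := by
    calc g = g * 1 * 1 := by ring
      _ ≤ g ^ 5 * h₁ * h₂ := by gcongr; exact Nat.le_self_pow (by norm_num) g
      _ = U := hU.symm
  have hgK : g * K = U := by rw [hK, hU]; ring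
  have hKU : K ≤ U := by rw [← hgK]; exact Nat.le_mul_of_pos_left _ hg0
  have hKl : K * l = g * U := by rw [hK, hU, hl]; ring
  have hg3 : g ^ 2 * 1000 ≤ g ^ 3 := by rw [pow_succ g 2]; gcongr
  have hg2N : g ^ 2 * 1000 ≤ N := by
    calc g ^ 2 * 1000 ≤ g ^ 3 * 1 := by omega
      _ ≤ g ^ 3 * h₂ := by gcongr
      _ = S₁ := hS₁.symm
      _ ≤ N := hN
  have hN0 : 0 < N := by have : 0 < g ^ 2 := by positivity
                         omega
  have hS₂1 : 1 ≤ S₂ := by rw [hS₂]; exact Nat.mul_pos (by positivity) hh₁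
  have hX1 : 1 ≤ X := by rw [hXdef]; exact Nat.mul_pos (by omega) hS₂1
  have hUU : 2 * U ≤ 2 ^ U := mul_le_two_pow_of_le (m := 3) (by norm_num) (by norm_num) (by omega)
  have hUsq : U * U ≤ 2 ^ U := by
    have : ∀ n : ℕ, 4 ≤ n → n * n ≤ 2 ^ n := fun n hn ↦ by
      induction n, hn using Nat.le_induction with
      | base => norm_num
      | succ k hk ih => rw [pow_succ]; nlinarith
    exact this U (by omega)
  have hKl2 : K * l ≤ 2 ^ U := by
    rw [hKl]; exact (Nat.mul_le_mul_right U hgU).trans hUsq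
  have hXK : X ^ K ≤ 2 ^ U := by
    rw [← hgK, pow_mul 2 g K]; exact Nat.pow_le_pow_left hX K
  have hDU : U ≤ D * U := Nat.le_mul_of_pos_left _ hD1
  have hNR : (0 : ℝ) < N := by exact_mod_cast hN0
  have hΛU : (U : ℝ) * |Λ| ≤ (1 / 2) ^ (17 * D * U) := by
    have h1 : (U : ℝ) ≤ 2 ^ (D * U) := by
      have : U ≤ 2 ^ (D * U) := le_trans (by omega) (hUU.trans (Nat.pow_le_pow_right (by norm_num) hDU))
      exact_mod_cast this
    calc (U : ℝ) * |Λ| ≤ 2 ^ (D * U) * (1 / 2) ^ (18 * D * U) := by gcongr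
      _ = (1 / 2) ^ (17 * D * U) := by
        rw [show 18 * D * U = D * U + 17 * D * U by ring, pow_add, ← mul_assoc, ← mul_pow]
        norm_num
  have hU1R : (1 : ℝ) ≤ U := by exact_mod_cast (by omega : 1 ≤ U)
  have hΛ1 : |Λ| ≤ 1 := by
    have : (1 / 2 : ℝ) ^ (17 * D * U) ≤ 1 := pow_le_one₀ (by norm_num) (by norm_num)
    nlinarith [abs_nonneg Λ]
  have hwN : N * |w| ≤ 2 * h₂ := by
    have h1 : N * w = Λ - v := by rw [hΛdef]; ring
    have h2 : |N * w| ≤ |Λ| + |v| := by rw [h1]; exact abs_sub _ _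
    rw [abs_mul, Nat.abs_cast] at h2
    have : (1 : ℝ) ≤ h₂ := by exact_mod_cast hh₂
    linarith
  have hwX : (l : ℝ) * |w| * X ≤ 4 * U := by
    calc (l : ℝ) * |w| * X = (N * |w|) * (2 * l * S₂) := by rw [hXdef]; push_cast; ring
      _ ≤ (2 * h₂) * (2 * l * S₂) := by gcongr
      _ = 4 * U := by rw [hl, hS₂, hU]; push_cast; ring
  have hlS₂ : (l : ℝ) * S₂ ≤ U := by
    have : l * S₂ ≤ U := by
      calc l * S₂ = g ^ 5 * h₁ * 1 := by rw [hl, hS₂]; ring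
        _ ≤ g ^ 5 * h₁ * h₂ := by gcongr
        _ = U := hU.symm
    exact_mod_cast this
  obtain ⟨p, hp0, hp, hsmall⟩ := exists_int_exp_poly_small (w := w) (K := K) (l := l) (X := X)
    (U := U) (T := 24 * D * U) (r := 9 * D * U) hX1 hwX hXK hKl2 (by nlinarith) (by
      rw [hKl]
      have e1 : 9 * U + 9 * D * U + 2 ≤ 20 * (D * U) := by nlinarith
      have e2 : K + 24 * D * U ≤ 25 * (D * U) := by nlinarith
      calc _ ≤ 20 * (D * U) * (25 * (D * U)) := Nat.mul_le_mul e1 e2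
        _ = 500 * D ^ 2 * (U * U) := by ring
        _ < g * (U * U) := by
          have : 0 < U * U := by have : 0 < U := by omega
                                 positivity
          have : 500 * D ^ 2 < g := by nlinarith
          gcongr
        _ = U * (g * U) := by ring)
  have hpoly : (fun j : Fin l ↦ ∑ i : Fin K, Polynomial.monomial (i : ℕ) (p i j : L)) ≠ 0 := by
    intro h
    apply hp0
    ext i j
    have h1 := congrArg (fun q ↦ Polynomial.coeff q (i : ℕ)) (congrFun h j)
    simp only [Polynomial.finsetSum_coeff, Polynomial.coeff_monomial, Pi.zero_apply,
      Polynomial.coeff_zero] at h1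
    rw [Finset.sum_eq_single i (fun b _ hb ↦ if_neg fun h ↦ hb (Fin.ext h)) (by simp), if_pos rfl]
      at h1
    exact_mod_cast h1
  have hα00 : α ≠ 0 := fun h ↦ by simp [h] at hα0
  have hβ00 : β ≠ 0 := fun h ↦ by simp [h] at hβ0
  have hK0 : 0 < K := by rw [hK]; positivity
  have hαinj : Function.Injective fun n : ℕ ↦ α ^ n := by
    intro m n hmn
    have h1 : (φ₀ α) ^ m = (φ₀ α) ^ n := by rw [← map_pow, ← map_pow]; exact congrArg φ₀ hmn
    exact pow_right_injective₀ hα0 hα1 h1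
  obtain ⟨s₁, hs₁, s₂, hs₂, hne⟩ := exists_eval_ne_zero_of_box (K := K - 1) (S₁ := S₁) (S₂ := S₂)
    (N := N) hαinj hα00 hβ00 _ hpoly (fun j ↦ by
      refine Polynomial.natDegree_sum_le_of_forall_le _ _ fun i _ ↦ ?_
      refine (Polynomial.natDegree_monomial_le _).trans ?_
      have := i.2; omega) hN (by
      have h1 : l * (K - 1) < l * K := by
        have : 0 < l := by rw [hl]; positivity
        gcongr; omega
      calc l * (K - 1) < l * K := h1
        _ = S₁ * S₂ := by rw [hl, hK, hS₁, hS₂]; ring)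
  set x : ℤ := (s₁ : ℤ) - N * s₂ with hx
  have hxX : |x| ≤ X := by
    have h1 : s₁ ≤ 2 * N := by omega
    have h2 : 2 * N ≤ X := by rw [hXdef]; exact Nat.le_mul_of_pos_right _ hS₂1
    have h3 : N * s₂ ≤ X := by
      rw [hXdef]; exact Nat.mul_le_mul (by omega) hs₂.le
    have h1' : (s₁ : ℤ) ≤ X := by exact_mod_cast h1.trans h2
    have h3' : (N : ℤ) * s₂ ≤ X := by exact_mod_cast h3
    have h4 : (0 : ℤ) ≤ (N : ℤ) * s₂ := by positivity
    rw [abs_le]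
    constructor <;> simp only [hx] <;> omega
  have hs₂l : ∀ j : Fin l, s₂ * (j : ℕ) ≤ l * S₂ := fun j ↦ by
    rw [mul_comm l]; exact Nat.mul_le_mul hs₂.le j.2.le
  set V : L := ∑ i, ∑ j, (p i j : L) * (x : L) ^ (i : ℕ) * (α ^ s₁ * β ^ s₂) ^ (j : ℕ) with hV
  have hV0 : V ≠ 0 := by
    convert hne using 1
    rw [hV, Finset.sum_comm]
    refine Finset.sum_congr rfl fun j _ ↦ ?_
    rw [Polynomial.eval_finsetSum, Finset.sum_mul]
    refine Finset.sum_congr rfl fun i _ ↦ ?_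
    rw [Polynomial.eval_monomial, hx]
    push_cast
    rfl
  set W : L := ∑ i, ∑ j, (p i j : L) * (x : L) ^ (i : ℕ) * (α ^ (s₁ * (j : ℕ)) *
    (d * β) ^ (s₂ * (j : ℕ)) * d ^ (l * S₂ - s₂ * (j : ℕ))) with hW
  have hWV : W = d ^ (l * S₂) * V := by
    rw [hW, hV, Finset.mul_sum]
    refine Finset.sum_congr rfl fun i _ ↦ ?_
    rw [Finset.mul_sum]
    refine Finset.sum_congr rfl fun j _ ↦ ?_
    rw [← Nat.add_sub_cancel' (hs₂l j), pow_add d, Nat.add_sub_cancel_left, mul_pow d, mul_pow,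
      pow_mul α, pow_mul β]
    ring
  have hW0 : W ≠ 0 := by rw [hWV]; exact mul_ne_zero (pow_ne_zero _ hd0) hV0
  have hWint : IsIntegral ℤ W := by
    refine IsIntegral.sum _ fun i _ ↦ IsIntegral.sum _ fun j _ ↦ ?_
    have hz : ∀ n : ℤ, IsIntegral ℤ (n : L) := fun n ↦ isIntegral_algebraMap (x := n)
    exact ((hz _).mul ((hz _).pow _)).mul (((hα.pow _).mul (hβ.pow _)).mul (hd.pow _))
  have hWφ : ∀ φ : L →ₐ[ℚ] ℂ, ‖φ W‖ ≤ 2 ^ (6 * U) := fun φ ↦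
    norm_sum_pow_mul_le φ (hφα φ) (hφd φ) (hφβ φ) hp hX1 hXK hKl2 (S := S₁ + l) (by
      calc (S₁ + l) * l * h₁ = g ^ 5 * h₁ * h₂ + g ^ 4 * h₁ * 1 := by rw [hS₁, hl]; ring
        _ ≤ g ^ 5 * h₁ * h₂ + g ^ 5 * h₁ * h₂ := by
          gcongr
          · omega
        _ = 2 * U := by rw [hU]; ring) (by
      apply le_of_eq; rw [hl, hS₂, hU]; ring) hxX hs₁.le hs₂.le
  let ψ : L →ₐ[ℚ] ℂ := (Complex.ofRealAm.restrictScalars ℚ).comp φ₀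
  have hψ : ∀ y, ‖ψ y‖ = |φ₀ y| := fun y ↦ by
    rw [← Real.norm_eq_abs, ← Complex.norm_real]; rfl
  have hfin := one_le_pow_finrank_mul_norm hWint hW0 (M := 2 ^ (6 * U))
    (one_le_pow₀ (by norm_num)) hD hWφ ψ
  have hd' : ‖ψ (d ^ (l * S₂))‖ ≤ 2 ^ U := by
    rw [map_pow, norm_pow]
    refine (pow_le_pow_left₀ (norm_nonneg _) (hφd ψ) _).trans ?_
    rw [← pow_mul]
    refine pow_le_pow_right₀ (by norm_num) (le_of_eq ?_)
    rw [hl, hS₂, hU]; ring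
  have hVφ : |φ₀ V| ≤ 3 * (1 / 2) ^ (8 * D * U) := by
    have hz : (l : ℝ) * |s₂ * Λ| ≤ U * |Λ| := by
      rw [abs_mul, Nat.abs_cast, ← mul_assoc]
      have : (s₂ : ℝ) ≤ S₂ := by exact_mod_cast hs₂.le
      refine mul_le_mul_of_nonneg_right (le_trans ?_ hlS₂) (abs_nonneg _)
      gcongr
    have hs := hsmall x (s₂ * Λ) hxX (hz.trans (hΛU.trans
      (pow_le_one₀ (by norm_num) (by norm_num))))
    have e1 : φ₀ V = ∑ i, ∑ j, (p i j : ℝ) * (x : ℝ) ^ (i : ℕ) *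
        Real.exp (x * w + s₂ * Λ) ^ (j : ℕ) := by
      have e2 : Real.exp (x * w + s₂ * Λ) = φ₀ α ^ s₁ * φ₀ β ^ s₂ := by
        have : (x : ℝ) * w + s₂ * Λ = s₁ * w + s₂ * v := by
          rw [hx, hΛdef]; push_cast; ring
        rw [this, Real.exp_add, Real.exp_nat_mul, Real.exp_nat_mul, hw, hv, Real.exp_log hα0,
          Real.exp_log hβ0]
      rw [e2, hV]
      simp only [map_sum, map_mul, map_pow, map_intCast]
    rw [e1]
    refine hs.trans ?_
    have t1 : ((K : ℝ) + (24 * D * U : ℕ)) * (1 / 2) ^ (9 * D * U) ≤ (1 / 2) ^ (8 * D * U) := by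
      have h1 : K + 24 * D * U ≤ 2 ^ (D * U) := by
        have := mul_le_two_pow_of_le (c := 25) (n := D * U) (m := 8) (by norm_num) (by norm_num)
          (by omega)
        nlinarith
      have h2 : (K : ℝ) + (24 * D * U : ℕ) ≤ 2 ^ (D * U) := by exact_mod_cast h1
      calc _ ≤ (2 : ℝ) ^ (D * U) * (1 / 2) ^ (9 * D * U) := by gcongr
        _ = _ := by
          rw [show 9 * D * U = D * U + 8 * D * U by ring, pow_add, ← mul_assoc, ← mul_pow]
          norm_num
    have t2 : (2 : ℝ) ^ (3 * U) * (2 * (1 / 2) ^ (24 * D * U)) ≤ (1 / 2) ^ (8 * D * U) := by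
      have h1 : (2 : ℝ) ^ (3 * U) * 2 ≤ 2 ^ (16 * D * U) := by
        rw [← pow_succ]
        exact pow_le_pow_right₀ (by norm_num) (by nlinarith)
      calc _ = (2 : ℝ) ^ (3 * U) * 2 * (1 / 2) ^ (24 * D * U) := by ring
        _ ≤ 2 ^ (16 * D * U) * (1 / 2) ^ (24 * D * U) := by gcongr
        _ = _ := by
          rw [show 24 * D * U = 16 * D * U + 8 * D * U by ring, pow_add, ← mul_assoc, ← mul_pow]
          norm_num
    have t3 : (2 : ℝ) ^ (9 * U) * (2 * (l * |s₂ * Λ|)) ≤ (1 / 2) ^ (8 * D * U) := by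
      have h2 : (U : ℝ) * |Λ| ≤ U * (1 / 2) ^ (18 * D * U) := by gcongr
      have h3 : (2 : ℝ) * U ≤ 2 ^ U := by exact_mod_cast hUU
      calc _ ≤ (2 : ℝ) ^ (9 * U) * (2 * (U * (1 / 2) ^ (18 * D * U))) := by
            refine mul_le_mul_of_nonneg_left ?_ (by positivity)
            exact mul_le_mul_of_nonneg_left (hz.trans h2) (by norm_num)
        _ = (2 : ℝ) ^ (9 * U) * (2 * U) * (1 / 2) ^ (18 * D * U) := by ring
        _ ≤ 2 ^ (9 * U) * 2 ^ U * (1 / 2) ^ (18 * D * U) := by gcongr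
        _ = 2 ^ (10 * U) * (1 / 2) ^ (18 * D * U) := by rw [← pow_add]; congr 2; ring
        _ ≤ 2 ^ (10 * D * U) * (1 / 2) ^ (18 * D * U) := by
            gcongr
            · norm_num
            · nlinarith
        _ = _ := by
          rw [show 18 * D * U = 10 * D * U + 8 * D * U by ring, pow_add, ← mul_assoc, ← mul_pow]
          norm_num
    linarith
  have hlt : ((2 : ℝ) ^ (6 * U)) ^ D * ‖ψ W‖ < 1 := by
    rw [hWV, map_mul, norm_mul, hψ V]
    calc _ ≤ ((2 : ℝ) ^ (6 * U)) ^ D * (2 ^ U * (3 * (1 / 2) ^ (8 * D * U))) := by gcongr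
      _ = 2 ^ (6 * D * U) * 2 ^ U * 3 * (1 / 2) ^ (8 * D * U) := by
          rw [← pow_mul, show 6 * U * D = 6 * D * U by ring]; ring
      _ < 2 ^ (6 * D * U) * 2 ^ U * 2 ^ U * (1 / 2) ^ (8 * D * U) := by
          gcongr
          have : (2 : ℝ) ^ 2 ≤ 2 ^ U := pow_le_pow_right₀ (by norm_num) (by omega)
          linarith
      _ = 2 ^ (6 * D * U + U + U) * (1 / 2) ^ (8 * D * U) := by rw [pow_add, pow_add]
      _ ≤ 2 ^ (8 * D * U) * (1 / 2) ^ (8 * D * U) := by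
          gcongr
          · norm_num
          · nlinarith
      _ = 1 := by rw [← mul_pow]; norm_num
  linarith

def artanhLower (S x : ℕ) : ℕ → ℕ → ℕ
  | 0, _ => 0
  | n + 1, k => S / (2 * k + 1) + x * artanhLower S x n (k + 1) / S

def artanhUpper (S x : ℕ) : ℕ → ℕ → ℕ
  | 0, _ => 2 * S
  | n + 1, k => S / (2 * k + 1) + x * artanhUpper S x n (k + 1) / S + 2

noncomputable def artanhTail (x : ℝ) (k : ℕ) : ℝ := ∑' m : ℕ, x ^ m / (2 * (k + m) + 1)

theorem summable_artanhTail {x : ℝ} (hx : 0 ≤ x) (hx1 : x < 1) (k : ℕ) :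
    Summable fun m : ℕ ↦ x ^ m / (2 * (k + m) + 1 : ℝ) := by
  refine Summable.of_nonneg_of_le (fun m ↦ by positivity) (fun m ↦ ?_)
    (summable_geometric_of_lt_one hx hx1)
  refine div_le_self (by positivity) ?_
  have : (0 : ℝ) ≤ k + m := by positivity
  linarith

theorem artanhTail_nonneg {x : ℝ} (hx : 0 ≤ x) (k : ℕ) : 0 ≤ artanhTail x k :=
  tsum_nonneg fun m ↦ by positivity

theorem artanhTail_le_two {x : ℝ} (hx : 0 ≤ x) (hx1 : x ≤ 1 / 2) (k : ℕ) :
    artanhTail x k ≤ 2 := by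
  have hx2 : x < 1 := by linarith
  calc artanhTail x k ≤ ∑' m : ℕ, x ^ m := by
        refine (summable_artanhTail hx hx2 k).tsum_le_tsum (fun m ↦ ?_)
          (summable_geometric_of_lt_one hx hx2)
        refine div_le_self (by positivity) ?_
        have : (0 : ℝ) ≤ k + m := by positivity
        linarith
    _ = (1 - x)⁻¹ := tsum_geometric_of_lt_one hx hx2
    _ ≤ 2 := by
        rw [inv_le_comm₀ (by linarith) (by norm_num)]
        linarith

theorem artanhTail_eq {x : ℝ} (hx : 0 ≤ x) (hx1 : x < 1) (k : ℕ) :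
    artanhTail x k = 1 / (2 * k + 1) + x * artanhTail x (k + 1) := by
  rw [artanhTail, (summable_artanhTail hx hx1 k).tsum_eq_zero_add, artanhTail, ← tsum_mul_left]
  congr 1
  · simp
  · refine tsum_congr fun m ↦ ?_
    push_cast
    rw [pow_succ']
    ring

theorem div_lt_natCast_div_add_one {a b : ℕ} (hb : 0 < b) :
    (a : ℝ) / b ≤ ((a / b : ℕ) : ℝ) + 1 := by
  rw [div_le_iff₀ (by exact_mod_cast hb)]
  have h := (Nat.lt_mul_div_succ a hb).le
  calc (a : ℝ) ≤ ((b * (a / b + 1) : ℕ) : ℝ) := by exact_mod_cast h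
    _ = _ := by push_cast; ring

theorem artanhLower_le {S x' : ℕ} (hS : 0 < S) {x : ℝ} (hx1 : x < 1) (hx' : x' ≤ S * x)
    (n k : ℕ) : artanhLower S x' n k ≤ S * artanhTail x k := by
  have hS' : (0 : ℝ) < S := by exact_mod_cast hS
  have hx : 0 ≤ x := by
    by_contra! h
    have : (x' : ℝ) < 0 := hx'.trans_lt (mul_neg_of_pos_of_neg hS' h)
    exact absurd (Nat.cast_nonneg x') (not_le.mpr this)
  induction n generalizing k with
  | zero => simpa [artanhLower] using mul_nonneg hS'.le (artanhTail_nonneg hx k)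
  | succ n ih =>
    rw [artanhLower, artanhTail_eq hx hx1, mul_add, Nat.cast_add]
    refine add_le_add ?_ ?_
    · refine Nat.cast_div_le.trans (le_of_eq ?_)
      push_cast; ring
    · refine Nat.cast_div_le.trans ?_
      rw [div_le_iff₀ hS']
      push_cast
      calc (x' : ℝ) * artanhLower S x' n (k + 1) ≤ (S * x) * (S * artanhTail x (k + 1)) := by
            gcongr; exact ih (k + 1)
        _ = _ := by ring

theorem le_artanhUpper {S x' : ℕ} (hS : 0 < S) {x : ℝ} (hx : 0 ≤ x) (hx1 : x ≤ 1 / 2)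
    (hx' : S * x ≤ x') (n k : ℕ) : S * artanhTail x k ≤ artanhUpper S x' n k := by
  have hS' : (0 : ℝ) < S := by exact_mod_cast hS
  induction n generalizing k with
  | zero =>
    simp only [artanhUpper, Nat.cast_mul, Nat.cast_ofNat]
    nlinarith [artanhTail_le_two hx hx1 k]
  | succ n ih =>
    rw [artanhUpper, artanhTail_eq hx (by linarith), mul_add]
    have h1 : (S : ℝ) * (1 / (2 * k + 1)) ≤ ((S / (2 * k + 1) : ℕ) : ℝ) + 1 := by
      refine le_trans (le_of_eq ?_) (div_lt_natCast_div_add_one (by positivity))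
      push_cast; ring
    have h2 : (S : ℝ) * (x * artanhTail x (k + 1)) ≤
        ((x' * artanhUpper S x' n (k + 1) / S : ℕ) : ℝ) + 1 := by
      refine le_trans ?_ (div_lt_natCast_div_add_one hS)
      rw [le_div_iff₀ hS']
      push_cast
      calc (S : ℝ) * (x * artanhTail x (k + 1)) * S = (S * x) * (S * artanhTail x (k + 1)) := by ring
        _ ≤ x' * artanhUpper S x' n (k + 1) := by
          gcongr
          · exact mul_nonneg hS'.le (artanhTail_nonneg hx _)
          · exact ih (k + 1)
    push_cast at h1 h2 ⊢
    linarith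

theorem Real.log_sub_log_eq_artanhTail {t : ℝ} (ht : 0 ≤ t) (ht1 : t < 1) :
    Real.log (1 + t) - Real.log (1 - t) = 2 * t * artanhTail (t ^ 2) 0 := by
  have h := Real.hasSum_log_sub_log_of_abs_lt_one (by rwa [abs_of_nonneg ht])
  rw [← h.tsum_eq, artanhTail, ← tsum_mul_left]
  refine tsum_congr fun m ↦ ?_
  rw [Nat.cast_zero, zero_add, ← pow_mul, pow_succ]
  ring

def logLower (S n a b : ℕ) : ℕ :=
  2 * (S * (a - b) / (a + b)) * artanhLower S ((S * (a - b) / (a + b)) ^ 2 / S) n 0 / S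

def logUpper (S n a b : ℕ) : ℕ :=
  2 * (S * (a - b) / (a + b) + 1) *
    artanhUpper S ((S * (a - b) / (a + b) + 1) ^ 2 / S + 1) n 0 / S + 1

theorem log_div_bounds {S n a b : ℕ} (hS : 0 < S) (hb : 0 < b) (hba : b ≤ a) (hab : a ≤ 2 * b) :
    (logLower S n a b : ℝ) ≤ S * Real.log (a / b) ∧
      S * Real.log (a / b) ≤ logUpper S n a b := by
  have hS' : (0 : ℝ) < S := by exact_mod_cast hS
  have hb' : (0 : ℝ) < b := by exact_mod_cast hb
  have hba' : (b : ℝ) ≤ a := by exact_mod_cast hba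
  have hab' : (a : ℝ) ≤ 2 * b := by exact_mod_cast hab
  set t : ℝ := (a - b) / (a + b) with ht
  have ht0 : 0 ≤ t := div_nonneg (by linarith) (by linarith)
  have ht1 : t ≤ 1 / 2 := by
    rw [ht, div_le_iff₀ (by linarith)]; linarith
  have hx1 : t ^ 2 ≤ 1 / 2 := by nlinarith
  have hlog : Real.log (a / b) = 2 * t * artanhTail (t ^ 2) 0 := by
    rw [← Real.log_sub_log_eq_artanhTail ht0 (by linarith),
      ← Real.log_div (by linarith) (by linarith)]
    congr 1
    have h1 : (1 : ℝ) + t = 2 * a / (a + b) := by rw [ht]; field_simp; ring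
    have h2 : (1 : ℝ) - t = 2 * b / (a + b) := by rw [ht]; field_simp; ring
    rw [h1, h2]
    have : (a : ℝ) + b ≠ 0 := by linarith
    field_simp
  set τ : ℕ := S * (a - b) / (a + b) with hτ
  have hSt : ((S * (a - b) : ℕ) : ℝ) / ((a + b : ℕ) : ℝ) = S * t := by
    rw [ht]; push_cast [Nat.cast_sub hba]; ring
  have hτ1 : (τ : ℝ) ≤ S * t := by rw [← hSt]; exact Nat.cast_div_le
  have hτ2 : S * t ≤ (τ : ℝ) + 1 := by rw [← hSt]; exact div_lt_natCast_div_add_one (by omega)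
  have hT := artanhTail_nonneg (sq_nonneg t) 0
  rw [hlog]
  constructor
  · have hx : ((τ ^ 2 / S : ℕ) : ℝ) ≤ S * t ^ 2 := by
      refine Nat.cast_div_le.trans ?_
      rw [div_le_iff₀ hS']
      push_cast
      calc (τ : ℝ) ^ 2 ≤ (S * t) ^ 2 := by gcongr
        _ = _ := by ring
    have h := artanhLower_le hS (by linarith) hx n 0
    rw [logLower]
    refine Nat.cast_div_le.trans ?_
    rw [div_le_iff₀ hS']
    rw [← hτ]
    push_cast
    calc 2 * (τ : ℝ) * artanhLower S (τ ^ 2 / S) n 0 ≤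
          2 * (S * t) * (S * artanhTail (t ^ 2) 0) := by gcongr
      _ = _ := by ring
  · have hx : S * t ^ 2 ≤ (((τ + 1) ^ 2 / S + 1 : ℕ) : ℝ) := by
      refine le_trans ?_ ((div_lt_natCast_div_add_one hS).trans (by push_cast; rfl))
      rw [le_div_iff₀ hS']
      push_cast
      calc S * t ^ 2 * S = (S * t) ^ 2 := by ring
        _ ≤ ((τ : ℝ) + 1) ^ 2 := by gcongr
    have h := le_artanhUpper hS (sq_nonneg t) hx1 hx n 0
    rw [logUpper, ← hτ]
    refine le_trans ?_ ((div_lt_natCast_div_add_one hS).trans (by push_cast; rfl))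
    rw [le_div_iff₀ hS']
    push_cast at h ⊢
    calc S * (2 * t * artanhTail (t ^ 2) 0) * S = 2 * (S * t) * (S * artanhTail (t ^ 2) 0) := by ring
      _ ≤ 2 * ((τ : ℝ) + 1) * artanhUpper S ((τ + 1) ^ 2 / S + 1) n 0 := by
        gcongr

def rootNum : Fin 4 → ℤ := ![
  (-3834649030484305547770929321270280601766323972145281572877844845209571287353120740678753877842285797909619857547359914035093839536140195575718581932392364032279968072012363274206080648424734866009228065913936716430391870104468323768036740301197105484222828840105679589626719937314683385137440146199631716310164621513087323284048519544881953755695726078774305601415380483978678756404188981454340314705283776938618949102304847594946519783055670986386003389554892635248959735872282198378543927182823823470920373236758175678520437538068387829369712157947624157314036468992100983815623546916305691776723448844873924562743934721549493272124998857303741393759857795250184691706622683908522571038976861702231280058992646283183399002741709347788440450531794192987871624759644258036212760450381003001396934615294519681935196274343611780485798165445288171366235693739913878329864012819180086599980099609),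
  (-558757404144321585312257895950634731104065981009352023204472244229795173450556720350974300049487183014150530102887751450551019324230721509685561895329226565910507989399777725131067752527964711564329925468134678595825083721248850958573370592171568846288808023021865835509896175236344157776115985286075934816823295365076105118014372597310834132564820005352226906302928895625926606765280671155897638430815123148644595524586508436224398725131692879969436165069590680560671671863360541003796974710503971476169847549800186524789968504813790628806430842412372597384764718713993024660821823686684104509267000867988315319472635850533432063505696480207889762131152999399222174884888811257385472022747724350696276607241606138952206108814888818346077839921195770868628104326278020968483923253864041313274425738325902755203487309430221429388881136000912220919551793828409442830210114709646971647023371030),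
  3086015715478538796725419211885548231565173011948495761087978715760001189655046232891666155167212900673651867381059698071109318520291032251203837996054853825058188550872151706490466602529765385964508440243523287555959708168742236509352795768376114403568625127569442644862827823223976852204426505064517270608920825812750633776644152736686181953668902442944493997025628830399082054841922738413741857763709232633249093974604002356403065935960059183607723163669282033746479349034121697882523557045604399100895714242964332470956723457446268690742920378247928684972462364078209897778311728740510957659814442089688801811963520043757394962238389922089074885940852761953329209061078371637899418375756760045161472855037071797149882214716902529852799316568134767083469068278616665930939610396147508603315046723622079611704925410299415261329333627608406249274200000662873438810752737808542206605558133894,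
  11377395455567242128697171776492936956951819260992011315112820505809275954666347088152785726211067678897219454233496031453146111516988710900652164563144701039796412456870587939953726288864852435844855159978032231714511940043850605405179011451948252084823260158598101883567856585622876537221851758057410319307224298914513858196553574362944442737205957089734463018047324908227367190339032384177307985083567011334420060436959330566270924973995756927290096651278833779252052980425837058032187007726793827922519080859713020858262366765229488399762541994996327497836434919405951219550098856990748962146457559096448786457928413213976005740143695566242149310848654976849786221602854342922231399906883673276605539698137211245714594427068930358601158178850364828050042778568268443255776355232910883464447297249135165490358920989339871368713784379425548314140651845358885893109990551132738317864577615526]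

def lnTwoNum : ℤ :=
  672686770413940223073148271595900068805576453682553244347033366695953597001340530792703067514758805818412015788951046947403908103624604074895153218420571229933589527513711262788976977022038229011259626027654610875259928239728332234485709876141284060383468915322346555753676648640187211463658773273040339251317700533993542064383454655339626288261531932159039529658910712588724594788758455086746362670150092051973069023346683834756981427058604672064204904706908308217728959923472650415363399292243013120748680967029583488802104403346953535078292868231432281458298912112633886748662186797582330996147514381287746167172419433082965755097311325273385504435345036088538105206320402661798478688887098963539571754083281582980871721590769265665878352858383959894946908812009581651172242970073091227348029985204120580012736574326733150500312350057222018834272308486683638729511295086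

def unitLogNum : Fin 4 → Fin 3 → ℤ := ![
  ![1715026663800569005104065902649178409686360869817155255065844425819729262464425261516447153796358365175392701978121511476799212781184369484827327238671254752090574074403859745041524902374401252144352825276067382640309111651155083911590508520346680117295929432964943812858783579854726330658034933902508420170162868490940190106084149384103180690594654140059737901424040624807132631339415658615102139496908543310709773299787131905781997894865140981653693038893949024174192590517283242184988671799731634984977852513041529865489900448210587786708629996694250112166493124492393905567968181701778874264886593804554774190487165086473221302338135551692431679486559231263088556558684199439640481712936484245030917732394235200805482971854635979797870789349727936806782065176720402867078150683705091509175543471634258649579052783284600281559425857403889047358548321425896089775705500170,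
    (-16555300885635652672911543663917864653709172425845945066276936284578733253342157167965449666285215187430918451759686260158751444379384155583551111894850480039552222999511725525079066776530514592504461360366573844640676954997950488806652430829325239555643674280731221036340527557863789266703320772700688714527540584155922428617626765861072258405615381354882124718184182970708751972138126769169042508543014809265063998572965496583479821028093252831664109920359959029707813646854831371352951917400002951169607669337785302178786605648580905688293925130074390555641818872044050003584405114339151059399497225071493597413168047089853463443837071222621779616767824398487544425101586330487558011058218011378054119256334397269930590351544989112297989817329028193031475417027560650910792745862985419544185367900782942386023891311930454039885463628725612783978714292498666611355414618304),
    10234871228923664087917982397423696571781413258287430657247516078146647011983353289785076880365670465912778281362048069797682671941220769773317750949709934827920444547580113906052859299790517734885841768598071570737982445311128448792672182952547332504448705292554744217671355144597127442684322644593964119567008971455893152426670553319574823781336035352314064213723801736844676583419980786565952932069741265523869486506266015491608261477166791738666445302422598361269226845280928964501952023105226775914648815647436198034757620027657547466356352260580154719124905821298852585621551458539631361816575318686513906119317486680904648138706868687932482276546894881330166682533317600834978907133325283495688723363497624585171791342125782590447501873891319161749519209192341440703122878055968303139262954560391707187231063229139870416840864717920414522231925310533817383522803778798],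
  ![(-6504095820085521167777239837798970676717816288896755507078490319188264736416104279528535685360642041659599959890061888707429147789132560448679252646494063722691274622795069769575953335564065831488354087112967459680324340354213561313326594261158805612756644117675775705027779717787736194121470689001079788340130648724247965749380372046270184638456439973368107240157078682350990260311139274392556921827890371600108358642762682044308938019440344841574322631049474308899948750549043192766922636428613241611273110263594245180424872131477071022805454179980478032743159503287085122547777187846005703325687143277339330482308992516028997197161905049894086601500335239358540425473857845343570102942431556948330689894740055073429738669028404606536048006184506305709300971733470872091260051494570013069892282040615480436692891976057424127928127328042747029707920986202720368196832207842),
    424729540407934496596669435030163568512015565361887465138671251813270297015750436817935445627993123506671217658408709747512338736834519819606234529448513052527065683953289187973178935022628186397162834146130015017132287145562668614150322384712101283340808778762697804247730101557422212960680728252240529004119280242371625619581306114570034725204812669594982259975026023720567941376014322325780828269977677543931837102605185102265981839740346861765272099260525556696352602503821536860086096438026413649701558984147717824235629456901870705872498332525169952168660392647972299812789571301666918197573792456889147526400942849656728638779154116686515153573473323029611711837285844731956856360629522118006842988559057561153296903570146877422222637076110127874943954122663656137086430591548610193764057677735687169139400015696249827196433031784152881206883299811011404131291892598,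
    (-1390449626292530895635469155855696061655287218259698506485690515950076177447657251071816996099490953800391032699080676333389904651237199936274148819760240147489279378075106124493342301856629369688283433713992177539467138367747023244075736153229132610667512306376942034791671432987604669526101361087922845539441707145373641126474389375945479472888134859303985340657820791083328537268611552802904088952375670954185326587871303545506025735251502414982540519054538266576743144564762796417989780537176281746087855573199213540987618059974775401870966534035644482757246771523221717419212355960824108083322252726925985776899806113507943240364580926977625039605984192958950037217879483386473686361113067190862919103066088994068417928412215084124854403295873440284085925487081580047435114115579270321843749034308952275636055743392908918063046400079333866078420986829067862824341584220)],
  ![1818967618469518167475092348357197507882114491617892921785448011938186750912847610374498225799140955276551781834192616851854117289200606048966615676479936209201164202089907304882191215959426946382158158003597445932602141924460980453609808917766124921176157532805177710959591253257247466384667736095340165627484426172498417810691586034235655917292230778319580229664496340823479558748318630610924760231270402844602790656261280400119238936691779317165891734973279226888939257250062779529772639661860703796531915781518152790556847988017081597436313401853109055163068568805297134158895771261612804280152751197086400757918430407132456035495761318698640894904669890712706568962504856728752871993075430142731204499567860959859605117429878336505839001186269920884418227687156619804676683474939376789775941549670634171296815407819914681600139723085519397038043994123052247130667084010,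
    5802194122665910756634046497632186930780748272813804148751231363220598574061448074634321603596780169960240360458649941620071805741772864529832256283571979850225027134772791794541209975434816489272096513824359139143497396251216675391258462505731720366023488101799959411406441596047533971940355140679684319829488175818536794648956477416245671564522282865512499617492942755477448955387686918594470760006286811961799230633617996746425407616565826669830183215349781694333390479786470696058808665509850988074689370388040828105362868993128559045170268124681216741713582705483339127761445382530207062446193601918722676926695138560422554655498756875971215555621867658992241762600909465534742195130950585038700319764877869702938629926143500936416089495870778983159114383018551675675460254029232772289271549736939924536455873122829346929828506896946653682754377732027569977408758904070,
    (-16362667795439502654879280101225322468697096543890922300477967832727477801260776847612545321670932443329239917078772483025147038025271879548205828158145640494128950815344487424878076808278999805257510449547272754527481192904208083939488127370881127700146151218019873395129931999674924078702391164528320373352637355798561005274119058376125828525627687577202351024309909597503477809815890503651586968803170668506437312215165987195997364048472629233230600378545428986350008409247249153204074432753323718411568152672199252269727604507211487390737005779987848477107487533752499439168076738190816055292091287714187271442402614550962508871171903606227661901184998086885140472891630619725057580255043662679375459149016512725653448623433299638525238720830902392472754210106897084243057264590152622718866709078102974184198102829553115366423109319824732058476530127145138895714469054682)],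
  ![2970101537815433995198081586792594759149340927461707330227197881430348723038831407637590305765142721207655476077747760378775817718747584914885309731342872761399536346301302719652237217230237632961843103833302631107413086778597496948126276823046000574284557151905654181209404884675762397078768019003231202542483354060809357832604636627931348030569555054988789109068541716720378070223404985166530022099711425444795794686714269738407701187883424542754737857182246057836816902781697171052161324967020902829763341969034562524378123695249401638660510781433118865413597809989394082820913234882614024780647798275698155533903397022423319859328008179503014027109106117382745299952668789175176749236419642560568567662777958912764650579743890290232338215648508448018100678869593849419505217335925544770940797019310587615817023784952909164768561747553338585311328670653772031290459623278,
    10328377222561807419680827731255514154416408587670253452387033669544864382264958656513192617060441893964006873642627608791167299900776771234112621081829987136800130180785644542564677866073069916835202012396084690480047271601171144801243645938881417906279377400168563820686355860258833081802284903768763865693933128095014008349088982330256552115888285819774642840716214191510735075374425528248790920266750319759332930836742314734788431571787079300068654605749651778678070564564539138434057155452125549445216739965596756249188107198550475937251158672868003861759575773912738576010170160507277078755729830695881772960071965679774180149559160229964048907572483416465690950663391020220858959566637904221346956502897470005838663521831341298459677684382139081997417079886345319098246061242204037061149760486107330680428618173404857282860523699994806220017453260660085229815363821216,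
    7518246192808369462596766859657321958570970503863190149716142270530906966725080808899285437404752931216852668415805089560854270735288309711162226028195945813697785645839479643318559810345111440059952114663193361328965885960826658390891680571562927806364958231842071212250248288065401305544169881022279099325070091488041493973922894432496484217179787084192272151243928651742129763664521269888538125685805073936753152296771275249895128306557339909546695595177368891657524708531082985120112190185273224243007192597962267775957602539528715326251620053443338240739828483976868570965737635612008801558838221754599351099984933983565803972829615845272804664244087398513923827576192502276552359482831446374549654888584977134550075209719732132202591250235456671007320926401637223587369500649763589901447503552020219272603095343806153867645291001983651402323025803440389375016006859698]]

def rootDiffLogNum : Fin 4 → Fin 4 → ℤ := ![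
  ![0,
    1042543528176395217482192438791115121329528111150049864079700377804439023343677775427869216879875520082824993087327085836163650866890267573464146672643675334461022373204902377104395313447618589120431631696497399758211708765551712626400704487485752696874771760333873129936467056669153876228107568994049758811161984861594061399166243095736031377019368655222990050349815811684116428641260577209114437162874683675861519367413465356258102133965765969471654758281873810400306554918106782238829089061975665131497778440682787143258283625788042988387808528887472206775447762860441081434343198404599775201319403784799453407554994310452781124065055840883803180506618462389649413016340306531752702198098857023710198554576953520614828995875007558402163491224043531075489765276752729246673795881565124099382689483415892322788630144445274438888843785732976496800280867878682189794813621612,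
    1768388017495695312420273918666032255889879113229271027036956623479193012878876950492692269892122739962270220557224714598205958408859966655621797526432994372641147163698663751718784296031743502399035291177641390068345071329648980855806321092232540024111815546377363797436474126846495927585272652055100420098948265655489234177148025582555492364882302284508855605641850483849721739592599489773567242595876196673681229760304229713895766330667590208234824134390830703895001118389975840448390934442439388701796005964431159264156899936586985045255963616047017136042516296615295326066857423200692546058045070382697415374317999920902012503679839748506652360859031144867374982934773343980004995083707904645839801993275949381797667453404234867192840494681417365216651859962194529486759103204486007599056037299243475705462518642630476564451911909236097413197402230133481464513508877916,
    2532715942077405196692372836313330408398333192277023346575025742912521848570582907495211744340761824835931574859585223258236407558612691597805333580723566898346024706957403692421466750770653117439963087620905251407381092280592529204286736739841084235119636332970926305124640853874000484637567885462140977742663684291084165307121563312426661426415397717504784538038285423798952276754646979961727073405827987979128105592681698076023659379854550492867636336234639906053281553819208107635255489168084366870686873018326929558879973972546271801005199176899183359853741332917604576952680908646406052391046731304918747321103952488635837650216410534767587803655400980173400942060248885840423691518473423510649820110710290832763152687832909060230452040019170909483544470934600837530429873655448639191587703120077954883642501307333189926189231600204900758927879841181169354532649239568],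
  ![1042543528176395217482192438791115121329528111150049864079700377804439023343677775427869216879875520082824993087327085836163650866890267573464146672643675334461022373204902377104395313447618589120431631696497399758211708765551712626400704487485752696874771760333873129936467056669153876228107568994049758811161984861594061399166243095736031377019368655222990050349815811684116428641260577209114437162874683675861519367413465356258102133965765969471654758281873810400306554918106782238829089061975665131497778440682787143258283625788042988387808528887472206775447762860441081434343198404599775201319403784799453407554994310452781124065055840883803180506618462389649413016340306531752702198098857023710198554576953520614828995875007558402163491224043531075489765276752729246673795881565124099382689483415892322788630144445274438888843785732976496800280867878682189794813621612,
    0,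
    1146097859261376469174807771369293608202963316411951196105738115706372328613629177910896904147008422485943387213950795957776325425426525194955448070906972232632546074001695021777801378622266471008583990493386151703593096162814396191778254192757706009353733384517681629510649358768185086258369989854657637867413939281818443021590981946220960202036604628181046832876460169585513766288104107280202283839137914788170050756284593555096320433420231197235623000588879537405784513758223171477619506441103452212919750474503418586236262979713823951367575122418681036868868024868264585701751882964471786706620507196132450995696310951394725206261887950539160048613661360310431699913380264604265652144718707086368475728805933423856495577176878365222043202845000274776139850029676944740246679520527096126628109212083972524036322391171700629964607675209967677197950905412575857132139475510,
    2297358887058356190066510372023413534027034253751110890009720021168377464341029154838699890165228785968481294497873709824521883971177089817361495257302825911634235358807896685298800039845554378324080477539644894119671522856524543362149914695919816428570794567402347376405918339826213397561763401394570190962521807791696588297925545475641957693418315017454030982861438891780364593896483638669249322468750690654661575691555871877595893167322199774384820124707819249209142108606618455104704647898609403261239603756242879308470377653638216458712319411987725438504053250967858319572099837709071811929917482033295110356008259311930080707533500423253711905765739990433804946606815319203915170020930091283497047149458042534692528431310147469895122936125106154555307583276894506984765761381934309875786078535156562718110142510982160650240209444739213455880584982267434360103700300866],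
  ![1768388017495695312420273918666032255889879113229271027036956623479193012878876950492692269892122739962270220557224714598205958408859966655621797526432994372641147163698663751718784296031743502399035291177641390068345071329648980855806321092232540024111815546377363797436474126846495927585272652055100420098948265655489234177148025582555492364882302284508855605641850483849721739592599489773567242595876196673681229760304229713895766330667590208234824134390830703895001118389975840448390934442439388701796005964431159264156899936586985045255963616047017136042516296615295326066857423200692546058045070382697415374317999920902012503679839748506652360859031144867374982934773343980004995083707904645839801993275949381797667453404234867192840494681417365216651859962194529486759103204486007599056037299243475705462518642630476564451911909236097413197402230133481464513508877916,
    1146097859261376469174807771369293608202963316411951196105738115706372328613629177910896904147008422485943387213950795957776325425426525194955448070906972232632546074001695021777801378622266471008583990493386151703593096162814396191778254192757706009353733384517681629510649358768185086258369989854657637867413939281818443021590981946220960202036604628181046832876460169585513766288104107280202283839137914788170050756284593555096320433420231197235623000588879537405784513758223171477619506441103452212919750474503418586236262979713823951367575122418681036868868024868264585701751882964471786706620507196132450995696310951394725206261887950539160048613661360310431699913380264604265652144718707086368475728805933423856495577176878365222043202845000274776139850029676944740246679520527096126628109212083972524036322391171700629964607675209967677197950905412575857132139475510,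
    0,
    1943758519302713669332704438841728208884001000836121265165999265845313966135072326328194937269452482086633383000492978857120903748254315490771174832970096242950677025305810952820819906608021912880508181220509424574689818452984407128433480125278374838108858966392480595644036708282841240841497082758354698416089095153162587061614084745832264121438158452546049631631225498051279030188739299829399832674591786540211945581188520693343972612306326168582927557454588100005038110014820212003660792032788799720129175821615561495611017551916636625995410497323260536095542152071326421409071730778745154573493558318988401598119111415229755283895234288440602404057527099702988857625803134165263237746802048904304156142962768286411422923423319842321823181945865008350298006821582655381317187500933381230774250363246685346543754216177449356224568785492972553460462811914820700149259922238],
  ![2532715942077405196692372836313330408398333192277023346575025742912521848570582907495211744340761824835931574859585223258236407558612691597805333580723566898346024706957403692421466750770653117439963087620905251407381092280592529204286736739841084235119636332970926305124640853874000484637567885462140977742663684291084165307121563312426661426415397717504784538038285423798952276754646979961727073405827987979128105592681698076023659379854550492867636336234639906053281553819208107635255489168084366870686873018326929558879973972546271801005199176899183359853741332917604576952680908646406052391046731304918747321103952488635837650216410534767587803655400980173400942060248885840423691518473423510649820110710290832763152687832909060230452040019170909483544470934600837530429873655448639191587703120077954883642501307333189926189231600204900758927879841181169354532649239568,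
    2297358887058356190066510372023413534027034253751110890009720021168377464341029154838699890165228785968481294497873709824521883971177089817361495257302825911634235358807896685298800039845554378324080477539644894119671522856524543362149914695919816428570794567402347376405918339826213397561763401394570190962521807791696588297925545475641957693418315017454030982861438891780364593896483638669249322468750690654661575691555871877595893167322199774384820124707819249209142108606618455104704647898609403261239603756242879308470377653638216458712319411987725438504053250967858319572099837709071811929917482033295110356008259311930080707533500423253711905765739990433804946606815319203915170020930091283497047149458042534692528431310147469895122936125106154555307583276894506984765761381934309875786078535156562718110142510982160650240209444739213455880584982267434360103700300866,
    1943758519302713669332704438841728208884001000836121265165999265845313966135072326328194937269452482086633383000492978857120903748254315490771174832970096242950677025305810952820819906608021912880508181220509424574689818452984407128433480125278374838108858966392480595644036708282841240841497082758354698416089095153162587061614084745832264121438158452546049631631225498051279030188739299829399832674591786540211945581188520693343972612306326168582927557454588100005038110014820212003660792032788799720129175821615561495611017551916636625995410497323260536095542152071326421409071730778745154573493558318988401598119111415229755283895234288440602404057527099702988857625803134165263237746802048904304156142962768286411422923423319842321823181945865008350298006821582655381317187500933381230774250363246685346543754216177449356224568785492972553460462811914820700149259922238,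
    0]]

def quartic {R : Type*} [CommRing R] (t : R) : R :=
  t ^ 4 - 9 * t ^ 3 - 21 * t ^ 2 + 88 * t + 48

def quarticHom (a s : ℤ) : ℤ :=
  a ^ 4 - 9 * a ^ 3 * s - 21 * a ^ 2 * s ^ 2 + 88 * a * s ^ 3 + 48 * s ^ 4

theorem quartic_div {a s : ℤ} (hs : s ≠ 0) :
    quartic ((a : ℝ) / s) = quarticHom a s / (s : ℝ) ^ 4 := by
  have : (s : ℝ) ≠ 0 := by exact_mod_cast hs
  rw [quartic, quarticHom]
  push_cast
  field_simp

theorem rootNum_sign (i : Fin 4) :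
    quarticHom (rootNum i) (2 ^ 2960) ≤ 0 ∧ 0 ≤ quarticHom (rootNum i + 1) (2 ^ 2960) ∨
    0 ≤ quarticHom (rootNum i) (2 ^ 2960) ∧ quarticHom (rootNum i + 1) (2 ^ 2960) ≤ 0 := by
  decide +kernel +revert

theorem exists_root (i : Fin 4) : ∃ t : ℝ, quartic t = 0 ∧
    rootNum i ≤ 2 ^ 2960 * t ∧ 2 ^ 2960 * t ≤ rootNum i + 1 := by
  have hc : Continuous (fun t : ℝ ↦ quartic t) := by unfold quartic; fun_prop
  have hpos : (0 : ℝ) < ((2 ^ 2960 : ℤ) : ℝ) := by positivity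
  have hs : (2 ^ 2960 : ℤ) ≠ 0 := by positivity
  have hle : ((rootNum i : ℤ) : ℝ) / ((2 ^ 2960 : ℤ) : ℝ) ≤
      ((rootNum i + 1 : ℤ) : ℝ) / ((2 ^ 2960 : ℤ) : ℝ) := by
    gcongr
    linarith
  have key : ∃ t ∈ Set.Icc (((rootNum i : ℤ) : ℝ) / ((2 ^ 2960 : ℤ) : ℝ))
      (((rootNum i + 1 : ℤ) : ℝ) / ((2 ^ 2960 : ℤ) : ℝ)), quartic t = 0 := by
    have h4 : (0 : ℝ) < ((2 ^ 2960 : ℤ) : ℝ) ^ 4 := by positivity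
    rcases rootNum_sign i with h | h
    · obtain ⟨t, ht, ht0⟩ := intermediate_value_Icc hle hc.continuousOn (show (0 : ℝ) ∈ _ by
        rw [Set.mem_Icc, quartic_div hs, quartic_div hs]
        exact ⟨div_nonpos_of_nonpos_of_nonneg (by exact_mod_cast h.1) h4.le,
          div_nonneg (by exact_mod_cast h.2) h4.le⟩)
      exact ⟨t, ht, ht0⟩
    · obtain ⟨t, ht, ht0⟩ := intermediate_value_Icc' hle hc.continuousOn (show (0 : ℝ) ∈ _ by
        rw [Set.mem_Icc, quartic_div hs, quartic_div hs]
        exact ⟨div_nonpos_of_nonpos_of_nonneg (by exact_mod_cast h.2) h4.le,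
          div_nonneg (by exact_mod_cast h.1) h4.le⟩)
      exact ⟨t, ht, ht0⟩
  obtain ⟨t, ⟨h1, h2⟩, ht⟩ := key
  rw [div_le_iff₀ hpos] at h1
  rw [le_div_iff₀ hpos] at h2
  refine ⟨t, ht, ?_, ?_⟩
  · rw [mul_comm]; exact_mod_cast h1
  · rw [mul_comm]; exact_mod_cast h2

noncomputable def root (i : Fin 4) : ℝ := (exists_root i).choose

theorem quartic_root (i : Fin 4) : quartic (root i) = 0 := (exists_root i).choose_spec.1

theorem rootNum_le (i : Fin 4) : rootNum i ≤ 2 ^ 2960 * root i := (exists_root i).choose_spec.2.1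

theorem le_rootNum (i : Fin 4) : 2 ^ 2960 * root i ≤ rootNum i + 1 :=
  (exists_root i).choose_spec.2.2

def rootApprox : Fin 4 → ℤ := ![-342719216, -49938573, 275810609, 1016847179]

theorem rootApprox_rootNum (i : Fin 4) : rootApprox i * 2 ^ 2960 ≤ rootNum i * 10 ^ 8 ∧
    (rootNum i + 1) * 10 ^ 8 ≤ (rootApprox i + 1) * 2 ^ 2960 := by
  decide +kernel +revert

theorem root_mem (i : Fin 4) :
    (rootApprox i : ℝ) / 10 ^ 8 ≤ root i ∧ root i ≤ (rootApprox i + 1) / 10 ^ 8 := by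
  obtain ⟨h1, h2⟩ := rootApprox_rootNum i
  have h1' : (rootApprox i : ℝ) * 2 ^ 2960 ≤ rootNum i * 10 ^ 8 := by exact_mod_cast h1
  have h2' : ((rootNum i : ℝ) + 1) * 10 ^ 8 ≤ (rootApprox i + 1) * 2 ^ 2960 := by exact_mod_cast h2
  have h3 := rootNum_le i
  have h4 := le_rootNum i
  have hp : (0 : ℝ) < 2 ^ 2960 := by positivity
  generalize (2 : ℝ) ^ 2960 = S at *
  constructor
  · rw [div_le_iff₀ (by norm_num)]
    refine le_of_mul_le_mul_left ?_ hp
    linarith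
  · rw [le_div_iff₀ (by norm_num)]
    refine le_of_mul_le_mul_left ?_ hp
    linarith

theorem root_zero_mem : -3.42719216 ≤ root 0 ∧ root 0 ≤ -3.42719215 := by
  have := root_mem 0
  rw [show rootApprox 0 = -342719216 from rfl] at this
  norm_num at this ⊢
  exact this

theorem root_one_mem : -0.49938573 ≤ root 1 ∧ root 1 ≤ -0.49938572 := by
  have := root_mem 1
  rw [show rootApprox 1 = -49938573 from rfl] at this
  norm_num at this ⊢
  exact this

theorem root_two_mem : 2.75810609 ≤ root 2 ∧ root 2 ≤ 2.75810610 := by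
  have := root_mem 2
  rw [show rootApprox 2 = 275810609 from rfl] at this
  norm_num at this ⊢
  exact this

theorem root_three_mem : 10.16847179 ≤ root 3 ∧ root 3 ≤ 10.16847180 := by
  have := root_mem 3
  rw [show rootApprox 3 = 1016847179 from rfl] at this
  norm_num at this ⊢
  exact this

theorem root_lt_root {i j : Fin 4} (h : i < j) : root i + 2.9 < root j := by
  have h0 := root_zero_mem
  have h1 := root_one_mem
  have h2 := root_two_mem
  have h3 := root_three_mem
  fin_cases i <;> fin_cases j <;> first | (exact absurd h (by decide)) | skip
  all_goals simp only [Fin.reduceFinMk, Fin.zero_eta, Fin.mk_one, Fin.isValue]; linarith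

theorem root_strictMono : StrictMono root := fun i j h ↦ by linarith [root_lt_root h]

theorem lt_abs_root_sub_root {i j : Fin 4} (h : i ≠ j) : 2.9 < |root i - root j| := by
  rcases lt_or_gt_of_ne h with h | h
  · have := root_lt_root h
    rw [abs_sub_comm, lt_abs]; left; linarith
  · have := root_lt_root h
    rw [lt_abs]; left; linarith

theorem abs_root_le (i : Fin 4) : |root i| ≤ 10.2 := by
  have h0 := root_zero_mem
  have h1 := root_one_mem
  have h2 := root_two_mem
  have h3 := root_three_mem
  rw [abs_le]
  fin_cases i <;> simp only [Fin.reduceFinMk, Fin.zero_eta, Fin.mk_one, Fin.isValue] <;>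
    constructor <;> linarith

theorem abs_root_sub_root_lt (i j : Fin 4) : |root i - root j| < 13.6 := by
  have h0 := root_zero_mem
  have h1 := root_one_mem
  have h2 := root_two_mem
  have h3 := root_three_mem
  rw [abs_lt]
  fin_cases i <;> fin_cases j <;>
    simp only [Fin.reduceFinMk, Fin.zero_eta, Fin.mk_one, Fin.isValue] <;>
    constructor <;> linarith

open Polynomial in
theorem quartic_eq_prod_root (t : ℝ) :
    quartic t = (t - root 0) * (t - root 1) * (t - root 2) * (t - root 3) := by
  set p : ℝ[X] := X ^ 4 - 9 * X ^ 3 - 21 * X ^ 2 + 88 * X + 48 with hp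
  set q : ℝ[X] := (X - C (root 0)) * (X - C (root 1)) * (X - C (root 2)) * (X - C (root 3)) with hq
  have hpm : p.Monic := by rw [hp]; monicity!
  have hpd : p.natDegree = 4 := by rw [hp]; compute_degree!
  have hqm : q.Monic :=
    (((monic_X_sub_C _).mul (monic_X_sub_C _)).mul (monic_X_sub_C _)).mul (monic_X_sub_C _)
  have hqd : q.natDegree = 4 := by rw [hq]; compute_degree!
  have heval : ∀ t, p.eval t = quartic t := fun t ↦ by simp [hp, quartic]
  have hpq : p = q := by
    refine Polynomial.eq_of_degree_sub_lt_of_eval_finset_eq (Finset.univ.image root) ?_ ?_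
    · rw [Finset.card_image_of_injective _ root_strictMono.injective, Finset.card_univ,
        Fintype.card_fin]
      refine lt_of_lt_of_eq (degree_sub_lt_left ?_ hpm.ne_zero ?_) ?_
      · rw [degree_eq_natDegree hpm.ne_zero, degree_eq_natDegree hqm.ne_zero, hpd, hqd]
      · rw [hpm.leadingCoeff, hqm.leadingCoeff]
      · rw [degree_eq_natDegree hpm.ne_zero, hpd]
    · intro x hx
      obtain ⟨i, -, rfl⟩ := Finset.mem_image.mp hx
      rw [heval, quartic_root]
      fin_cases i <;> simp [hq]
  rw [← heval, hpq]
  simp [hq]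

theorem prod_sub_root_mul (x y : ℝ) :
    ∏ i, (x - root i * y) =
      x ^ 4 - 9 * x ^ 3 * y - 21 * x ^ 2 * y ^ 2 + 88 * x * y ^ 3 + 48 * y ^ 4 := by
  rw [Fin.prod_univ_four]
  rcases eq_or_ne y 0 with rfl | hy
  · ring
  · have h := quartic_eq_prod_root (x / y)
    have h1 : ∀ i, x / y - root i = (x - root i * y) / y := fun i ↦ by field_simp
    rw [h1, h1, h1, h1, quartic] at h
    field_simp at h
    linarith

def ordEval {R : Type*} [Field R] (c : Fin 4 → ℤ) (t : R) : R :=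
  c 0 + c 1 * t + c 2 * t ^ 2 + c 3 * ((4 + 7 * t + 3 * t ^ 2 + t ^ 3) / 8)

def ordMul (c d : Fin 4 → ℤ) : Fin 4 → ℤ := ![
  c 0 * d 0 - 4 * (c 1 * d 2 + c 2 * d 1) - 12 * (c 1 * d 3 + c 3 * d 1) - 84 * (c 2 * d 2)
    - 140 * (c 2 * d 3 + c 3 * d 2) - 252 * (c 3 * d 3),
  c 0 * d 1 + c 1 * d 0 - 7 * (c 1 * d 2 + c 2 * d 1) - 21 * (c 1 * d 3 + c 3 * d 1)
    - 151 * (c 2 * d 2) - 257 * (c 2 * d 3 + c 3 * d 2) - 463 * (c 3 * d 3),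
  c 0 * d 2 + c 1 * d 1 + c 2 * d 0 - 3 * (c 1 * d 2 + c 2 * d 1) - (c 1 * d 3 + c 3 * d 1)
    - 6 * (c 2 * d 2) - 30 * (c 2 * d 3 + c 3 * d 2) - 50 * (c 3 * d 3),
  c 0 * d 3 + c 3 * d 0 + 8 * (c 1 * d 2 + c 2 * d 1) + 12 * (c 1 * d 3 + c 3 * d 1)
    + 72 * (c 2 * d 2) + 136 * (c 2 * d 3 + c 3 * d 2) + 236 * (c 3 * d 3)]

theorem ordEval_mul {R : Type*} [Field R] [CharZero R] {t : R} (ht : quartic t = 0)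
    (c d : Fin 4 → ℤ) : ordEval (ordMul c d) t = ordEval c t * ordEval d t := by
  have h8 : (8 : R) ≠ 0 := by norm_num
  simp only [ordEval, ordMul, quartic, Matrix.cons_val] at *
  push_cast
  field_simp
  linear_combination (-64 * (c 2 * d 2) - 8 * (c 1 * d 3 + c 3 * d 1) -
    8 * (c 2 * d 3 + c 3 * d 2) * (t + 12) - c 3 * d 3 * (t ^ 2 + 15 * t + 179)) * ht

theorem ordEval_one {R : Type*} [Field R] (t : R) : ordEval ![1, 0, 0, 0] t = 1 := by
  simp [ordEval]

theorem ordEval_add {R : Type*} [Field R] (c d : Fin 4 → ℤ) (t : R) :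
    ordEval (c + d) t = ordEval c t + ordEval d t := by
  simp [ordEval]; ring

theorem ordEval_neg {R : Type*} [Field R] (c : Fin 4 → ℤ) (t : R) :
    ordEval (-c) t = -ordEval c t := by
  simp [ordEval]; ring

theorem map_ordEval {R R' : Type*} [Field R] [Field R'] (φ : R →+* R') (c : Fin 4 → ℤ) (t : R) :
    φ (ordEval c t) = ordEval c (φ t) := by
  simp [ordEval, map_ofNat]

def rootOrder : Subring (Fin 4 → ℝ) where
  carrier := {z | ∃ c, ∀ i, z i = ordEval c (root i)}
  mul_mem' := by
    rintro z w ⟨c, hc⟩ ⟨d, hd⟩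
    exact ⟨ordMul c d, fun i ↦ by rw [ordEval_mul (quartic_root i), ← hc, ← hd]; rfl⟩
  one_mem' := ⟨![1, 0, 0, 0], fun i ↦ by rw [ordEval_one]; rfl⟩
  add_mem' := by
    rintro z w ⟨c, hc⟩ ⟨d, hd⟩
    exact ⟨c + d, fun i ↦ by rw [ordEval_add, ← hc, ← hd]; rfl⟩
  zero_mem' := ⟨0, fun i ↦ by simp [ordEval]⟩
  neg_mem' := by
    rintro z ⟨c, hc⟩
    exact ⟨-c, fun i ↦ by rw [ordEval_neg, ← hc]; rfl⟩

def unitCoeff : Fin 3 → Fin 4 → ℤ :=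
  ![![1, 2, 0, 0], ![395, 748, 96, -333], ![1527, 2219, -2387, 1253]]

def unitInvCoeff : Fin 3 → Fin 4 → ℤ :=
  ![![737, -186, -100, 64], ![1041127, 1518189, -1605263, 832433],
    ![-3011301, -6361586, -1300278, 1125551]]

theorem ordMul_unitCoeff (j : Fin 3) :
    ordMul (unitCoeff j) (unitInvCoeff j) = ![1, 0, 0, 0] := by
  decide +kernel +revert

theorem ordEval_unitCoeff_mul {R : Type*} [Field R] [CharZero R] {t : R} (ht : quartic t = 0)
    (j : Fin 3) : ordEval (unitCoeff j) t * ordEval (unitInvCoeff j) t = 1 := by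
  rw [← ordEval_mul ht, ordMul_unitCoeff, ordEval_one]

theorem ordEval_unitCoeff_ne_zero {R : Type*} [Field R] [CharZero R] {t : R} (ht : quartic t = 0)
    (j : Fin 3) : ordEval (unitCoeff j) t ≠ 0 :=
  left_ne_zero_of_mul_eq_one (ordEval_unitCoeff_mul ht j)

noncomputable def unitLog (i : Fin 4) (j : Fin 3) : ℝ := Real.log |ordEval (unitCoeff j) (root i)|

noncomputable def rootDiffLog (i j : Fin 4) : ℝ := Real.log |root i - root j|

def ordMulMatrix (c : Fin 4 → ℤ) : Matrix (Fin 4) (Fin 4) ℤ :=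
  Matrix.of fun k l ↦ ordMul c (Pi.single l 1) k

theorem ordMulMatrix_mul_inv (j : Fin 3) :
    ordMulMatrix (unitCoeff j) * ordMulMatrix (unitInvCoeff j) = 1 := by
  ext k l
  rw [Matrix.mul_apply, Matrix.one_apply]
  decide +kernel +revert

theorem abs_det_ordMulMatrix_unitCoeff (j : Fin 3) :
    |(ordMulMatrix (unitCoeff j)).det| = 1 := by
  have h := congrArg Matrix.det (ordMulMatrix_mul_inv j)
  rw [Matrix.det_mul, Matrix.det_one] at h
  exact Int.isUnit_iff_abs_eq.mp (IsUnit.of_mul_eq_one _ h)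

noncomputable def rootBasisMatrix : Matrix (Fin 4) (Fin 4) ℝ :=
  Matrix.of fun i k ↦ ordEval (Pi.single k 1) (root i)

theorem rootBasisMatrix_eq : rootBasisMatrix = Matrix.vandermonde root *
    !![1, 0, 0, 1 / 2; 0, 1, 0, 7 / 8; 0, 0, 1, 3 / 8; 0, 0, 0, 1 / 8] := by
  ext i k
  fin_cases k <;>
    simp [rootBasisMatrix, Matrix.mul_apply, Fin.sum_univ_four, ordEval, Matrix.vandermonde_apply]
  ring

theorem det_rootBasisMatrix_ne_zero : rootBasisMatrix.det ≠ 0 := by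
  rw [rootBasisMatrix_eq, Matrix.det_mul]
  refine mul_ne_zero (Matrix.det_vandermonde_ne_zero_iff.mpr root_strictMono.injective) ?_
  simp [Matrix.det_succ_row_zero, Fin.sum_univ_succ]

theorem rootBasisMatrix_mul (c : Fin 4 → ℤ) :
    rootBasisMatrix * (ordMulMatrix c).map (Int.cast : ℤ → ℝ) =
      Matrix.diagonal (fun i ↦ ordEval c (root i)) * rootBasisMatrix := by
  ext i k
  rw [Matrix.diagonal_mul, rootBasisMatrix, Matrix.of_apply, ← ordEval_mul (quartic_root i)]
  simp only [Matrix.mul_apply, Fin.sum_univ_four, Matrix.of_apply, Matrix.map_apply, ordMulMatrix]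
  simp [ordEval]
  ring

theorem prod_ordEval_root (c : Fin 4 → ℤ) :
    ∏ i, ordEval c (root i) = ((ordMulMatrix c).det : ℝ) := by
  have h := congrArg Matrix.det (rootBasisMatrix_mul c)
  rw [Matrix.det_mul, Matrix.det_mul, Matrix.det_diagonal, mul_comm] at h
  have h2 := mul_right_cancel₀ det_rootBasisMatrix_ne_zero h
  rw [← h2]
  exact ((Int.castRingHom ℝ).map_det _).symm

theorem sum_unitLog (j : Fin 3) : ∑ i, unitLog i j = 0 := by
  simp only [unitLog]
  rw [← Real.log_prod fun i _ ↦ abs_ne_zero.mpr (ordEval_unitCoeff_ne_zero (quartic_root i) j),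
    ← Finset.abs_prod, prod_ordEval_root, ← Int.cast_abs, abs_det_ordMulMatrix_unitCoeff]
  simp

def logShiftLower (V sh : ℕ) : ℤ :=
  ((V.log2 : ℤ) - sh) * lnTwoNum - |(V.log2 : ℤ) - sh| * 2 ^ 12 +
    logLower (2 ^ 2900) 920 V (2 ^ V.log2)

def logShiftUpper (V sh : ℕ) : ℤ :=
  ((V.log2 : ℤ) - sh) * lnTwoNum + |(V.log2 : ℤ) - sh| * 2 ^ 12 +
    logUpper (2 ^ 2900) 920 V (2 ^ V.log2)

theorem lnTwoNum_bounds : lnTwoNum - 2 ^ 12 ≤ (logLower (2 ^ 2900) 920 2 1 : ℤ) ∧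
    (logUpper (2 ^ 2900) 920 2 1 : ℤ) ≤ lnTwoNum + 2 ^ 12 := by
  decide +kernel

theorem abs_log_two_sub_le : |2 ^ 2900 * Real.log 2 - lnTwoNum| ≤ 2 ^ 12 := by
  have h := log_div_bounds (S := 2 ^ 2900) (n := 920) (a := 2) (b := 1) (by positivity)
    (by norm_num) (by norm_num) (by norm_num)
  have h1 : (lnTwoNum : ℝ) - 2 ^ 12 ≤ logLower (2 ^ 2900) 920 2 1 := by
    exact_mod_cast lnTwoNum_bounds.1
  have h2 : (logUpper (2 ^ 2900) 920 2 1 : ℝ) ≤ lnTwoNum + 2 ^ 12 := by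
    exact_mod_cast lnTwoNum_bounds.2
  have e : ((2 ^ 2900 : ℕ) : ℝ) = 2 ^ 2900 := by push_cast; rfl
  rw [e, Nat.cast_one, div_one, Nat.cast_ofNat] at h
  rw [abs_le]
  constructor <;> linarith [h.1, h.2]

theorem logShift_bounds {V sh : ℕ} (hV : V ≠ 0) :
    logShiftLower V sh ≤ 2 ^ 2900 * (Real.log V - sh * Real.log 2) ∧
      2 ^ 2900 * (Real.log V - sh * Real.log 2) ≤ logShiftUpper V sh := by
  have h1 := Nat.log2_self_le hV
  have h2 := (Nat.lt_log2_self (n := V)).le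
  rw [pow_succ'] at h2
  obtain ⟨hl, hu⟩ := log_div_bounds (S := 2 ^ 2900) (n := 920) (by positivity)
    (by positivity) h1 h2
  have e : ((2 ^ 2900 : ℕ) : ℝ) = 2 ^ 2900 := by push_cast; rfl
  have hV' : (V : ℝ) ≠ 0 := by exact_mod_cast hV
  rw [e, Real.log_div hV' (by positivity), Nat.cast_pow, Real.log_pow, Nat.cast_ofNat] at hl hu
  have h3 : |((V.log2 : ℝ) - sh) * (2 ^ 2900 * Real.log 2 - lnTwoNum)| ≤
      |(V.log2 : ℝ) - sh| * 2 ^ 12 := by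
    rw [abs_mul]
    exact mul_le_mul_of_nonneg_left abs_log_two_sub_le (abs_nonneg _)
  rw [abs_le] at h3
  simp only [logShiftLower, logShiftUpper]
  push_cast at *
  generalize (2 : ℝ) ^ 2900 = S at *
  constructor <;> linarith [h3.1, h3.2]

theorem log_bounds_of_mem {x : ℝ} {V₁ V₂ sh : ℕ} (h0 : V₁ ≠ 0) (h1 : V₁ ≤ 2 ^ sh * x)
    (h2 : 2 ^ sh * x ≤ V₂) :
    logShiftLower V₁ sh ≤ 2 ^ 2900 * Real.log x ∧
      2 ^ 2900 * Real.log x ≤ logShiftUpper V₂ sh := by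
  have hV : (0 : ℝ) < V₁ := by exact_mod_cast Nat.pos_of_ne_zero h0
  have hV2 : (0 : ℝ) < V₂ := hV.trans_le (h1.trans h2)
  have hx : 0 < x := pos_of_mul_pos_right (hV.trans_le h1) (by positivity)
  have e : Real.log (2 ^ sh * x) = sh * Real.log 2 + Real.log x := by
    rw [Real.log_mul (by positivity) hx.ne', Real.log_pow]
  have l1 := Real.log_le_log hV h1
  have l2 := Real.log_le_log (hV.trans_le h1) h2
  have hp : (0 : ℝ) ≤ 2 ^ 2900 := by positivity
  rw [e] at l1 l2
  constructor
  · refine (logShift_bounds h0).1.trans (mul_le_mul_of_nonneg_left ?_ hp)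
    linarith
  · refine le_trans (mul_le_mul_of_nonneg_left ?_ hp)
      (logShift_bounds (V := V₂) (by rintro rfl; simp at hV2)).2
    linarith

theorem abs_log_sub_le {x : ℝ} {N : ℤ} {E sh : ℕ} {v : ℤ} (hx : |2 ^ sh * x - N| ≤ E)
    (h : E < N.natAbs ∧ v - 2 ^ 20 ≤ logShiftLower (N.natAbs - E) sh ∧
      logShiftUpper (N.natAbs + E) sh ≤ v + 2 ^ 20) :
    |2 ^ 2900 * Real.log |x| - v| ≤ 2 ^ 20 := by
  obtain ⟨h0, h1, h2⟩ := h
  have hN : ((N.natAbs : ℕ) : ℝ) = |(N : ℝ)| := by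
    rw [Nat.cast_natAbs, Int.cast_abs]
  have h3 := abs_abs_sub_abs_le_abs_sub (2 ^ sh * x) (N : ℝ)
  have h3 := h3.trans hx
  rw [abs_mul, abs_of_pos (show (0 : ℝ) < 2 ^ sh by positivity), abs_le] at h3
  obtain ⟨h4, h5⟩ := log_bounds_of_mem (x := |x|) (V₁ := N.natAbs - E) (V₂ := N.natAbs + E)
    (sh := sh) (by omega) (by rw [Nat.cast_sub h0.le, hN]; linarith [h3.1])
    (by push_cast; rw [hN]; linarith [h3.2])
  have h1' : (v : ℝ) - 2 ^ 20 ≤ logShiftLower (N.natAbs - E) sh := by exact_mod_cast h1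
  have h2' : (logShiftUpper (N.natAbs + E) sh : ℝ) ≤ v + 2 ^ 20 := by exact_mod_cast h2
  rw [abs_le]
  constructor <;> linarith

def ordEvalNum (c : Fin 4 → ℤ) (s A : ℤ) : ℤ :=
  8 * c 0 * s ^ 3 + 8 * c 1 * A * s ^ 2 + 8 * c 2 * A ^ 2 * s +
    c 3 * (4 * s ^ 3 + 7 * A * s ^ 2 + 3 * A ^ 2 * s + A ^ 3)

theorem abs_ordEval_sub_le {c : Fin 4 → ℤ} (hc : ∀ k, |c k| ≤ 2400) {s A : ℤ} {t : ℝ}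
    (hs : 100 ≤ s) (ht : |t| ≤ 10.2) (h1 : A ≤ s * t) (h2 : s * t ≤ A + 1) :
    |8 * (s : ℝ) ^ 3 * ordEval c t - (ordEvalNum c s A : ℝ)| ≤ 2 ^ 21 * (s : ℝ) ^ 2 := by
  have hs' : (100 : ℝ) ≤ s := by exact_mod_cast hs
  have hs0 : (0 : ℝ) < s := by linarith
  set d : ℝ := s * t - A with hd
  have hd0 : |d| ≤ 1 := by rw [abs_le]; constructor <;> linarith
  have hτ : |s * t| ≤ 10.2 * s := by
    rw [abs_mul, abs_of_pos hs0, mul_comm]; gcongr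
  have hA : |(A : ℝ)| ≤ 11 * s := by
    have : (A : ℝ) = s * t - d := by ring
    rw [this]
    refine (abs_sub _ _).trans ?_
    linarith
  have hc' : ∀ k, |(c k : ℝ)| ≤ 2400 := fun k ↦ by exact_mod_cast hc k
  have key : 8 * (s : ℝ) ^ 3 * ordEval c t - ordEvalNum c s A =
      d * (8 * c 1 * s ^ 2 + 8 * c 2 * ((s * t + A) * s) + c 3 * (7 * s ^ 2 +
        3 * ((s * t + A) * s) + ((s * t) * (s * t) + (s * t) * A + A * A))) := by
    rw [hd, ordEval, ordEvalNum]; push_cast; ring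
  have b0 : |(s : ℝ) ^ 2| = s ^ 2 := abs_of_nonneg (by positivity)
  have b1 : |(s * t + A) * s| ≤ 22 * (s : ℝ) ^ 2 := by
    rw [abs_mul, abs_of_pos hs0]
    have := abs_add_le (s * t) (A : ℝ)
    nlinarith
  have b2 : |(s * t) * (s * t)| ≤ 110 * (s : ℝ) ^ 2 := by
    rw [abs_mul]
    nlinarith [mul_le_mul hτ hτ (abs_nonneg _) (by positivity)]
  have b3 : |(s * t) * A| ≤ 115 * (s : ℝ) ^ 2 := by
    rw [abs_mul]
    nlinarith [mul_le_mul hτ hA (abs_nonneg _) (by positivity)]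
  have b4 : |(A : ℝ) * A| ≤ 121 * (s : ℝ) ^ 2 := by
    rw [abs_mul]
    nlinarith [mul_le_mul hA hA (abs_nonneg _) (by positivity)]
  have b5 : |7 * (s : ℝ) ^ 2 + 3 * ((s * t + A) * s) +
      ((s * t) * (s * t) + (s * t) * A + A * A)| ≤ 419 * (s : ℝ) ^ 2 := by
    rw [abs_le] at *
    constructor <;> linarith [b1.1, b1.2, b2.1, b2.2, b3.1, b3.2, b4.1, b4.2]
  rw [key, abs_mul]
  have t1 : |8 * (c 1 : ℝ) * s ^ 2| ≤ 8 * 2400 * (s : ℝ) ^ 2 := by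
    rw [abs_mul, abs_mul, b0, abs_of_pos (by norm_num : (0 : ℝ) < 8)]
    gcongr; exact hc' 1
  have t2 : |8 * (c 2 : ℝ) * ((s * t + A) * s)| ≤ 8 * 2400 * (22 * s ^ 2) := by
    rw [abs_mul, abs_mul, abs_of_pos (by norm_num : (0 : ℝ) < 8)]
    gcongr; exact hc' 2
  have t3 : |(c 3 : ℝ) * (7 * (s : ℝ) ^ 2 + 3 * ((s * t + A) * s) +
      ((s * t) * (s * t) + (s * t) * A + A * A))| ≤ 2400 * (419 * (s : ℝ) ^ 2) := by
    rw [abs_mul]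
    gcongr; exact hc' 3
  refine (mul_le_mul hd0 ((abs_add_three _ _ _).trans (add_le_add_three t1 t2 t3))
    (abs_nonneg _) zero_le_one).trans ?_
  nlinarith [sq_nonneg (s : ℝ)]

theorem unitLogNum_check (i : Fin 4) (j : Fin 3) :
    2 ^ 21 * (2 ^ 2960) ^ 2 < (ordEvalNum (unitCoeff j) (2 ^ 2960) (rootNum i)).natAbs ∧
    unitLogNum i j - 2 ^ 20 ≤ logShiftLower ((ordEvalNum (unitCoeff j) (2 ^ 2960)
      (rootNum i)).natAbs - 2 ^ 21 * (2 ^ 2960) ^ 2) 8883 ∧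
    logShiftUpper ((ordEvalNum (unitCoeff j) (2 ^ 2960) (rootNum i)).natAbs +
      2 ^ 21 * (2 ^ 2960) ^ 2) 8883 ≤ unitLogNum i j + 2 ^ 20 := by
  decide +kernel +revert

theorem abs_unitLog_sub_le (i : Fin 4) (j : Fin 3) :
    |2 ^ 2900 * unitLog i j - unitLogNum i j| ≤ 2 ^ 20 := by
  refine abs_log_sub_le ?_ (unitLogNum_check i j)
  have h := abs_ordEval_sub_le (c := unitCoeff j) (s := 2 ^ 2960) (A := rootNum i) (t := root i)
    (by decide +revert) (by decide +kernel) (abs_root_le i)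
    (by have := rootNum_le i; push_cast; exact this) (by have := le_rootNum i; push_cast; exact this)
  push_cast at h ⊢
  rw [show (2 : ℝ) ^ 8883 = 8 * (2 ^ 2960) ^ 3 by rw [← pow_mul, show (8 : ℝ) = 2 ^ 3 by norm_num, ← pow_add]]
  norm_num at h ⊢
  exact h

theorem rootDiffLogNum_check {i j : Fin 4} (h : i ≠ j) :
    1 < (rootNum i - rootNum j).natAbs ∧
    rootDiffLogNum i j - 2 ^ 20 ≤ logShiftLower ((rootNum i - rootNum j).natAbs - 1) 2960 ∧
    logShiftUpper ((rootNum i - rootNum j).natAbs + 1) 2960 ≤ rootDiffLogNum i j + 2 ^ 20 := by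
  decide +kernel +revert

theorem abs_rootDiffLog_sub_le {i j : Fin 4} (h : i ≠ j) :
    |2 ^ 2900 * rootDiffLog i j - rootDiffLogNum i j| ≤ 2 ^ 20 := by
  refine abs_log_sub_le ?_ (rootDiffLogNum_check h)
  have hi1 := rootNum_le i
  have hi2 := le_rootNum i
  have hj1 := rootNum_le j
  have hj2 := le_rootNum j
  push_cast
  generalize (2 : ℝ) ^ 2960 = s at *
  rw [abs_le]
  constructor <;> linarith

def unitLogApprox : Fin 4 → Fin 3 → ℤ :=
  ![![176719, -1705885, 1054617], ![-670193, 43764, -143275], ![187429, 597867, -1686036],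
    ![306044, 1064252, 774692]]

theorem unitLogApprox_check (i : Fin 4) (j : Fin 3) :
    unitLogApprox i j * 2 ^ 2900 ≤ (unitLogNum i j - 2 ^ 20) * 10 ^ 5 ∧
      (unitLogNum i j + 2 ^ 20) * 10 ^ 5 ≤ (unitLogApprox i j + 1) * 2 ^ 2900 := by
  decide +kernel +revert

theorem unitLog_mem (i : Fin 4) (j : Fin 3) : (unitLogApprox i j : ℝ) / 10 ^ 5 ≤ unitLog i j ∧
    unitLog i j ≤ (unitLogApprox i j + 1) / 10 ^ 5 := by
  obtain ⟨h1, h2⟩ := unitLogApprox_check i j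
  have h1' : (unitLogApprox i j : ℝ) * 2 ^ 2900 ≤ (unitLogNum i j - 2 ^ 20) * 10 ^ 5 := by
    exact_mod_cast h1
  have h2' : ((unitLogNum i j : ℝ) + 2 ^ 20) * 10 ^ 5 ≤ (unitLogApprox i j + 1) * 2 ^ 2900 := by
    exact_mod_cast h2
  have h3 := abs_le.mp (abs_unitLog_sub_le i j)
  have hp : (0 : ℝ) < 2 ^ 2900 := by positivity
  generalize (2 : ℝ) ^ 2900 = S at *
  constructor
  · rw [div_le_iff₀ (by norm_num)]
    refine le_of_mul_le_mul_left ?_ hp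
    linarith [h3.1]
  · rw [le_div_iff₀ (by norm_num)]
    refine le_of_mul_le_mul_left ?_ hp
    linarith [h3.2]

theorem mul_abs_le_of_dominant {a b c x y z δ M : ℝ} (h : |a * x + b * y + c * z| ≤ M)
    (hy : |y| ≤ |x|) (hz : |z| ≤ |x|) (hd : |b| + |c| + δ ≤ |a|) : δ * |x| ≤ M := by
  have h1 : |a * x| ≤ |a * x + b * y + c * z| + |b * y| + |c * z| := by
    calc |a * x| = |(a * x + b * y + c * z) - b * y - c * z| := by ring_nf
      _ ≤ _ := (abs_sub _ _).trans (add_le_add_left (abs_sub _ _) _)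
  rw [abs_mul, abs_mul b, abs_mul c] at h1
  have h2 := mul_le_mul_of_nonneg_left hy (abs_nonneg b)
  have h3 := mul_le_mul_of_nonneg_left hz (abs_nonneg c)
  have h4 := mul_le_mul_of_nonneg_right hd (abs_nonneg x)
  linarith

theorem mul_abs_le_of_forall_abs_sum_le {t : Fin 3 → ℝ} {M : ℝ}
    (h : ∀ i : Fin 3, |∑ j, unitLog i.castSucc j * t j| ≤ M) (j : Fin 3) : 4.6 * |t j| ≤ M := by
  obtain ⟨p, -, hp⟩ := Finset.exists_max_image Finset.univ (fun j ↦ |t j|) ⟨j, Finset.mem_univ j⟩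
  refine (mul_le_mul_of_nonneg_left (hp j (Finset.mem_univ j)) (by norm_num)).trans ?_
  have hq : ∀ j, |t j| ≤ |t p| := fun j ↦ hp j (Finset.mem_univ j)
  have b := fun i j v (h : unitLogApprox i j = v) ↦ h ▸ unitLog_mem i j
  have b00 := b 0 0 176719 rfl
  have b01 := b 0 1 (-1705885) rfl
  have b02 := b 0 2 1054617 rfl
  have b10 := b 1 0 (-670193) rfl
  have b11 := b 1 1 43764 rfl
  have b12 := b 1 2 (-143275) rfl
  have b20 := b 2 0 187429 rfl
  have b21 := b 2 1 597867 rfl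
  have b22 := b 2 2 (-1686036) rfl
  norm_num at b00 b01 b02 b10 b11 b12 b20 b21 b22
  fin_cases p
  · refine mul_abs_le_of_dominant (b := unitLog 1 1) (c := unitLog 1 2) (a := unitLog 1 0)
      (y := t 1) (z := t 2) ?_ (hq _) (hq _) ?_
    · have := h 1
      rw [Fin.sum_univ_three] at this
      exact this
    · rw [abs_of_neg (show unitLog 1 0 < 0 by linarith [b10.2]),
        abs_of_pos (show 0 < unitLog 1 1 by linarith [b11.1]),
        abs_of_neg (show unitLog 1 2 < 0 by linarith [b12.2])]
      linarith [b10.2, b11.2, b12.1]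
  · refine mul_abs_le_of_dominant (b := unitLog 0 0) (c := unitLog 0 2) (a := unitLog 0 1)
      (y := t 0) (z := t 2) ?_ (hq _) (hq _) ?_
    · have := h 0
      rw [Fin.sum_univ_three, add_comm (unitLog _ 0 * _)] at this
      exact this
    · rw [abs_of_pos (show 0 < unitLog 0 0 by linarith [b00.1]),
        abs_of_neg (show unitLog 0 1 < 0 by linarith [b01.2]),
        abs_of_pos (show 0 < unitLog 0 2 by linarith [b02.1])]
      linarith [b00.2, b01.2, b02.2]
  · refine mul_abs_le_of_dominant (b := unitLog 2 0) (c := unitLog 2 1) (a := unitLog 2 2)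
      (y := t 0) (z := t 1) ?_ (hq _) (hq _) ?_
    · have := h 2
      rw [Fin.sum_univ_three, add_comm, ← add_assoc] at this
      exact this
    · rw [abs_of_pos (show 0 < unitLog 2 0 by linarith [b20.1]),
        abs_of_pos (show 0 < unitLog 2 1 by linarith [b21.1]),
        abs_of_neg (show unitLog 2 2 < 0 by linarith [b22.2])]
      linarith [b20.2, b21.2, b22.2]

theorem exists_forall_sum_unitLog_eq (b : Fin 3 → ℝ) :
    ∃ t : Fin 3 → ℝ, ∀ i : Fin 3, ∑ j, unitLog i.castSucc j * t j = b i := by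
  let f : (Fin 3 → ℝ) →ₗ[ℝ] (Fin 3 → ℝ) :=
    Matrix.toLin' (Matrix.of fun (i : Fin 3) j ↦ unitLog i.castSucc j)
  have hf : ∀ t i, f t i = ∑ j, unitLog i.castSucc j * t j := fun t i ↦ by
    simp [f, Matrix.toLin'_apply, Matrix.mulVec, dotProduct]
  have hinj : Function.Injective f := by
    rw [injective_iff_map_eq_zero]
    intro t ht
    ext j
    have := mul_abs_le_of_forall_abs_sum_le (t := t) (M := 0)
      (fun i ↦ by rw [← hf, ht]; simp) j
    exact abs_eq_zero.mp (le_antisymm (by linarith) (abs_nonneg _))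
  obtain ⟨t, ht⟩ := LinearMap.injective_iff_surjective.mp hinj b
  exact ⟨t, fun i ↦ by rw [← hf, ht]⟩

theorem exists_nat_forall_abs_mul_sub_lt {ι : Type*} [Fintype ι] (t : ι → ℝ) (m : ι → ℕ)
    (hm : ∀ j, 0 < m j) :
    ∃ k : ℕ, 1 ≤ k ∧ k ≤ ∏ j, m j ∧ ∃ a : ι → ℤ, ∀ j, |k * t j - a j| < 1 / m j := by
  classical
  have hfl : ∀ (k : ℕ) j, ⌊Int.fract (k * t j) * m j⌋₊ < m j := fun k j ↦ by
    rw [Nat.floor_lt (mul_nonneg (Int.fract_nonneg _) (Nat.cast_nonneg _))]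
    have : (0 : ℝ) < m j := by exact_mod_cast hm j
    nlinarith [Int.fract_lt_one ((k : ℝ) * t j)]
  let F : Fin (∏ j, m j + 1) → (∀ j, Fin (m j)) := fun k j ↦ ⟨_, hfl k j⟩
  obtain ⟨k₁, k₂, hne, hF⟩ := Fintype.exists_ne_map_eq_of_card_lt F (by simp)
  wlog hlt : k₁ < k₂ generalizing k₁ k₂
  · exact this k₂ k₁ hne.symm hF.symm (lt_of_le_of_ne (not_lt.mp hlt) hne.symm)
  have hlt' : (k₁ : ℕ) < k₂ := hlt
  refine ⟨k₂ - k₁, by omega, by omega, fun j ↦ ⌊(k₂ : ℕ) * t j⌋ - ⌊(k₁ : ℕ) * t j⌋, fun j ↦ ?_⟩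
  have hj : ⌊Int.fract ((k₁ : ℕ) * t j) * m j⌋₊ = ⌊Int.fract ((k₂ : ℕ) * t j) * m j⌋₊ :=
    congrArg Fin.val (congrFun hF j)
  have hmj : (0 : ℝ) < m j := by exact_mod_cast hm j
  have h1 := Nat.floor_le (mul_nonneg (Int.fract_nonneg ((k₁ : ℕ) * t j)) hmj.le)
  have h2 := Nat.lt_floor_add_one (Int.fract ((k₁ : ℕ) * t j) * m j)
  have h3 := Nat.floor_le (mul_nonneg (Int.fract_nonneg ((k₂ : ℕ) * t j)) hmj.le)
  have h4 := Nat.lt_floor_add_one (Int.fract ((k₂ : ℕ) * t j) * m j)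
  rw [hj] at h1 h2
  rw [Nat.cast_sub hlt'.le, lt_div_iff₀ hmj]
  push_cast
  have e : ((k₂ : ℕ) - (k₁ : ℕ) : ℝ) * t j - (⌊((k₂ : ℕ) : ℝ) * t j⌋ - ⌊((k₁ : ℕ) : ℝ) * t j⌋) =
      Int.fract ((k₂ : ℕ) * t j) - Int.fract ((k₁ : ℕ) * t j) := by
    simp only [Int.fract]; ring
  have e2 := abs_mul (Int.fract ((k₂ : ℕ) * t j) - Int.fract ((k₁ : ℕ) * t j)) (m j : ℝ)
  rw [abs_of_pos hmj] at e2
  rw [e, ← e2, abs_lt]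
  constructor <;> linarith

theorem abs_le_div_of_mul {D h h₀ B : ℝ} (hh : 0 < h₀) (h₀h : h₀ ≤ h) (hB : |D * h| ≤ B) :
    |D| ≤ B / h₀ := by
  rw [le_div_iff₀ hh]
  rw [abs_mul, abs_of_pos (hh.trans_le h₀h)] at hB
  exact (mul_le_mul_of_nonneg_left h₀h (abs_nonneg _)).trans hB

theorem eq_zero_of_abs_ordEval_root_le {c : Fin 4 → ℤ}
    (hz : ∀ i, |ordEval c (root i)| ≤ 5.6) : c 1 = 0 ∧ c 2 = 0 ∧ c 3 = 0 := by
  have r0 := root_zero_mem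
  have r1 := root_one_mem
  have r2 := root_two_mem
  have r3 := root_three_mem
  have hsub : ∀ i j, |ordEval c (root i) - ordEval c (root j)| ≤ 11.2 := fun i j ↦
    (abs_sub _ _).trans (by linarith [hz i, hz j])
  set D : ℝ → ℝ → ℝ := fun x y ↦
    c 1 + c 2 * (x + y) + c 3 / 8 * (7 + 3 * (x + y) + x ^ 2 + x * y + y ^ 2) with hD
  have hD1 : ∀ x y, D x y * (y - x) = ordEval c y - ordEval c x := fun x y ↦ by
    simp only [hD, ordEval]; ring
  set T : ℝ → ℝ → ℝ → ℝ := fun x y z ↦ c 2 + c 3 / 8 * (3 + x + y + z) with hT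
  have hT1 : ∀ x y z, T x y z * (z - x) = D y z - D x y := fun x y z ↦ by
    simp only [hT, hD]; ring
  have hT2 : T (root 1) (root 2) (root 3) - T (root 0) (root 1) (root 2) =
      c 3 / 8 * (root 3 - root 0) := by
    simp only [hT]; ring
  have d01 := abs_le_div_of_mul (h₀ := 2.9278) (by norm_num) (by linarith)
    ((hD1 (root 0) (root 1)).symm ▸ hsub 1 0)
  have d12 := abs_le_div_of_mul (h₀ := 3.2574) (by norm_num) (by linarith)
    ((hD1 (root 1) (root 2)).symm ▸ hsub 2 1)
  have d23 := abs_le_div_of_mul (h₀ := 7.4103) (by norm_num) (by linarith)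
    ((hD1 (root 2) (root 3)).symm ▸ hsub 3 2)
  have d13 := abs_le_div_of_mul (h₀ := 10.6678) (by norm_num) (by linarith)
    ((hD1 (root 1) (root 3)).symm ▸ hsub 3 1)
  have t012 := abs_le_div_of_mul (h₀ := 6.1852) (by norm_num) (by linarith)
    ((hT1 (root 0) (root 1) (root 2)).symm ▸ (abs_sub _ _).trans (add_le_add d12 d01))
  have t123 := abs_le_div_of_mul (h₀ := 10.6678) (by norm_num) (by linarith)
    ((hT1 (root 1) (root 2) (root 3)).symm ▸ (abs_sub _ _).trans (add_le_add d23 d12))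
  have t013 := abs_le_div_of_mul (h₀ := 13.5956) (by norm_num) (by linarith)
    ((hT1 (root 0) (root 1) (root 3)).symm ▸ (abs_sub _ _).trans (add_le_add d13 d01))
  have h3 := abs_le_div_of_mul (h₀ := 13.5956) (by norm_num) (by linarith)
    (hT2 ▸ (abs_sub _ _).trans (add_le_add t123 t012))
  have c3 : c 3 = 0 := by
    have : |(c 3 : ℝ)| < 1 := by
      rw [abs_div, abs_of_pos (by norm_num : (0 : ℝ) < 8)] at h3
      refine ((div_le_iff₀ (by norm_num)).mp h3).trans_lt ?_
      norm_num
    exact Int.abs_lt_one_iff.mp (by exact_mod_cast this)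
  have c2 : c 2 = 0 := by
    simp only [hT, c3, Int.cast_zero, zero_div, zero_mul, add_zero] at t013
    have : |(c 2 : ℝ)| < 1 := t013.trans_lt (by norm_num)
    exact Int.abs_lt_one_iff.mp (by exact_mod_cast this)
  have c1 : c 1 = 0 := by
    have := hsub 3 0
    rw [← hD1] at this
    simp only [hD, c3, c2, Int.cast_zero, zero_div, zero_mul, add_zero] at this
    have := abs_le_div_of_mul (h₀ := 13) (by norm_num) (by linarith) this
    have : |(c 1 : ℝ)| < 1 := this.trans_lt (by norm_num)
    exact Int.abs_lt_one_iff.mp (by exact_mod_cast this)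
  exact ⟨c1, c2, c3⟩

theorem abs_eq_one_of_mem_rootOrder {z : Fin 4 → ℝ} (hz : z ∈ rootOrder)
    (hle : ∀ i, |z i| ≤ 5.6) (hN : |∏ i, z i| = 1) (i : Fin 4) : |z i| = 1 := by
  obtain ⟨c, hc⟩ := hz
  obtain ⟨h1, h2, h3⟩ := eq_zero_of_abs_ordEval_root_le (c := c) fun i ↦ hc i ▸ hle i
  have hzc : ∀ i, z i = c 0 := fun i ↦ by rw [hc]; simp [ordEval, h1, h2, h3]
  simp only [hzc] at hN ⊢
  rw [Finset.prod_const, Finset.card_univ, Fintype.card_fin, abs_pow] at hN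
  exact (pow_eq_one_iff_of_nonneg (abs_nonneg _) (by norm_num)).mp hN

theorem Real.exp_lt_of_le {x : ℝ} (hx : x ≤ 1.71) : Real.exp x < 5.6 := by
  have h := Real.exp_bound' (x := 0.57) (by norm_num) (by norm_num) (n := 6) (by norm_num)
  have h2 : Real.exp x ≤ Real.exp 0.57 ^ 3 := by
    rw [← Real.exp_nat_mul]
    exact Real.exp_le_exp.mpr (by push_cast; linarith)
  refine h2.trans_lt ?_
  refine (pow_le_pow_left₀ (Real.exp_pos _).le h 3).trans_lt ?_
  norm_num [Finset.sum_range_succ, Nat.factorial]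

noncomputable def unitVec (j : Fin 3) : Fin 4 → ℝ := fun i ↦ ordEval (unitCoeff j) (root i)

theorem exists_mem_rootOrder_log_eq (j : Fin 3) (a : ℤ) : ∃ w ∈ rootOrder,
    ∀ i, w i ≠ 0 ∧ Real.log |w i| = a * unitLog i j := by
  have hu : unitVec j ∈ rootOrder := ⟨unitCoeff j, fun i ↦ rfl⟩
  obtain ⟨n, rfl | rfl⟩ := a.eq_nat_or_neg
  · refine ⟨unitVec j ^ n, pow_mem hu n, fun i ↦ ?_⟩
    have : unitVec j i ≠ 0 := ordEval_unitCoeff_ne_zero (quartic_root i) j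
    rw [Pi.pow_apply]
    refine ⟨pow_ne_zero _ this, ?_⟩
    rw [abs_pow, Real.log_pow, Int.cast_natCast]
    rfl
  · refine ⟨(fun i ↦ ordEval (unitInvCoeff j) (root i)) ^ n,
      pow_mem (⟨unitInvCoeff j, fun i ↦ rfl⟩ : _ ∈ rootOrder) n, fun i ↦ ?_⟩
    have h1 := ordEval_unitCoeff_mul (quartic_root i) j
    rw [Pi.pow_apply]
    refine ⟨pow_ne_zero _ (right_ne_zero_of_mul_eq_one h1), ?_⟩
    rw [abs_pow, Real.log_pow, ← inv_eq_of_mul_eq_one_right h1, abs_inv, Real.log_inv, unitLog]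
    push_cast
    ring

theorem exists_exponents {η : Fin 4 → ℝ} (hη : η ∈ rootOrder) (hN : |∏ i, η i| = 1) {M : ℝ}
    (hM : ∀ i, |Real.log (|η i|)| ≤ M) :
    ∃ k : ℕ, 1 ≤ k ∧ k ≤ 2527 ∧ ∃ a : Fin 3 → ℤ,
      (∀ i, k * Real.log |η i| = ∑ j, a j * unitLog i j) ∧ ∀ j, |(a j : ℝ)| ≤ 2527 * M + 1 := by
  obtain ⟨t, ht⟩ := exists_forall_sum_unitLog_eq fun i ↦ Real.log |η i.castSucc|
  have htM : ∀ j, 4.6 * |t j| ≤ M := mul_abs_le_of_forall_abs_sum_le fun i ↦ by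
    rw [ht]; exact hM _
  have hη0 : ∀ i, η i ≠ 0 := fun i h ↦ by
    rw [Finset.prod_eq_zero (Finset.mem_univ i) h] at hN
    norm_num at hN
  have hsum : ∑ i, Real.log |η i| = 0 := by
    rw [← Real.log_prod fun i _ ↦ abs_ne_zero.mpr (hη0 i), ← Finset.abs_prod, hN, Real.log_one]
  have ht4 : ∀ i, Real.log |η i| = ∑ j, unitLog i j * t j := fun i ↦ by
    induction i using Fin.lastCases with
    | cast i => exact (ht i).symm
    | last =>
      have h1 : ∀ j, unitLog (Fin.last 3) j = - ∑ i : Fin 3, unitLog i.castSucc j := fun j ↦ by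
        have := sum_unitLog j
        rw [Fin.sum_univ_castSucc] at this
        linarith
      rw [Fin.sum_univ_castSucc] at hsum
      simp only [h1, neg_mul, Finset.sum_mul, Finset.sum_neg_distrib]
      rw [Finset.sum_comm]
      simp only [ht]
      linarith
  obtain ⟨k, hk1, hk2, a, ha⟩ := exists_nat_forall_abs_mul_sub_lt t ![7, 19, 19] (by decide)
  have hk3 : k ≤ 2527 := hk2.trans (by decide)
  refine ⟨k, hk1, hk3, a, ?_, fun j ↦ ?_⟩
  · choose w hw hw' using fun j ↦ exists_mem_rootOrder_log_eq j (-a j)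
    set ρ : Fin 4 → ℝ := η ^ k * ∏ j, w j with hρ
    have hρm : ρ ∈ rootOrder := mul_mem (pow_mem hη k) (prod_mem fun j _ ↦ hw j)
    have hρi : ∀ i, ρ i = η i ^ k * ∏ j, w j i := fun i ↦ by
      rw [hρ, Pi.mul_apply, Pi.pow_apply, Finset.prod_apply]
    have hρ0 : ∀ i, ρ i ≠ 0 := fun i ↦ by
      rw [hρi]
      exact mul_ne_zero (pow_ne_zero _ (hη0 i)) (Finset.prod_ne_zero_iff.mpr fun j _ ↦ (hw' j i).1)
    have hlog : ∀ i, Real.log |ρ i| = k * Real.log |η i| - ∑ j, a j * unitLog i j := fun i ↦ by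
      rw [hρi, abs_mul, Real.log_mul (abs_ne_zero.mpr (pow_ne_zero _ (hη0 i)))
        (abs_ne_zero.mpr (Finset.prod_ne_zero_iff.mpr fun j _ ↦ (hw' j i).1)), abs_pow,
        Real.log_pow, Finset.abs_prod, Real.log_prod fun j _ ↦ abs_ne_zero.mpr (hw' j i).1]
      simp only [(hw' _ i).2, Int.cast_neg, neg_mul, Finset.sum_neg_distrib]
      ring
    have hlog2 : ∀ i, Real.log |ρ i| = ∑ j, (k * t j - a j) * unitLog i j := fun i ↦ by
      rw [hlog, ht4, Finset.mul_sum, ← Finset.sum_sub_distrib]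
      exact Finset.sum_congr rfl fun j _ ↦ by ring
    have hsmall : ∀ i, Real.log |ρ i| ≤ 1.71 := fun i ↦ by
      rw [hlog2]
      have hb : ∀ j, |unitLog i j| ≤ (|unitLogApprox i j| + 1 : ℤ) / 10 ^ 5 := fun j ↦ by
        have := unitLog_mem i j
        push_cast
        have h1 := neg_abs_le (unitLogApprox i j : ℝ)
        have h2 := le_abs_self (unitLogApprox i j : ℝ)
        rw [abs_le]
        constructor <;> linarith
      have hj : ∀ j, (k * t j - a j) * unitLog i j ≤
          1 / (![7, 19, 19] j : ℕ) * ((|unitLogApprox i j| + 1 : ℤ) / 10 ^ 5) := fun j ↦ by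
        refine (le_abs_self _).trans ?_
        rw [abs_mul]
        exact mul_le_mul (ha j).le (hb j) (abs_nonneg _) (by positivity)
      refine (Finset.sum_le_sum fun j _ ↦ hj j).trans ?_
      have hc : 19 * (|unitLogApprox i 0| + 1) + 7 * (|unitLogApprox i 1| + 1) +
          7 * (|unitLogApprox i 2| + 1) ≤ 133 * 171000 := by
        clear * -
        decide +revert
      have hc' : (19 : ℝ) * (|unitLogApprox i 0| + 1 : ℤ) + 7 * (|unitLogApprox i 1| + 1 : ℤ) +
          7 * (|unitLogApprox i 2| + 1 : ℤ) ≤ 133 * 171000 := by exact_mod_cast hc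
      simp only [Fin.sum_univ_three, Matrix.cons_val, Nat.cast_ofNat]
      linarith
    have hone := abs_eq_one_of_mem_rootOrder hρm (fun i ↦ by
      rw [← Real.exp_log (abs_pos.mpr (hρ0 i))]
      exact (Real.exp_lt_of_le (hsmall i)).le) (by
      have hs : ∑ i, Real.log |ρ i| = 0 := by
        simp only [hlog, Finset.sum_sub_distrib]
        rw [← Finset.mul_sum, hsum, Finset.sum_comm]
        simp only [← Finset.mul_sum, sum_unitLog]
        simp
      rw [← Real.log_prod fun i _ ↦ abs_ne_zero.mpr (hρ0 i), ← Finset.abs_prod] at hs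
      exact Real.eq_one_of_pos_of_log_eq_zero
        (abs_pos.mpr (Finset.prod_ne_zero_iff.mpr fun i _ ↦ hρ0 i)) hs)
    intro i
    have := hlog i
    rw [hone, Real.log_one] at this
    linarith
  · have h1 : |(a j : ℝ)| ≤ |k * t j| + 1 := by
      have h2 : (1 : ℝ) / (![7, 19, 19] j : ℕ) ≤ 1 := by fin_cases j <;> norm_num
      have h3 := abs_sub_abs_le_abs_sub (a j : ℝ) (k * t j)
      rw [abs_sub_comm] at h3
      linarith [ha j]
    rw [abs_mul, Nat.abs_cast] at h1
    have hk4 : (k : ℝ) ≤ 2527 := by exact_mod_cast hk3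
    nlinarith [htM j, abs_nonneg (t j)]

theorem sub_root_mul_mem_rootOrder (x y : ℤ) :
    (fun i ↦ (x : ℝ) - root i * y) ∈ rootOrder :=
  ⟨![x, -y, 0, 0], fun i ↦ by simp [ordEval]; ring⟩

theorem abs_log_le_two_mul {t : ℝ} (ht : |t - 1| ≤ 1 / 2) : |Real.log t| ≤ 2 * |t - 1| := by
  have h := abs_le.mp ht
  have h0 : 0 < t := by linarith
  have h1 := Real.log_le_sub_one_of_pos h0
  have h2 := Real.one_sub_inv_le_log_of_pos h0
  have h3 : 1 - t⁻¹ = (t - 1) * t⁻¹ := by field_simp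
  have h4 : t⁻¹ ≤ 2 := by
    rw [inv_le_comm₀ h0 (by norm_num)]; linarith
  have h5 : |(t - 1) * t⁻¹| ≤ 2 * |t - 1| := by
    rw [abs_mul, abs_of_pos (inv_pos.mpr h0), mul_comm]
    gcongr
  rw [abs_le]
  constructor
  · linarith [(abs_le.mp h5).1]
  · linarith [le_abs_self (t - 1), abs_nonneg (t - 1)]

theorem exists_abs_sub_root_mul_le {x y : ℝ} (hy : 1 ≤ y)
    (h : |∏ i, (x - root i * y)| ≤ 1) : ∃ i₀, |x - root i₀ * y| ≤ 0.33 / y ^ 3 ∧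
      ∀ i ≠ i₀, 1.45 * y ≤ |x - root i * y| ∧ |x - root i * y| ≤ 14 * y := by
  obtain ⟨i₀, -, hi₀⟩ := Finset.exists_min_image Finset.univ (fun i ↦ |x - root i * y|)
    ⟨0, Finset.mem_univ 0⟩
  have hy0 : 0 < y := by linarith
  have hdiff : ∀ i, (x - root i * y) - (x - root i₀ * y) = (root i₀ - root i) * y :=
    fun i ↦ by ring
  have hlow : ∀ i ≠ i₀, 1.45 * y ≤ |x - root i * y| := fun i hi ↦ by
    have h1 := abs_sub (x - root i * y) (x - root i₀ * y)
    rw [hdiff, abs_mul, abs_of_pos hy0] at h1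
    have h2 := lt_abs_root_sub_root hi.symm
    have h3 := hi₀ i (Finset.mem_univ i)
    nlinarith
  have hsmall : |x - root i₀ * y| ≤ 0.33 / y ^ 3 := by
    rw [le_div_iff₀ (by positivity)]
    rw [Finset.abs_prod, ← Finset.mul_prod_erase _ _ (Finset.mem_univ i₀)] at h
    have h1 : (1.45 * y) ^ 3 ≤ ∏ i ∈ Finset.univ.erase i₀, |x - root i * y| := by
      have hc : (Finset.univ.erase i₀).card = 3 := by
        rw [Finset.card_erase_of_mem (Finset.mem_univ _)]; rfl
      rw [← hc, ← Finset.prod_const]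
      exact Finset.prod_le_prod (fun _ _ ↦ by positivity)
        fun i hi ↦ hlow i (Finset.ne_of_mem_erase hi)
    have h2 := (mul_le_mul_of_nonneg_left h1 (abs_nonneg (x - root i₀ * y))).trans h
    nlinarith
  refine ⟨i₀, hsmall, fun i hi ↦ ⟨hlow i hi, ?_⟩⟩
  have h1 := abs_add_le ((root i₀ - root i) * y) (x - root i₀ * y)
  rw [← hdiff, sub_add_cancel, hdiff, abs_mul, abs_of_pos hy0] at h1
  have h2 := abs_root_sub_root_lt i₀ i
  have h3 : 0.33 / y ^ 3 ≤ 0.33 := div_le_self (by norm_num) (one_le_pow₀ hy)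
  nlinarith

noncomputable def linForm (i₀ i i' : Fin 4) (k : ℕ) (a : Fin 3 → ℤ) : ℝ :=
  ∑ j, a j * (unitLog i j - unitLog i' j) + k * (rootDiffLog i' i₀ - rootDiffLog i i₀)

theorem exists_small_linForm {x y : ℤ} (hy : 2 ≤ y)
    (h : |∏ i, ((x : ℝ) - root i * y)| = 1) :
    ∃ i₀, |(x : ℝ) - root i₀ * y| ≤ 0.33 / y ^ 3 ∧ ∃ k : ℕ, 1 ≤ k ∧ k ≤ 2527 ∧
      ∃ a : Fin 3 → ℤ, (∀ j, |(a j : ℝ)| ≤ 2527 * (3 * Real.log y + 8) + 1) ∧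
      ∀ i i', i ≠ i₀ → i' ≠ i₀ → i ≠ i' →
        linForm i₀ i i' k a ≠ 0 ∧ |linForm i₀ i i' k a| ≤ k * (2.2 / y ^ 4) := by
  have hy' : (2 : ℝ) ≤ y := by exact_mod_cast hy
  have hy0 : (0 : ℝ) < y := by linarith
  obtain ⟨i₀, hs, hl⟩ := exists_abs_sub_root_mul_le (x := (x : ℝ)) (y := (y : ℝ)) (by linarith) h.le
  have hη0 : ∀ i, (x : ℝ) - root i * y ≠ 0 := fun i h0 ↦ by
    rw [Finset.prod_eq_zero (Finset.mem_univ i) h0] at h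
    norm_num at h
  have hlog14 : Real.log 14 ≤ 8 / 3 := by
    rw [Real.log_le_iff_le_exp (by norm_num)]
    have h1 : (14 : ℝ) ^ 3 ≤ Real.exp (8 / 3) ^ 3 := by
      rw [← Real.exp_nat_mul, show ((3 : ℕ) : ℝ) * (8 / 3) = ((8 : ℕ) : ℝ) * 1 by norm_num,
        Real.exp_nat_mul]
      have := Real.exp_one_gt_d9
      refine le_trans ?_ (pow_le_pow_left₀ (by norm_num) this.le 8)
      norm_num
    exact le_of_pow_le_pow_left₀ (by norm_num) (Real.exp_pos _).le h1
  have hlogy : 0 ≤ Real.log y := Real.log_nonneg (by linarith)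
  have hM : ∀ i, |Real.log (|(x : ℝ) - root i * y|)| ≤ 3 * Real.log y + 8 := fun i ↦ by
    by_cases hi : i = i₀
    · subst hi
      have h1 : |(x : ℝ) - root i * y| ≤ 1 := hs.trans (by
        rw [div_le_one (by positivity)]
        nlinarith [one_le_pow₀ (n := 3) (show (1 : ℝ) ≤ y by linarith)])
      rw [abs_of_nonpos (Real.log_nonpos (abs_nonneg _) h1)]
      have h2 := h
      rw [Finset.abs_prod, ← Finset.mul_prod_erase _ _ (Finset.mem_univ i)] at h2
      have h3 : ∏ j ∈ Finset.univ.erase i, |(x : ℝ) - root j * y| ≤ (14 * y) ^ 3 := by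
        have hc : (Finset.univ.erase i).card = 3 := by
          rw [Finset.card_erase_of_mem (Finset.mem_univ _)]; rfl
        rw [← hc, ← Finset.prod_const]
        exact Finset.prod_le_prod (fun _ _ ↦ abs_nonneg _)
          fun j hj ↦ (hl j (Finset.ne_of_mem_erase hj)).2
      have h4 : 1 ≤ |(x : ℝ) - root i * y| * (14 * y) ^ 3 :=
        h2.symm.le.trans (mul_le_mul_of_nonneg_left h3 (abs_nonneg _))
      have h5 := Real.log_nonneg h4
      rw [Real.log_mul (abs_ne_zero.mpr (hη0 i)) (by positivity), Real.log_pow,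
        Real.log_mul (by norm_num) hy0.ne'] at h5
      push_cast at h5
      linarith
    · obtain ⟨h1, h2⟩ := hl i hi
      rw [abs_of_nonneg (Real.log_nonneg (by nlinarith))]
      have h3 := Real.log_le_log (abs_pos.mpr (hη0 i)) h2
      rw [Real.log_mul (by norm_num) hy0.ne'] at h3
      linarith
  obtain ⟨k, hk1, hk2, a, ha, hab⟩ := exists_exponents (sub_root_mul_mem_rootOrder x y) h hM
  refine ⟨i₀, hs, k, hk1, hk2, a, hab, fun i i' hi hi' hii ↦ ?_⟩
  have hk0 : (0 : ℝ) < k := by exact_mod_cast hk1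
  set τ : ℝ := (root i' - root i₀) * (x - root i * y) / ((root i - root i₀) * (x - root i' * y))
    with hτ
  have n1 : root i' - root i₀ ≠ 0 := sub_ne_zero.mpr (root_strictMono.injective.ne hi')
  have n2 : root i - root i₀ ≠ 0 := sub_ne_zero.mpr (root_strictMono.injective.ne hi)
  have n3 : root i' - root i ≠ 0 := sub_ne_zero.mpr (root_strictMono.injective.ne hii.symm)
  have hτ1 : τ - 1 = (root i' - root i) * (x - root i₀ * y) /
      ((root i - root i₀) * (x - root i' * y)) := by
    have := hη0 i'
    rw [hτ]
    field_simp
    ring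
  have hτ2 : |τ - 1| ≤ 1.1 / y ^ 4 := by
    rw [hτ1, abs_div, abs_mul, abs_mul]
    have b1 : |root i' - root i| * |x - root i₀ * y| ≤ 13.6 * (0.33 / y ^ 3) :=
      mul_le_mul (abs_root_sub_root_lt _ _).le hs (abs_nonneg _) (by norm_num)
    have b2 : 2.9 * (1.45 * y) ≤ |root i - root i₀| * |(x : ℝ) - root i' * y| :=
      mul_le_mul (lt_abs_root_sub_root hi).le (hl i' hi').1 (by positivity) (abs_nonneg _)
    refine (div_le_div₀ (by positivity) b1 (by positivity) b2).trans ?_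
    have e : 13.6 * (0.33 / (y : ℝ) ^ 3) / (2.9 * (1.45 * y)) =
        13.6 * 0.33 / (2.9 * 1.45) / (y : ℝ) ^ 4 := by field_simp
    rw [e]
    exact div_le_div_of_nonneg_right (by norm_num) (by positivity)
  have hτ3 : |τ - 1| ≤ 1 / 2 := hτ2.trans (by
    rw [div_le_iff₀ (by positivity)]
    nlinarith [pow_le_pow_left₀ (by norm_num) hy' 4])
  have hτ4 : 0 < τ := by linarith [(abs_le.mp hτ3).1]
  have hτ5 : τ ≠ 1 := by
    rw [← sub_ne_zero, hτ1]
    exact div_ne_zero (mul_ne_zero n3 (hη0 _)) (mul_ne_zero n2 (hη0 _))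
  have hlin : linForm i₀ i i' k a = k * Real.log τ := by
    rw [← abs_of_pos hτ4, hτ, abs_div, abs_mul, abs_mul,
      Real.log_div (by simp [n1, hη0]) (by simp [n2, hη0]),
      Real.log_mul (abs_ne_zero.mpr n1) (abs_ne_zero.mpr (hη0 _)),
      Real.log_mul (abs_ne_zero.mpr n2) (abs_ne_zero.mpr (hη0 _)), linForm]
    simp only [mul_sub, Finset.sum_sub_distrib, mul_add, ← ha, rootDiffLog]
    ring
  rw [hlin]
  refine ⟨mul_ne_zero hk0.ne' (Real.log_ne_zero_of_pos_of_ne_one hτ4 hτ5), ?_⟩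
  rw [abs_mul, Nat.abs_cast]
  refine mul_le_mul_of_nonneg_left ?_ hk0.le
  refine (abs_log_le_two_mul hτ3).trans ?_
  rw [show (2.2 : ℝ) / y ^ 4 = 2 * (1.1 / y ^ 4) by ring]
  linarith

theorem two_pow_neg_lt_abs_linear_form_log_of_ne_zero {L : Type*} [Field L] [NumberField L]
    (φ₀ : L →ₐ[ℚ] ℝ) {D g h₁ h₂ N : ℕ} {α β d : L} (hD : Module.finrank ℚ L ≤ D)
    (hα : IsIntegral ℤ α) (hd : IsIntegral ℤ d) (hβ : IsIntegral ℤ (d * β)) (hd0 : d ≠ 0)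
    (hα0 : 0 < φ₀ α) (hβ0 : 0 < φ₀ β)
    (hφα : ∀ φ : L →ₐ[ℚ] ℂ, ‖φ α‖ ≤ 2 ^ h₁) (hφd : ∀ φ : L →ₐ[ℚ] ℂ, ‖φ d‖ ≤ 2 ^ h₂)
    (hφβ : ∀ φ : L →ₐ[ℚ] ℂ, ‖φ (d * β)‖ ≤ 2 ^ h₂) (hlog : |Real.log (φ₀ β)| ≤ h₂)
    (hh₁ : 1 ≤ h₁) (hh₂ : 1 ≤ h₂) (hg : 1000 * D ^ 2 ≤ g) (hN : g ^ 3 * h₂ ≤ N)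
    (hX : 2 * N * (g ^ 3 * h₁) ≤ 2 ^ g)
    (hΛ : N * Real.log (φ₀ α) + Real.log (φ₀ β) ≠ 0) :
    (1 / 2) ^ (18 * D * (g ^ 5 * h₁ * h₂)) < |N * Real.log (φ₀ α) + Real.log (φ₀ β)| := by
  by_cases hα1 : φ₀ α = 1
  swap
  · exact two_pow_neg_lt_abs_linear_form_log φ₀ hD hα hd hβ hd0 hα0 hα1 hβ0 hφα hφd hφβ hlog hh₁
      hh₂ hg hN hX
  simp only [hα1, Real.log_one, mul_zero, zero_add] at hΛ ⊢
  have hD1 : 1 ≤ D := le_trans (Module.finrank_pos (R := ℚ) (M := L)) hD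
  have hβ1 : φ₀ β ≠ 1 := fun h ↦ hΛ (by rw [h, Real.log_one])
  have hne : d * β - d ≠ 0 := fun h ↦ hβ1 (by
    have h1 : d * (β - 1) = 0 := by rw [← h]; ring
    have h2 := (mul_eq_zero.mp h1).resolve_left hd0
    rw [sub_eq_zero.mp h2, map_one])
  have h1 := one_le_pow_finrank_mul_norm (hβ.sub hd) hne (M := 2 ^ (h₂ + 1))
    (one_le_pow₀ (by norm_num)) hD (fun φ ↦ by
      rw [map_sub, pow_succ]
      linarith [norm_sub_le (φ (d * β)) (φ d), hφβ φ, hφd φ])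
    (((Complex.ofRealAm.restrictScalars ℚ) : ℝ →ₐ[ℚ] ℂ).comp φ₀)
  have hd1 := hφd (((Complex.ofRealAm.restrictScalars ℚ) : ℝ →ₐ[ℚ] ℂ).comp φ₀)
  have e1 : ∀ z, (((Complex.ofRealAm.restrictScalars ℚ) : ℝ →ₐ[ℚ] ℂ).comp φ₀) z = (φ₀ z : ℂ) :=
    fun _ ↦ rfl
  rw [e1, Complex.norm_real, Real.norm_eq_abs] at h1 hd1
  rw [map_sub, map_mul, show φ₀ d * φ₀ β - φ₀ d = φ₀ d * (φ₀ β - 1) by ring, abs_mul] at h1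
  have h2 : 1 ≤ 2 ^ ((h₂ + 1) * D + h₂) * |φ₀ β - 1| := by
    refine h1.trans ?_
    rw [pow_add (2 : ℝ) ((h₂ + 1) * D) h₂, pow_mul, mul_assoc]
    gcongr
  have hexp : (h₂ + 1) * D + h₂ + 1 < 18 * D * (g ^ 5 * h₁ * h₂) := by
    have : 1000 ≤ g := le_trans (by nlinarith) hg
    have h3 : 1 * 1 * h₂ ≤ g ^ 5 * h₁ * h₂ := by
      gcongr
      exact Nat.one_le_pow _ _ (by omega)
    have h4 := Nat.mul_le_mul_left (18 * D) h3
    nlinarith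
  by_contra! hc
  set E := 18 * D * (g ^ 5 * h₁ * h₂)
  have h3 : ((1 : ℝ) / 2) ^ E < (1 / 2) ^ ((h₂ + 1) * D + h₂ + 1) :=
    pow_lt_pow_right_of_lt_one₀ (by norm_num) (by norm_num) hexp
  have h4 : |Real.log (φ₀ β)| ≤ 1 / 2 := by
    refine hc.trans (h3.le.trans ?_)
    exact pow_le_of_le_one (by norm_num) (by norm_num) (by omega)
  have h5 := Real.abs_exp_sub_one_le (x := Real.log (φ₀ β)) (by linarith)
  rw [Real.exp_log hβ0] at h5
  have h6 : |φ₀ β - 1| < (1 / 2) ^ ((h₂ + 1) * D + h₂) := by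
    rw [pow_succ] at h3
    linarith
  have h7 := mul_lt_mul_of_pos_left h6 (show (0 : ℝ) < 2 ^ ((h₂ + 1) * D + h₂) by positivity)
  rw [← mul_pow] at h7
  norm_num at h7
  linarith

theorem quartic_eq_prod_root_complex (z : ℂ) :
    quartic z = (z - root 0) * (z - root 1) * (z - root 2) * (z - root 3) := by
  have h0 := quartic_eq_prod_root 0
  have h1 := quartic_eq_prod_root 1
  have h2 := quartic_eq_prod_root (-1)
  have h3 := quartic_eq_prod_root 2
  simp only [quartic] at *
  set a := root 0
  set b := root 1
  set c := root 2
  set d := root 3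
  have e4 : a * b * c * d = 48 := by linear_combination -h0
  have e2 : a * b + a * c + a * d + b * c + b * d + c * d = -21 := by
    linear_combination h0 - h1 / 2 - h2 / 2
  have e3 : a * b * c + a * b * d + a * c * d + b * c * d = -88 := by
    linear_combination (4 * (h1 - h2) - (h3 + 4 * e2 + e4)) / 6
  have e1 : a + b + c + d = 9 := by
    linear_combination h1 / 2 - h2 / 2 - e3
  have e1' := congrArg ((↑) : ℝ → ℂ) e1
  have e2' := congrArg ((↑) : ℝ → ℂ) e2
  have e3' := congrArg ((↑) : ℝ → ℂ) e3
  have e4' := congrArg ((↑) : ℝ → ℂ) e4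
  push_cast at e1' e2' e3' e4'
  linear_combination z ^ 3 * e1' - z ^ 2 * e2' + z * e3' - e4'

theorem isIntegral_of_quartic_eq_zero {R : Type*} [CommRing R] {t : R} (ht : quartic t = 0) :
    IsIntegral ℤ t := by
  refine ⟨.X ^ 4 - 9 * .X ^ 3 - 21 * .X ^ 2 + 88 * .X + 48, by monicity!, ?_⟩
  simpa [quartic] using ht

theorem isIntegral_ordEval {R : Type*} [Field R] [CharZero R] {t : R} (ht : quartic t = 0)
    (c : Fin 4 → ℤ) : IsIntegral ℤ (ordEval c t) := by
  have h1 := isIntegral_of_quartic_eq_zero ht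
  have h2 : IsIntegral ℤ ((4 + 7 * t + 3 * t ^ 2 + t ^ 3) / 8) := by
    refine ⟨.X ^ 4 - 185 * .X ^ 3 + 945 * .X ^ 2 + 4580 * .X - 664, by monicity!, ?_⟩
    set w : Fin 4 → ℤ := ![0, 0, 0, 1]
    have e1 : ordEval w t = (4 + 7 * t + 3 * t ^ 2 + t ^ 3) / 8 := by simp [ordEval, w]
    have e2 := ordEval_mul ht w w
    have e3 := ordEval_mul ht (ordMul w w) w
    have e4 := ordEval_mul ht (ordMul w w) (ordMul w w)
    rw [e2] at e3 e4
    rw [show ordMul (ordMul w w) (ordMul w w) = ![-8440656, -15601040, -1772595, 7743680] by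
      decide +kernel] at e4
    rw [show ordMul (ordMul w w) w = ![-46916, -86695, -9837, 43088] by decide +kernel] at e3
    rw [show ordMul w w = ![-252, -463, -50, 236] by decide +kernel] at e2
    rw [← e1]
    simp only [Polynomial.eval₂_add, Polynomial.eval₂_sub, Polynomial.eval₂_mul,
      Polynomial.eval₂_pow, Polynomial.eval₂_X, Polynomial.eval₂_ofNat]
    have e5 : ordEval w t ^ 4 - 185 * ordEval w t ^ 3 + 945 * ordEval w t ^ 2 +
        4580 * ordEval w t - 664 = 0 := by
      have e6 : ordEval ![-8440656, -15601040, -1772595, 7743680] t -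
        185 * ordEval ![-46916, -86695, -9837, 43088] t + 945 * ordEval ![-252, -463, -50, 236] t +
        4580 * ordEval w t - 664 = 0 := by
        simp [ordEval, w]
        ring
      rw [e2, e3, e4] at e6
      linear_combination e6
    exact e5
  have hz : ∀ n : ℤ, IsIntegral ℤ (n : R) := fun n ↦ isIntegral_algebraMap (x := n)
  exact (((hz _).add ((hz _).mul h1)).add ((hz _).mul (h1.pow 2))).add ((hz _).mul h2)

theorem exists_numberField_root : ∃ (L : Type) (_ : Field L) (_ : NumberField L)
    (φ₀ : L →ₐ[ℚ] ℝ) (τ : Fin 4 → L), Module.finrank ℚ L ≤ 256 ∧ (∀ i, φ₀ (τ i) = root i) ∧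
    (∀ i, quartic (τ i) = 0) ∧
    ∀ (φ : L →ₐ[ℚ] ℂ), ∃ σ : Fin 4 → Fin 4, Function.Injective σ ∧ ∀ i, φ (τ i) = root (σ i) := by
  have hfin : FiniteDimensional ℚ (IntermediateField.adjoin ℚ (Set.range root)) :=
    IntermediateField.finiteDimensional_adjoin (by
      rintro x ⟨i, rfl⟩
      exact (isIntegral_of_quartic_eq_zero (quartic_root i)).tower_top)
  let L := IntermediateField.adjoin ℚ (Set.range root)
  have hmem : ∀ i, root i ∈ L := fun i ↦ IntermediateField.subset_adjoin ℚ _ ⟨i, rfl⟩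
  have hτ : ∀ i, quartic (⟨root i, hmem i⟩ : L) = 0 := fun i ↦ Subtype.ext (quartic_root i)
  have hσ : ∀ (φ : L →ₐ[ℚ] ℂ) i, ∃ j, φ ⟨root i, hmem i⟩ = root j := fun φ i ↦ by
    have h1 : quartic (φ ⟨root i, hmem i⟩) = 0 := by
      rw [← map_zero φ, ← hτ i]
      simp only [quartic, map_add, map_sub, map_mul, map_pow, map_ofNat]
    rw [quartic_eq_prod_root_complex] at h1
    rcases mul_eq_zero.mp h1 with h1 | h1
    · rcases mul_eq_zero.mp h1 with h1 | h1
      · rcases mul_eq_zero.mp h1 with h1 | h1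
        · exact ⟨0, sub_eq_zero.mp h1⟩
        · exact ⟨1, sub_eq_zero.mp h1⟩
      · exact ⟨2, sub_eq_zero.mp h1⟩
    · exact ⟨3, sub_eq_zero.mp h1⟩
  choose σ hσ using hσ
  refine ⟨L, inferInstance, ⟨⟩, L.val, fun i ↦ ⟨root i, hmem i⟩, ?_, fun i ↦ rfl, hτ,
    fun φ ↦ ⟨σ φ, fun i j hij ↦ ?_, hσ φ⟩⟩
  · rw [← AlgHom.card ℚ L ℂ]
    refine (Fintype.card_le_of_injective σ fun φ ψ h ↦ ?_).trans (by simp)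
    have h1 : (φ : L →+* ℂ).toRatAlgHom = (ψ : L →+* ℂ).toRatAlgHom := by
      refine IntermediateField.algHom_ext_of_eq_adjoin ℚ rfl ?_
      rintro x ⟨i, rfl⟩
      exact (hσ φ i).trans ((congrArg (fun j ↦ (root j : ℂ)) (congrFun h i)).trans (hσ ψ i).symm)
    exact AlgHom.ext fun x ↦ DFunLike.congr_fun h1 x
  · have h1 := hσ φ i
    rw [hij, ← hσ φ j] at h1
    exact root_strictMono.injective (congrArg Subtype.val (φ.toRingHom.injective h1))

theorem IsIntegral.zpow_of_inv {R : Type*} [Field R] {x : R} (hx : IsIntegral ℤ x)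
    (hx' : IsIntegral ℤ x⁻¹) (z : ℤ) : IsIntegral ℤ (x ^ z) := by
  obtain ⟨n, rfl | rfl⟩ := z.eq_nat_or_neg
  · rw [zpow_natCast]; exact hx.pow n
  · rw [zpow_neg, zpow_natCast, ← inv_pow]; exact hx'.pow n

theorem norm_zpow_le_two_pow {x : ℂ} {C n : ℕ} (hx : ‖x‖ ≤ 2 ^ C) (hx' : ‖x⁻¹‖ ≤ 2 ^ C) {z : ℤ}
    (hz : |z| ≤ n) : ‖x ^ z‖ ≤ 2 ^ (C * n) := by
  obtain ⟨m, rfl | rfl⟩ := z.eq_nat_or_neg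
  · rw [zpow_natCast, norm_pow, pow_mul]
    have hm : m ≤ n := by simpa using hz
    exact (pow_le_pow_left₀ (norm_nonneg _) hx m).trans
      (pow_le_pow_right₀ (one_le_pow₀ (by norm_num)) hm)
  · rw [zpow_neg, zpow_natCast, ← inv_pow, norm_pow, pow_mul]
    have hm : m ≤ n := by simpa using hz
    exact (pow_le_pow_left₀ (norm_nonneg _) hx' m).trans
      (pow_le_pow_right₀ (one_le_pow₀ (by norm_num)) hm)

theorem abs_unitLog_le (i : Fin 4) (j : Fin 3) : |unitLog i j| ≤ 18 := by
  obtain ⟨h1, h2⟩ := unitLog_mem i j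
  have h3 : -1800000 ≤ unitLogApprox i j ∧ unitLogApprox i j + 1 ≤ 1800000 := by
    clear * -
    decide +kernel +revert
  have h4 : (-1800000 : ℝ) ≤ unitLogApprox i j := by exact_mod_cast h3.1
  have h5 : (unitLogApprox i j : ℝ) + 1 ≤ 1800000 := by exact_mod_cast h3.2
  rw [abs_le]
  constructor <;> linarith

theorem exp_eighteen_le : Real.exp 18 ≤ 2 ^ 28 := by
  have h := Real.exp_one_lt_d9
  rw [show (18 : ℝ) = (18 : ℕ) * 1 by norm_num, Real.exp_nat_mul]
  refine (pow_le_pow_left₀ (Real.exp_pos _).le h.le 18).trans ?_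
  norm_num

theorem abs_ordEval_unitCoeff_le (i : Fin 4) (j : Fin 3) :
    |ordEval (unitCoeff j) (root i)| ≤ 2 ^ 28 := by
  have h := ordEval_unitCoeff_ne_zero (quartic_root i) j
  rw [← Real.exp_log (abs_pos.mpr h)]
  refine le_trans (Real.exp_le_exp.mpr ?_) exp_eighteen_le
  exact (le_abs_self _).trans (abs_unitLog_le i j)

theorem abs_ordEval_unitInvCoeff_le (i : Fin 4) (j : Fin 3) :
    |ordEval (unitInvCoeff j) (root i)| ≤ 2 ^ 28 := by
  have h := ordEval_unitCoeff_ne_zero (quartic_root i) j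
  rw [eq_inv_of_mul_eq_one_right (ordEval_unitCoeff_mul (quartic_root i) j), abs_inv,
    ← Real.exp_log (abs_pos.mpr h), ← Real.exp_neg]
  refine le_trans (Real.exp_le_exp.mpr ?_) exp_eighteen_le
  exact (neg_le_abs _).trans (abs_unitLog_le i j)

theorem exists_unit_of_exponents {L : Type*} [Field L] [NumberField L] {φ₀ : L →ₐ[ℚ] ℝ}
    {τ : Fin 4 → L} (hτ₀ : ∀ i, φ₀ (τ i) = root i) (hτ : ∀ i, quartic (τ i) = 0)
    (hφ : ∀ (φ : L →ₐ[ℚ] ℂ), ∃ σ : Fin 4 → Fin 4, ∀ i, φ (τ i) = root (σ i))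
    (i i' : Fin 4) {z : Fin 3 → ℤ} {n : ℕ} (hz : ∀ j, |z j| ≤ n) :
    ∃ w : L, IsIntegral ℤ w ∧ (∀ (φ : L →ₐ[ℚ] ℂ), ‖φ w‖ ≤ 2 ^ (336 * n)) ∧ 0 < φ₀ w ∧
      Real.log (φ₀ w) = 2 * ∑ j, z j * (unitLog i j - unitLog i' j) := by
  set u : Fin 3 → L := fun j ↦ ordEval (unitCoeff j) (τ i) * ordEval (unitInvCoeff j) (τ i') with hu
  have hu' : ∀ j, (u j)⁻¹ = ordEval (unitCoeff j) (τ i') * ordEval (unitInvCoeff j) (τ i) :=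
    fun j ↦ by
      refine inv_eq_of_mul_eq_one_right ?_
      linear_combination (ordEval (unitCoeff j) (τ i') * ordEval (unitInvCoeff j) (τ i')) *
        ordEval_unitCoeff_mul (hτ i) j + ordEval_unitCoeff_mul (hτ i') j
  have hI : ∀ j, IsIntegral ℤ (u j) :=
    fun j ↦ (isIntegral_ordEval (hτ i) _).mul (isIntegral_ordEval (hτ i') _)
  have hI' : ∀ j, IsIntegral ℤ (u j)⁻¹ := fun j ↦ by
    rw [hu']
    exact (isIntegral_ordEval (hτ i') _).mul (isIntegral_ordEval (hτ i) _)
  have hb : ∀ (φ : L →ₐ[ℚ] ℂ) j l l',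
      ‖φ (ordEval (unitCoeff j) (τ l) * ordEval (unitInvCoeff j) (τ l'))‖ ≤ 2 ^ 56 :=
    fun φ j l l' ↦ by
      obtain ⟨σ, hσ⟩ := hφ φ
      have hr : ∀ c l, φ (ordEval c (τ l)) = (ordEval c (root (σ l)) : ℝ) := fun c l ↦ by
        rw [← AlgHom.coe_toRingHom, map_ordEval, AlgHom.coe_toRingHom, hσ, ← Complex.ofRealHom_eq_coe,
          ← Complex.ofRealHom_eq_coe, map_ordEval]
      rw [map_mul, hr, hr, norm_mul, Complex.norm_real, Complex.norm_real]
      exact (mul_le_mul (abs_ordEval_unitCoeff_le _ _) (abs_ordEval_unitInvCoeff_le _ _)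
        (abs_nonneg _) (by norm_num)).trans (by norm_num)
  have hu0 : ∀ j, φ₀ (u j) = ordEval (unitCoeff j) (root i) * ordEval (unitInvCoeff j) (root i') :=
    fun j ↦ by
      rw [hu, map_mul, ← AlgHom.coe_toRingHom, map_ordEval, map_ordEval, AlgHom.coe_toRingHom,
        hτ₀, hτ₀]
  have hinv : ∀ j, ordEval (unitInvCoeff j) (root i') = (ordEval (unitCoeff j) (root i'))⁻¹ :=
    fun j ↦ eq_inv_of_mul_eq_one_right (ordEval_unitCoeff_mul (quartic_root i') j)
  have hu0' : ∀ j, φ₀ (u j) ≠ 0 := fun j ↦ by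
    rw [hu0, hinv]
    exact mul_ne_zero (ordEval_unitCoeff_ne_zero (quartic_root i) j)
      (inv_ne_zero (ordEval_unitCoeff_ne_zero (quartic_root i') j))
  refine ⟨∏ j, u j ^ (2 * z j), IsIntegral.prod _ fun j _ ↦ (hI j).zpow_of_inv (hI' j) _,
    fun φ ↦ ?_, ?_, ?_⟩
  · rw [map_prod, norm_prod]
    have h1 : ∀ j ∈ Finset.univ, ‖φ (u j ^ (2 * z j))‖ ≤ 2 ^ (56 * (2 * n)) := fun j _ ↦ by
      rw [map_zpow₀]
      refine norm_zpow_le_two_pow (hb φ j i i') ?_ ?_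
      · rw [← map_inv₀, hu']
        exact hb φ j i' i
      · rw [abs_mul, abs_two]
        push_cast
        linarith [hz j]
    refine (Finset.prod_le_prod (fun _ _ ↦ norm_nonneg _) h1).trans ?_
    rw [Finset.prod_const, ← pow_mul]
    exact le_of_eq (by congr 1; simp; ring)
  · rw [map_prod]
    refine Finset.prod_pos fun j _ ↦ ?_
    rw [map_zpow₀]
    exact Even.zpow_pos (even_two_mul _) (hu0' j)
  · rw [map_prod, Real.log_prod fun j _ ↦ by rw [map_zpow₀]; exact zpow_ne_zero _ (hu0' j),
      Finset.mul_sum]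
    refine Finset.sum_congr rfl fun j _ ↦ ?_
    rw [map_zpow₀, Real.log_zpow, hu0, hinv, Real.log_mul, Real.log_inv, unitLog, unitLog,
      Real.log_abs, Real.log_abs]
    · push_cast; ring
    · exact ordEval_unitCoeff_ne_zero (quartic_root i) j
    · exact inv_ne_zero (ordEval_unitCoeff_ne_zero (quartic_root i') j)

theorem rootDiffLog_mem {i j : Fin 4} (h : i ≠ j) : 0 ≤ rootDiffLog i j ∧ rootDiffLog i j ≤ 4 := by
  have h1 := lt_abs_root_sub_root h
  have h2 := abs_root_sub_root_lt i j
  refine ⟨Real.log_nonneg (by linarith), ?_⟩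
  rw [rootDiffLog, Real.log_le_iff_le_exp (by linarith)]
  have h3 : (13.6 : ℝ) ≤ Real.exp 4 := by
    rw [show (4 : ℝ) = (4 : ℕ) * 1 by norm_num, Real.exp_nat_mul]
    refine le_trans ?_ (pow_le_pow_left₀ (by norm_num) Real.exp_one_gt_d9.le 4)
    norm_num
  linarith

theorem two_pow_neg_lt_abs_linForm {i₀ i i' : Fin 4} (hi : i ≠ i₀) (hi' : i' ≠ i₀) {k : ℕ}
    (hk : 1 ≤ k) {a q r : Fin 3 → ℤ} {N m R g : ℕ} (ha : ∀ j, a j = N * q j + r j)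
    (hq : ∀ j, |q j| ≤ m) (hr : ∀ j, |r j| ≤ R) (hm : 1 ≤ m) (hg : 1000 * 256 ^ 2 ≤ g)
    (hN : g ^ 3 * (8 * k + 336 * R) ≤ N) (hX : 2 * N * (g ^ 3 * (336 * m)) ≤ 2 ^ g)
    (hΛ : linForm i₀ i i' k a ≠ 0) :
    (1 / 2) ^ (18 * 256 * (g ^ 5 * (336 * m) * (8 * k + 336 * R))) <
      2 * |linForm i₀ i i' k a| := by
  obtain ⟨L, _, _, φ₀, τ, hfin, hτ₀, hτ, hφ⟩ := exists_numberField_root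
  have hφ' : ∀ (φ : L →ₐ[ℚ] ℂ), ∃ σ : Fin 4 → Fin 4, ∀ i, φ (τ i) = root (σ i) := fun φ ↦
    (hφ φ).imp fun _ h ↦ h.2
  obtain ⟨α, hα, hφα, hα0, hlα⟩ := exists_unit_of_exponents hτ₀ hτ hφ' i i' hq
  obtain ⟨γ, hγ, hφγ, hγ0, hlγ⟩ := exists_unit_of_exponents hτ₀ hτ hφ' i i' hr
  have hroot : ∀ {l l'}, l ≠ l' → root l - root l' ≠ 0 := fun h ↦
    sub_ne_zero.mpr (root_strictMono.injective.ne h)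
  have hτne : ∀ {l l'}, l ≠ l' → τ l - τ l' ≠ 0 := fun {l l'} h h0 ↦ hroot h (by
    rw [← hτ₀, ← hτ₀, ← map_sub, h0, map_zero])
  have hτI : ∀ l, IsIntegral ℤ (τ l) := fun l ↦ isIntegral_of_quartic_eq_zero (hτ l)
  have hτb : ∀ (φ : L →ₐ[ℚ] ℂ) l l', ‖φ ((τ l - τ l') ^ (2 * k))‖ ≤ 2 ^ (8 * k) :=
    fun φ l l' ↦ by
      obtain ⟨σ, hσ⟩ := hφ' φ
      rw [map_pow, map_sub, hσ, hσ, norm_pow, show 8 * k = 4 * (2 * k) by ring, pow_mul (2 : ℝ) 4,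
        ← Complex.ofReal_sub, Complex.norm_real]
      refine pow_le_pow_left₀ (norm_nonneg (root (σ l) - root (σ l'))) ?_ _
      rw [Real.norm_eq_abs]
      linarith [abs_root_sub_root_lt (σ l) (σ l')]
  set d : L := (τ i - τ i₀) ^ (2 * k) with hd
  have hd0 : d ≠ 0 := pow_ne_zero _ (hτne hi)
  set β : L := (τ i' - τ i₀) ^ (2 * k) / d * γ with hβ
  have hdβ : d * β = (τ i' - τ i₀) ^ (2 * k) * γ := by
    rw [hβ]; field_simp
  have hφβ0 : φ₀ β = (root i' - root i₀) ^ (2 * k) / (root i - root i₀) ^ (2 * k) * φ₀ γ := by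
    simp only [hβ, hd, map_mul, map_div₀, map_pow, map_sub, hτ₀]
  have hp : ∀ {l l'}, l ≠ l' → 0 < (root l - root l') ^ (2 * k) := fun h ↦
    Even.pow_pos (even_two_mul k) (hroot h)
  have hβ0 : 0 < φ₀ β := by
    rw [hφβ0]
    exact mul_pos (div_pos (hp hi') (hp hi)) hγ0
  have hlβ : Real.log (φ₀ β) = 2 * (∑ j, r j * (unitLog i j - unitLog i' j)) +
      2 * k * (rootDiffLog i' i₀ - rootDiffLog i i₀) := by
    rw [hφβ0, Real.log_mul (div_pos (hp hi') (hp hi)).ne' hγ0.ne',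
      Real.log_div (hp hi').ne' (hp hi).ne', Real.log_pow, Real.log_pow, hlγ, rootDiffLog,
      rootDiffLog, Real.log_abs, Real.log_abs]
    push_cast
    ring
  have hlin : N * Real.log (φ₀ α) + Real.log (φ₀ β) = 2 * linForm i₀ i i' k a := by
    rw [hlα, hlβ, linForm]
    simp only [ha, Fin.sum_univ_three]
    push_cast
    ring
  have hlog : |Real.log (φ₀ β)| ≤ (8 * k + 336 * R : ℕ) := by
    have h1 : |∑ j, (r j : ℝ) * (unitLog i j - unitLog i' j)| ≤ ∑ j : Fin 3, (R : ℝ) * 36 := by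
      refine (Finset.abs_sum_le_sum_abs _ _).trans (Finset.sum_le_sum fun j _ ↦ ?_)
      rw [abs_mul]
      refine mul_le_mul (by exact_mod_cast hr j) ?_ (abs_nonneg _) (Nat.cast_nonneg _)
      linarith [abs_sub (unitLog i j) (unitLog i' j), abs_unitLog_le i j, abs_unitLog_le i' j]
    have h2 : |rootDiffLog i' i₀ - rootDiffLog i i₀| ≤ 4 := by
      obtain ⟨b1, b2⟩ := rootDiffLog_mem hi
      obtain ⟨b3, b4⟩ := rootDiffLog_mem hi'
      rw [abs_le]
      constructor <;> linarith
    have h3 : |2 * (k : ℝ) * (rootDiffLog i' i₀ - rootDiffLog i i₀)| ≤ 2 * k * 4 := by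
      rw [abs_mul, abs_of_nonneg (by positivity : (0 : ℝ) ≤ 2 * k)]
      gcongr
    rw [hlβ]
    refine (abs_add_le _ _).trans ?_
    rw [abs_mul, abs_two]
    simp only [Finset.sum_const, Finset.card_univ, Fintype.card_fin, nsmul_eq_mul] at h1
    push_cast at h1 ⊢
    have : (0 : ℝ) ≤ R := Nat.cast_nonneg _
    linarith
  have key := two_pow_neg_lt_abs_linear_form_log_of_ne_zero φ₀ (h₁ := 336 * m)
    (h₂ := 8 * k + 336 * R) hfin hα (((hτI i).sub (hτI i₀)).pow _)
    (by rw [hdβ]; exact (((hτI i').sub (hτI i₀)).pow _).mul hγ) hd0 hα0 hβ0 hφα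
    (fun φ ↦ (hτb φ i i₀).trans (pow_le_pow_right₀ (by norm_num) (by omega)))
    (fun φ ↦ by
      rw [hdβ, map_mul, norm_mul, pow_add]
      exact mul_le_mul (hτb φ i' i₀) (hφγ φ) (norm_nonneg _) (by positivity))
    hlog (by omega) (by omega) hg hN hX (by rw [hlin]; exact mul_ne_zero two_ne_zero hΛ)
  rwa [hlin, abs_mul, abs_two] at key

theorem Nat.exists_pow_le_lt_succ_pow (n : ℕ) {e : ℕ} (he : e ≠ 0) :
    ∃ g, g ^ e ≤ n ∧ n < (g + 1) ^ e := by
  refine ⟨Nat.findGreatest (fun g ↦ g ^ e ≤ n) n,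
    Nat.findGreatest_spec (P := fun g ↦ g ^ e ≤ n) (Nat.zero_le n) (by simp [he]), ?_⟩
  by_contra! h
  have h1 : Nat.findGreatest (fun g ↦ g ^ e ≤ n) n + 1 ≤ n := (Nat.le_self_pow he _).trans h
  exact Nat.findGreatest_is_greatest (P := fun g ↦ g ^ e ≤ n) (Nat.lt_succ_self _) h1 h

theorem pow_le_two_pow_self {g : ℕ} (hg : 2 ^ 44 ≤ g) : g ^ 47 ≤ 2 ^ g := by
  have h0 : g ≠ 0 := by rintro rfl; norm_num at hg
  set s := Nat.log 2 g with hs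
  have hs1 : 44 ≤ s := Nat.le_log_of_pow_le (by norm_num) hg
  have h1 : 2 ^ s ≤ g := Nat.pow_log_le_self 2 h0
  have h2 : g < 2 ^ (s + 1) := Nat.lt_pow_succ_log_self (by norm_num) g
  have h3 : 49 * s ≤ 2 ^ s := mul_le_two_pow_of_le (m := 9) (by norm_num) (by norm_num) (by omega)
  calc g ^ 47 ≤ (2 ^ (s + 1)) ^ 47 := Nat.pow_le_pow_left h2.le 47
    _ = 2 ^ ((s + 1) * 47) := (pow_mul ..).symm
    _ ≤ 2 ^ g := Nat.pow_le_pow_right (by norm_num) (by omega)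

theorem exists_simultaneous_quotients {a : Fin 3 → ℤ} {B g : ℕ} (hg : 2 ≤ g) (hB : g ^ 42 ≤ B)
    (ha : ∀ j, |a j| ≤ B) : ∃ m N R : ℕ, ∃ q r : Fin 3 → ℤ, 1 ≤ m ∧ m ≤ g ^ 18 ∧ g ^ 24 ≤ N ∧
      N * m ≤ B ∧ R * g ^ 6 ≤ 2 * N ∧ (∀ j, a j = N * q j + r j) ∧ (∀ j, |q j| ≤ m) ∧
      ∀ j, |r j| ≤ R := by
  have hg6 : 1 < g ^ 6 := Nat.one_lt_pow (by norm_num) (by omega)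
  have hB0 : 0 < B := lt_of_lt_of_le (by positivity) hB
  obtain ⟨m, hm, hmg, q, hq⟩ := exists_nat_forall_abs_mul_sub_lt (fun j ↦ (a j : ℝ) / B)
    (fun _ ↦ g ^ 6) (fun _ ↦ by omega)
  have hmg' : m ≤ g ^ 18 := hmg.trans (by simp [← pow_mul])
  have hNm : B / m * m ≤ B := Nat.div_mul_le_self B m
  have hNm' : B < (B / m + 1) * m := by
    rw [mul_comm]; exact Nat.lt_mul_div_succ B hm
  have hgN : g ^ 24 ≤ B / m := by
    rw [Nat.le_div_iff_mul_le hm]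
    calc g ^ 24 * m ≤ g ^ 24 * g ^ 18 := by gcongr
      _ = g ^ 42 := by ring
      _ ≤ B := hB
  have hq1 : ∀ j, |m * a j - q j * B| * g ^ 6 < (B : ℤ) := fun j ↦ by
    have h1 := hq j
    have hBR : (0 : ℝ) < B := by exact_mod_cast hB0
    have hgR : (0 : ℝ) < (g : ℝ) ^ 6 := by exact_mod_cast (by omega : 0 < g ^ 6)
    rw [show (m : ℝ) * (a j / B) - q j = (m * a j - q j * B) / B by field_simp, abs_div,
      abs_of_pos hBR] at h1
    push_cast at h1
    rw [div_lt_div_iff₀ hBR hgR, one_mul] at h1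
    exact_mod_cast h1
  have hq2 : ∀ j, |q j| ≤ m := fun j ↦ by
    have h1 := hq1 j
    have h2 : |q j| * B ≤ |m * a j - q j * B| + m * |a j| := by
      have h3 := abs_sub (m * a j) (m * a j - q j * B)
      rw [sub_sub_cancel, abs_mul, abs_mul, Nat.abs_cast, Nat.abs_cast] at h3
      linarith
    have h4 : |m * a j - q j * B| < (B : ℤ) := by
      have : (1 : ℤ) < (g : ℤ) ^ 6 := by exact_mod_cast hg6
      nlinarith [abs_nonneg (m * a j - q j * B)]
    have h5 : (m : ℤ) * |a j| ≤ m * B := by gcongr; exact ha j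
    have h6 : |q j| * B < (m + 1) * B := by linarith
    have h7 := lt_of_mul_lt_mul_right h6 (by positivity)
    omega
  have hr : ∀ j, |a j - (B / m : ℕ) * q j| * g ^ 6 ≤ 2 * (B / m : ℕ) := fun j ↦ by
    set N := B / m
    have e1 : (m : ℤ) * (a j - N * q j) = (m * a j - q j * B) + (B - N * m) * q j := by ring
    have h1 : (m : ℤ) * |a j - N * q j| ≤ |m * a j - q j * B| + m * m := by
      rw [← Nat.abs_cast m, ← abs_mul, e1, Nat.abs_cast]
      refine (abs_add_le _ _).trans (add_le_add_right ?_ _)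
      rw [abs_mul]
      have h2 : (N : ℤ) * m ≤ B := by exact_mod_cast hNm
      have h3 : (B : ℤ) < (N + 1) * m := by exact_mod_cast hNm'
      refine mul_le_mul ?_ (hq2 j) (abs_nonneg _) (by positivity)
      rw [abs_le]
      constructor <;> linarith
    have h3 : (B : ℤ) < (N + 1) * m := by exact_mod_cast hNm'
    have h4 : (m : ℤ) * (|a j - N * q j| * g ^ 6) < m * (N + 1 + m * g ^ 6) := by
      have h5 := mul_le_mul_of_nonneg_right h1 (show (0 : ℤ) ≤ (g : ℤ) ^ 6 by positivity)
      linarith [hq1 j]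
    have h6 := lt_of_mul_lt_mul_left h4 (by positivity)
    have h7 : (m : ℤ) * g ^ 6 ≤ N := by
      have : m * g ^ 6 ≤ N := by
        calc m * g ^ 6 ≤ g ^ 18 * g ^ 6 := by gcongr
          _ = g ^ 24 := by ring
          _ ≤ N := hgN
      exact_mod_cast this
    linarith
  refine ⟨m, B / m, 2 * (B / m) / g ^ 6, q, fun j ↦ a j - (B / m : ℕ) * q j, hm, hmg', hgN, hNm,
    Nat.div_mul_le_self _ _, fun j ↦ by ring, hq2, fun j ↦ ?_⟩
  have h1 := hr j
  rw [Int.abs_eq_natAbs] at h1 ⊢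
  have h2 : (a j - (B / m : ℕ) * q j).natAbs * g ^ 6 ≤ 2 * (B / m) := by exact_mod_cast h1
  exact_mod_cast (Nat.le_div_iff_mul_le (by omega)).mpr h2

theorem log_bound_lt {E B : ℕ} {y : ℝ} (hy : 2 ≤ y) (hEB : E * 2 ^ 14 ≤ B) (hB : 10 ^ 6 ≤ B)
    (h1 : y ^ 4 < 2 ^ (E + 14)) : 2527 * (3 * Real.log y + 8) + 1 < B := by
  have h2 := Real.log_lt_log (by positivity) h1
  rw [Real.log_pow, Real.log_pow] at h2
  push_cast at h2
  have h3 := Real.log_two_lt_d9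
  have h4 : ((E : ℝ) + 14) * Real.log 2 ≤ (E + 14) * 0.7 := by
    gcongr
    linarith
  have h5 : (E : ℝ) * 2 ^ 14 ≤ B := by exact_mod_cast hEB
  have h6 : (10 : ℝ) ^ 6 ≤ B := by
    exact_mod_cast hB
  linarith

theorem mul_two_pow_le {E g B : ℕ} (h : E * g ≤ 2 ^ 30 * B) (hg : 2 ^ 44 ≤ g) :
    E * 2 ^ 14 ≤ B := by
  have h2 := (Nat.mul_le_mul_left E hg).trans h
  refine Nat.le_of_mul_le_mul_right (c := 2 ^ 30) ?_ (by norm_num)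
  linarith

theorem exponents_lt {i₀ i i' : Fin 4} (hi : i ≠ i₀) (hi' : i' ≠ i₀) {k : ℕ}
    (hk : 1 ≤ k) (hk' : k ≤ 2527) {y : ℝ} (hy : 2 ≤ y) {a : Fin 3 → ℤ}
    (ha : ∀ j, |(a j : ℝ)| ≤ 2527 * (3 * Real.log y + 8) + 1) (hΛ : linForm i₀ i i' k a ≠ 0)
    (hΛ' : |linForm i₀ i i' k a| ≤ k * (2.2 / y ^ 4)) (j : Fin 3) : |a j| < 2 ^ 1848 := by
  obtain ⟨p, -, hp⟩ := Finset.exists_max_image Finset.univ (fun j ↦ |a j|) ⟨j, Finset.mem_univ j⟩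
  refine lt_of_le_of_lt (hp j (Finset.mem_univ j)) ?_
  by_contra! hbig
  set B := (a p).natAbs with hBdef
  have hB' : (B : ℤ) = |a p| := Int.natCast_natAbs _
  have hB : 2 ^ 1848 ≤ B := by rw [← hB'] at hbig; exact_mod_cast hbig
  have hBR : (B : ℝ) ≤ 2527 * (3 * Real.log y + 8) + 1 := by
    have : (B : ℝ) = |(a p : ℝ)| := by exact_mod_cast congrArg (Int.cast (R := ℝ)) hB'
    rw [this]
    exact ha p
  obtain ⟨g, hgB, hBg⟩ := Nat.exists_pow_le_lt_succ_pow B (e := 42) (by norm_num)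
  have hg : 2 ^ 44 ≤ g := by
    by_contra! h
    have h1 : (g + 1) ^ 42 ≤ (2 ^ 44) ^ 42 := Nat.pow_le_pow_left h 42
    rw [← pow_mul, show 44 * 42 = 1848 from rfl] at h1
    exact absurd (hBg.trans_le h1) (not_lt.mpr hB)
  clear hB hbig
  have hg0 : 0 < g := by omega
  obtain ⟨m, N, R, q, r, hm, hmg, hgN, hNm, hR, haq, hq, hr⟩ :=
    exists_simultaneous_quotients (a := a) (by omega) hgB
      (fun j ↦ by rw [hB']; exact hp j (Finset.mem_univ j))
  have hpow : ∀ e : ℕ, e ≠ 0 → 2 ^ 44 ≤ g ^ e := fun e he ↦ hg.trans (Nat.le_self_pow he g)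
  have hN : g ^ 3 * (8 * k + 336 * R) ≤ N := by
    have h1 : g ^ 3 * (g ^ 3 * (8 * k + 336 * R)) ≤ g ^ 3 * N := by
      calc g ^ 3 * (g ^ 3 * (8 * k + 336 * R)) = g ^ 6 * (8 * k) + 336 * (R * g ^ 6) := by ring
        _ ≤ g ^ 6 * (8 * 2527) + 336 * (2 * N) := by gcongr
        _ ≤ g ^ 6 * g ^ 18 + 336 * (2 * N) := by
          gcongr
          exact le_trans (by norm_num) (hpow 18 (by norm_num))
        _ = g ^ 24 + 672 * N := by ring
        _ ≤ 673 * N := by omega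
        _ ≤ g ^ 3 * N := by
          gcongr
          exact le_trans (by norm_num) (hpow 3 (by norm_num))
    exact le_of_mul_le_mul_left h1 (pow_pos hg0 3)
  have hX : 2 * N * (g ^ 3 * (336 * m)) ≤ 2 ^ g := by
    calc 2 * N * (g ^ 3 * (336 * m)) = 672 * g ^ 3 * (N * m) := by ring
      _ ≤ 672 * g ^ 3 * (2 * g) ^ 42 := by
        gcongr
        exact hNm.trans (hBg.le.trans (by gcongr; omega))
      _ = 672 * 2 ^ 42 * g ^ 45 := by ring
      _ ≤ (2 ^ 44) ^ 2 * g ^ 45 := by gcongr; norm_num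
      _ ≤ g ^ 2 * g ^ 45 := by gcongr
      _ = g ^ 47 := by ring
      _ ≤ 2 ^ g := pow_le_two_pow_self hg
  have key := two_pow_neg_lt_abs_linForm hi hi' hk haq hq hr hm (le_trans (by norm_num) hg) hN hX hΛ
  set E := 18 * 256 * (g ^ 5 * (336 * m) * (8 * k + 336 * R)) with hE
  have hEB : E * 2 ^ 14 ≤ B := by
    have h1 : E * g ≤ 2 ^ 30 * B := by
      calc E * g = 1548288 * (8 * k * m * g ^ 6 + 336 * (m * (R * g ^ 6))) := by rw [hE]; ring
        _ ≤ 1548288 * (8 * 2527 * g ^ 18 * g ^ 6 + 336 * (m * (2 * N))) := by gcongr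
        _ = 1548288 * (20216 * g ^ 24 + 672 * (N * m)) := by ring
        _ ≤ 1548288 * (g ^ 18 * g ^ 24 + 672 * B) := by
          gcongr
          exact le_trans (by norm_num) (hpow 18 (by norm_num))
        _ = 1548288 * (g ^ 42 + 672 * B) := by ring
        _ ≤ 2 ^ 30 * B := by omega
    exact mul_two_pow_le h1 hg
  clear_value E
  have hy0 : (0 : ℝ) < y := by linarith
  have h1 : y ^ 4 < 2 ^ (E + 14) := by
    have hkR : (k : ℝ) ≤ 2527 := by exact_mod_cast hk'
    have h2 : (1 / 2 : ℝ) ^ E < 2 ^ 14 / y ^ 4 := by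
      refine key.trans_le ((mul_le_mul_of_nonneg_left hΛ' (by norm_num)).trans ?_)
      rw [show 2 * ((k : ℝ) * (2.2 / y ^ 4)) = (4.4 * k) / y ^ 4 by ring]
      gcongr
      norm_num
      linarith
    rw [lt_div_iff₀ (by positivity), one_div, inv_pow, inv_mul_lt_iff₀ (by positivity),
      ← pow_add] at h2
    exact h2
  exact lt_irrefl _ (hBR.trans_lt (log_bound_lt hy hEB
    (le_trans (by norm_num) ((hpow 42 (by norm_num)).trans hgB)) h1))

def certNum : Fin 4 → Fin 3 → ℤ := ![
  ![(-32503779775758615991239103141372838714689213586181881118589788756459338750605808117006905105972894187831580311748425643346709730472869395084798356722569162103686429703727195291057628921653410332361757686908519814429871791119747771140005550130656213507708220572025778371999985073804),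
    31541163765688003756695845230626746333957211339256753428692580600189369314075691390664202787959742485305170341190759303643996599677535698870093180196133707000035308276115035958921519211647000008403189904650574687117198168816483102808721613756391747389475428912896508253782118352669,
    418962779087123530111418909447617021129085281584039821301948204772409327822780444921822733050451033527113741754338020920032776860614666043703984815531718170626574751367566454680499890514223980620010213739096466296121780423581667783859260770701129099824499966701790390833312137743794],
  ![13489922700562973242229669680181648485678445544715625178951741363217706174531535353414888077304601843650182083450606080967202256368966072664646554550108914519896918897255496917850035059011840888932442697817362951441872702788533310374838742525281996956007574702159810321744567444691,
    162788157632358763588879044326642809675288537787971839220137754978529164829019315167055105860288301541821001749918133281267885184740383586582049677248212809850878872037656378196855713784267697659723205618957067575554037047726814451173051807302059151684708989362237284521538554071983,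
    136083242897915092191125643893801516991292852349454223711760833715144517787974751301159623285458063466162893547777791177267698054888412867778456857636111306643321214753164664822978450118262181126405400733964117983096648926247943939583737616571178936385455626099557687553390379125401],
  ![52273514895728910935988652133834405543033785324930261912029870460784862467004315152174673713222828942864589882390061465234723281743086079996261852935562381984874938190543069315786908585439943689875222757230173700611750938256039897384405857799059752286923609176162160616674385230226,
    222084227104527878914183870710956809038030198009067755431475809632893768565535217484231823789964536403512258786447781949077907542899264179070867585834556051542346467073559616587311609840128866086540580491886351064448173476270478417233453194636083961756667939575127842665620051095464,
    23637582058296246460965079680386261977748165321944669642507943798548870559948133257146009507021660353977713830233894932847394130388162940954926919770057887065586360362826939866876417132026876053096867875494897442288446363134251948758432215266150863539389094786113328348118050447210],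
  ![243410971815516841366250770569967710703072200581319598882499844630987110470835388551611930449370224252775641348665089846761545738744338812224435384365210497990708477928998342833544356434268841093471065927439913629841965235741328538935331792170545944188920090276156779789617999021259,
    (-420835041924313654610097688842701565415239905750445208057503879225019023130146049148325005813252444827407899725390322695533529828453514548263695385957271813465812148382331591057210026324483195548476835110265752793142767854487866252694539609306662078293611300561116674078720592892837),
    247091166680112641214419980731902092167160533746128205056320809526592544682703944722688205181140958230096052358320246518155302476667077527459287212084273726014604730331755982763066713399795703856294254144631010597366245925597437365337306917005548832886040629849859130352673967461175]]

def certMul : Fin 4 → Fin 2 → ℤ := ![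
  ![1817306910668998953231149105871000425852831409147164460955588023621225675228864299229647107744710839796866040810808504715695604374704053695107030535006540688596186410518526586047787769524793578420310954409710529419449444387974921989947026950302586641995472483240991107175250591753106733711394352473860155537990257988390462392236396510461777122229761131758107419470619238934564062642966056873253801362405792101116734686706495804466852748100937040371581003408443053726732920657001060919790010038693288425403060238764811873782585448219583138925151212099638538382866595863125543981255146860174830347636188140030824593709341020151854003987314534467888487376919490776230926665267438082350641286809677251601735843488450736889140937568227447542911474513390287041990741181278744281207683946965214795371388256199143653583145525118537020026029212330676185567095879477118,
    (-1280294172316218677716706668678051774001892881878675209233172857338287558800087698751909916078044692091707172877228633621295922715681362934576341033382549749739441107541720319495603977282988087036803701442779458086846966985913368591234761690827336125688033756839145222086869469006918602687780540425022195925823854352280160579127263204718644026664833927212182138012781985017575222363034850725335353434738231919423784535169824821080089276448926157263698271851008997072295095732612003565603351400313574147790865909560927033564244654715905036197495749959770605886836524933042798790058062954030673611690626832223431237923672084398519440809545116733156038818231630001952747072396159139017833637204496200128324033245598838094833654158922003023180472917573322979056132247658006496282033335322333859445866656114464522400159119078573163496245682372112714545295637948430)],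
  ![577634763897900954939264408957270872225332303637502609801043809723303020522127675522254773961178087735547363366596912355274422534080644903929527094700260090500014933589508101772509970880804865586189657581015872214781671588239965918066872868037896677926100198663496406591226909058133646248578137212557453686005063991653803220074570816766005366993125351757514366873281138765077010129146413896620268354083633532587391956463807655365213964559357576674440575348050736412855827231653951585060750470017517412002961408146671425535421574194386723981590157888651410514504441630294132415703414847493491768538422588852807766498083879027441144975094710171227432351837296777456401219630429259553147850349518872031726215580224098582744361441299496696900013187050015561571674112665342401362779634882078841981052077864164987955451847340924652321449160041730009346301733217106,
    (-1038484705061224613038012792127015325159988915389567790823435570260470008380874884930212122062031425548356713158235445353848875577929080416945687349198531952624695137731648292892181639688543348374705725524632825254888752760537211928766466708413328716660005024831237647236147819119988923721549725129841205204480638389999771504777728864329830284778187305913895632328487149681946914006884137114658160688311517412493623148075119576760872813365875283920300212424384460362456183096775834900203944744656671396092064887800952313872795532463557525387953295927968553228056981285012487905177273517375656926279721234568683753372321128973046702369446619153013423881513458343034236961023701075196443065883111927736970355841931528799805440001482403084714490006671338473444226829973855316683273074581569742784080684047528792799939395240198259681801507369629185951520901728994)],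
  ![428583863571356988804879672854019123658093622002129429857490226757655166392651999244087615025687404831605767148974762990093333960100813919437888365886525225213471979264925723113521078949350578472265565963864619701588347181062726980853924816563719696427242869672253777471596265731214070209676332711419114555030866443382391339784823201319447193863366500393060422795080645716356944727068975499117432896037558914848192285259612880095710600726691692575670170839025465257730402802280967881862378084877797230502326552811546185675252522558854463108123459668752720289043028088808573874025487284114794966049109062990303810331114050753159223929535139590970802800506120507098558024250991906722138598950112669575181692923691021079857237988989818911507238406266699359283680944789366682734393898343206813768563783266492392810306324486403080817506221297249675106903191500398,
    (-1032090023691949790809699030167318067959588832393666916755284994308510068657400230650291643220927214908913358788415949272865123667039647711591136191225062746189290547057762122162812597834148301659920017938228937698114434188671956907081224497196880164722365067255026875195521040487050187823174674036069410355845226086727619254312222469578658460293044091470095089188272556750650446083833828503512726478660847577624601469420689971627343910988357194679407216687559402297127236991029536716044630965006081201513696726024608539551170749212439828898857292546901000128783413820917134772477681712319125875146020532481410678400902635146548498271133166436489304774354977725942334680390430817721756531435726973908787736535855336260505593605863050824864156958339107052220075170628289357292352811377623352334355408270311570720686803306644037909630974367735013348584954213059)],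
  ![2725331312805750275643082301362821711733603558974643933823002649856588505506608843888504533434518775280938897995701146765944135332419224922095433334452968809548974458814856053772492257569330030304142734260707779286724045951885273475014500348355015934936686361588544912150357617729298312107070958911699853456845215766012797159084285920674919104053904658112104187871480610534935473119202173950477169136546749480643634785461812235075694019355870226925711598304059145952706596476263196788015785899707931549337378904543335296252134323898142112197433780510402973292650247159468689151742451018671714374062918296628832377847721521960504994977474641756016776936898435355383481784375544122325021821337329159640592293570113335940886708379884518660306693279721496421033848564035019375922137324113351565023335025265066558617485061197604553437983207870056801595364092650218,
    (-334956104162264093066019435376042118061553867220175840549580680826462571204820657672797504142021495316554786163991480887629807563907902723296660509374773164722530287418875950607260038773986719822959865963620127988735978225733085095932495058658024704036904294253779387719424257888987416691030848595319149124000852487585057714196847494682842124027625505685368048547659211593345558551260709646108457217890459171861827056036046288594730060506689651077689970560696117208154969347365329732970638412385177253071858534633178602942834748584920518558127274839787835163847265417086225129248631020603995352714627533728754374909251649654402452292485586053408944787736454517336301077536087877744588556482482932684046796174777544669110263774137755164964528465912541316401857474316598993038486644941277093412653333931423627599499186072626303460549451163545713472043916816452)]]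

def certForm (i₀ : Fin 4) (j : Fin 3) : ℤ :=
  certMul i₀ 0 * (unitLogNum (i₀.succAbove 0) j - unitLogNum (i₀.succAbove 1) j) +
    certMul i₀ 1 * (unitLogNum (i₀.succAbove 0) j - unitLogNum (i₀.succAbove 2) j)

def certConst (i₀ : Fin 4) : ℤ :=
  certMul i₀ 0 * (rootDiffLogNum (i₀.succAbove 1) i₀ - rootDiffLogNum (i₀.succAbove 0) i₀) +
    certMul i₀ 1 * (rootDiffLogNum (i₀.succAbove 2) i₀ - rootDiffLogNum (i₀.succAbove 0) i₀)

def certErr (i₀ : Fin 4) : ℤ :=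
  2 ^ 1848 * (|certForm i₀ 0 - 2 ^ 4820 * certNum i₀ 0| + |certForm i₀ 1 - 2 ^ 4820 * certNum i₀ 1| +
    |certForm i₀ 2 - 2 ^ 4820 * certNum i₀ 2|) + (|certMul i₀ 0| + |certMul i₀ 1|) * 2 ^ 1914

theorem cert_check (i₀ : Fin 4) : ∀ p < 50, ∀ q < 51,
    certErr i₀ < ((51 * p + q + 1 : ℕ) : ℤ) * certConst i₀ % 2 ^ 4820 ∧
      ((51 * p + q + 1 : ℕ) : ℤ) * certConst i₀ % 2 ^ 4820 < 2 ^ 4820 - certErr i₀ := by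
  decide +kernel +revert

theorem Int.lt_abs_add_mul_of_emod {z W T t : ℤ} (hW : 0 ≤ W) (h1 : T < z % W)
    (h2 : z % W < W - T) : T < |z + W * t| := by
  have h3 := Int.mul_ediv_add_emod z W
  rw [← h3]
  by_cases hs : 0 ≤ z / W + t
  · refine lt_of_lt_of_le ?_ (le_abs_self _)
    nlinarith [mul_nonneg hW hs]
  · refine lt_of_lt_of_le ?_ (neg_le_abs _)
    have : z / W + t ≤ -1 := by omega
    nlinarith [mul_le_mul_of_nonneg_left this hW]

theorem abs_mul_add_mul_sum_le {a f F n : Fin 3 → ℝ} {k G C W A η κ ν : ℝ}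
    (ha : ∀ j, |a j| ≤ A) (hF : ∀ j, |F j - f j| ≤ η) (hG : |G - C| ≤ η) (hk : 0 ≤ k) (hκ : k ≤ κ)
    (h : |∑ j, a j * F j + k * G| ≤ ν) :
    |k * C + W * ∑ j, a j * n j| ≤
      A * (|f 0 - W * n 0| + |f 1 - W * n 1| + |f 2 - W * n 2|) + (3 * A + κ) * η + ν := by
  have hA : 0 ≤ A := (abs_nonneg _).trans (ha 0)
  have hη : 0 ≤ η := (abs_nonneg _).trans hG
  have h1 : ∀ j, |a j * (F j - W * n j)| ≤ A * (η + |f j - W * n j|) := fun j ↦ by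
    rw [abs_mul]
    refine mul_le_mul (ha j) ?_ (abs_nonneg _) hA
    refine le_trans ?_ (add_le_add_left (hF j) _)
    rw [show F j - W * n j = (F j - f j) + (f j - W * n j) by ring]
    exact abs_add_le _ _
  have h2 : |k * (G - C)| ≤ κ * η := by
    rw [abs_mul, abs_of_nonneg hk]
    exact mul_le_mul hκ hG (abs_nonneg _) (hk.trans hκ)
  have e : k * C + W * ∑ j, a j * n j = (∑ j, a j * F j + k * G) - k * (G - C) -
      a 0 * (F 0 - W * n 0) - a 1 * (F 1 - W * n 1) - a 2 * (F 2 - W * n 2) := by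
    simp only [Fin.sum_univ_three]
    ring
  rw [e, abs_le]
  obtain ⟨b1, b2⟩ := abs_le.mp h
  obtain ⟨b3, b4⟩ := abs_le.mp h2
  obtain ⟨c1, c2⟩ := abs_le.mp (h1 0)
  obtain ⟨c3, c4⟩ := abs_le.mp (h1 1)
  obtain ⟨c5, c6⟩ := abs_le.mp (h1 2)
  constructor <;> linarith

theorem abs_combination_sub_le {p x₁ x₂ u v w u' v' w' ε : ℝ} (hu : |p * u - u'| ≤ ε)
    (hv : |p * v - v'| ≤ ε) (hw : |p * w - w'| ≤ ε) :
    |p * (x₁ * (u - v) + x₂ * (u - w)) - (x₁ * (u' - v') + x₂ * (u' - w'))| ≤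
      (|x₁| + |x₂|) * (2 * ε) := by
  have h1 : |x₁ * ((p * u - u') - (p * v - v'))| ≤ |x₁| * (2 * ε) := by
    rw [abs_mul]
    gcongr
    exact (abs_sub _ _).trans (by linarith)
  have h2 : |x₂ * ((p * u - u') - (p * w - w'))| ≤ |x₂| * (2 * ε) := by
    rw [abs_mul]
    gcongr
    exact (abs_sub _ _).trans (by linarith)
  rw [show p * (x₁ * (u - v) + x₂ * (u - w)) - (x₁ * (u' - v') + x₂ * (u' - w')) =
    x₁ * ((p * u - u') - (p * v - v')) + x₂ * ((p * u - u') - (p * w - w')) by ring, add_mul]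
  exact (abs_add_le _ _).trans (add_le_add h1 h2)

theorem lt_two_pow_of_small_linForm {i₀ : Fin 4} {k : ℕ} (hk : 1 ≤ k) (hk' : k ≤ 2527) {y : ℝ}
    {a : Fin 3 → ℤ} (hy : 0 < y) (ha : ∀ j, |a j| < 2 ^ 1848)
    (hΛ : ∀ i i', i ≠ i₀ → i' ≠ i₀ → i ≠ i' → |linForm i₀ i i' k a| ≤ k * (2.2 / y ^ 4)) :
    y < 2 ^ 250 := by
  by_contra! hy250
  set i := i₀.succAbove 0 with hi
  set i₁ := i₀.succAbove 1 with hi₁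
  set i₂ := i₀.succAbove 2 with hi₂
  have ne0 : i ≠ i₀ := Fin.succAbove_ne _ _
  have ne1 : i₁ ≠ i₀ := Fin.succAbove_ne _ _
  have ne2 : i₂ ≠ i₀ := Fin.succAbove_ne _ _
  have ne01 : i ≠ i₁ := fun h ↦ absurd (Fin.succAbove_right_injective h) (by decide)
  have ne02 : i ≠ i₂ := fun h ↦ absurd (Fin.succAbove_right_injective h) (by decide)
  have hΛ1 := hΛ i i₁ ne0 ne1 ne01
  have hΛ2 := hΛ i i₂ ne0 ne2 ne02
  set x₁ : ℝ := ((certMul i₀ 0 : ℤ) : ℝ) with hx₁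
  set x₂ : ℝ := ((certMul i₀ 1 : ℤ) : ℝ) with hx₂
  have hkR : (k : ℝ) ≤ 2527 := by exact_mod_cast hk'
  have hsmall : (2 : ℝ) ^ 2900 * (k * (2.2 / y ^ 4)) ≤ 2 ^ 1913 := by
    have h1 : (2 : ℝ) ^ 1000 ≤ y ^ 4 := by
      rw [show 1000 = 250 * 4 from rfl, pow_mul]
      exact pow_le_pow_left₀ (by positivity) hy250 4
    have h2 : (2 : ℝ) ^ 2900 * 5560 ≤ 2 ^ 1913 * 2 ^ 1000 := by
      have : 2 ^ 2900 * 5560 ≤ 2 ^ 1913 * 2 ^ 1000 := by clear * -; decide +kernel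
      exact_mod_cast this
    rw [show (2 : ℝ) ^ 2900 * (k * (2.2 / y ^ 4)) = 2 ^ 2900 * (2.2 * k) / y ^ 4 by ring,
      div_le_iff₀ (by positivity)]
    refine le_trans ?_ (h2.trans (mul_le_mul_of_nonneg_left h1 (by positivity)))
    exact mul_le_mul_of_nonneg_left (by linarith) (by positivity)
  have h1 : |∑ j, (a j : ℝ) * (2 ^ 2900 * (x₁ * (unitLog i j - unitLog i₁ j) +
      x₂ * (unitLog i j - unitLog i₂ j))) + k * (2 ^ 2900 * (x₁ * (rootDiffLog i₁ i₀ -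
      rootDiffLog i i₀) + x₂ * (rootDiffLog i₂ i₀ - rootDiffLog i i₀)))| ≤
      (|x₁| + |x₂|) * 2 ^ 1913 := by
    have e : ∑ j, (a j : ℝ) * (2 ^ 2900 * (x₁ * (unitLog i j - unitLog i₁ j) +
        x₂ * (unitLog i j - unitLog i₂ j))) + k * (2 ^ 2900 * (x₁ * (rootDiffLog i₁ i₀ -
        rootDiffLog i i₀) + x₂ * (rootDiffLog i₂ i₀ - rootDiffLog i i₀))) =
        2 ^ 2900 * (x₁ * linForm i₀ i i₁ k a + x₂ * linForm i₀ i i₂ k a) := by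
      simp only [linForm, Fin.sum_univ_three]
      ring
    rw [e, abs_mul, abs_of_pos (by positivity : (0 : ℝ) < 2 ^ 2900)]
    have h3 : |x₁ * linForm i₀ i i₁ k a + x₂ * linForm i₀ i i₂ k a| ≤
        (|x₁| + |x₂|) * (k * (2.2 / y ^ 4)) := by
      refine (abs_add_le _ _).trans ?_
      rw [abs_mul, abs_mul, add_mul]
      gcongr
    refine (mul_le_mul_of_nonneg_left h3 (by positivity)).trans ?_
    rw [mul_left_comm]
    exact mul_le_mul_of_nonneg_left hsmall (by positivity)
  have h2 := abs_mul_add_mul_sum_le (A := 2 ^ 1848) (η := (|x₁| + |x₂|) * (2 * 2 ^ 20)) (κ := 2527)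
    (f := fun j ↦ (certForm i₀ j : ℝ)) (n := fun j ↦ (certNum i₀ j : ℝ)) (W := 2 ^ 4820)
    (C := certConst i₀)
    (fun j ↦ by exact_mod_cast (ha j).le)
    (fun j ↦ by
      have := abs_combination_sub_le (x₁ := x₁) (x₂ := x₂) (abs_unitLog_sub_le i j)
        (abs_unitLog_sub_le i₁ j) (abs_unitLog_sub_le i₂ j)
      rw [certForm]
      push_cast
      exact this)
    (by
      have := abs_combination_sub_le (x₁ := -x₁) (x₂ := -x₂) (abs_rootDiffLog_sub_le ne0)
        (abs_rootDiffLog_sub_le ne1) (abs_rootDiffLog_sub_le ne2)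
      rw [abs_neg, abs_neg] at this
      rw [certConst]
      push_cast
      refine le_trans (le_of_eq ?_) this
      congr 1
      ring)
    (Nat.cast_nonneg k) hkR h1
  have h4 : ((3 : ℝ) * 2 ^ 1848 + 2527) * (2 * 2 ^ 20) + 2 ^ 1913 ≤ 2 ^ 1914 := by
    have : (3 * 2 ^ 1848 + 2527) * (2 * 2 ^ 20) + 2 ^ 1913 ≤ 2 ^ 1914 := by
      clear * -
      decide +kernel
    exact_mod_cast this
  have h5 : |(k : ℝ) * certConst i₀ + 2 ^ 4820 * ∑ j, (a j : ℝ) * certNum i₀ j| ≤ (certErr i₀ : ℝ) := by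
    refine h2.trans ?_
    rw [certErr]
    push_cast
    have h6 := mul_le_mul_of_nonneg_left h4 (add_nonneg (abs_nonneg x₁) (abs_nonneg x₂))
    linarith
  have h6 : |(k : ℤ) * certConst i₀ + 2 ^ 4820 * ∑ j, a j * certNum i₀ j| ≤ certErr i₀ := by
    exact_mod_cast h5
  obtain ⟨h7, h8⟩ := cert_check i₀ ((k - 1) / 51) (by omega) ((k - 1) % 51) (by omega)
  rw [show 51 * ((k - 1) / 51) + (k - 1) % 51 + 1 = k by omega] at h7 h8
  exact absurd h6 (not_le.mpr (Int.lt_abs_add_mul_of_emod (pow_nonneg (by norm_num) _) h7 h8))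

theorem lt_two_pow_of_abs_prod_eq_one {x y : ℤ} (hy : 2 ≤ y)
    (h : |∏ i, ((x : ℝ) - root i * y)| = 1) : (y : ℝ) < 2 ^ 250 := by
  have hyR : (2 : ℝ) ≤ y := by exact_mod_cast hy
  obtain ⟨i₀, -, k, hk, hk', a, ha, hΛ⟩ := exists_small_linForm hy h
  have h1 := hΛ (i₀.succAbove 0) (i₀.succAbove 1) (Fin.succAbove_ne _ _) (Fin.succAbove_ne _ _)
    fun h ↦ absurd (Fin.succAbove_right_injective h) (by decide)
  exact lt_two_pow_of_small_linForm hk hk' (by linarith)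
    (exponents_lt (Fin.succAbove_ne i₀ 0) (Fin.succAbove_ne i₀ 1) hk hk' hyR ha h1.1 h1.2)
    fun i i' hi hi' hii ↦ (hΛ i i' hi hi' hii).2

def convNum : Fin 4 → Fin 4 → ℤ :=
  ![![(-2012827621219732959537654166883593991679641151085247726957172208494158191999),
      (-27590880334129162460366940),
      (-843005819),
      (-353)],
    ![(-481511092127475036312449288687508738986910050881831947244597395245961530661),
      (-6203037530141343372507901),
      (-25585807),
      (-1)],
    ![2893932659775328071974840086489361946671670124910846586682882980803493914474,
      6993603020239034890384543,
      200949545,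
      1106],
    ![3368712614103370473198218919574190448262656371792270201537589377668508511375,
      17918641943032708207378004,
      3188653026,
      1871]]

def convDen : Fin 4 → Fin 4 → ℤ :=
  ![![587310990397182072356901458342927507726263732469058426318377631111881423654,
      8050578740144660767831711,
      245975650,
      103],
    ![964206756396171665992641404814218947777115888056762052778715145060831337892,
      12421335239267747681592673,
      51234558,
      2],
    ![1049246316199977244694774904396087806171491869365814874227911602629051343297,
      2535654097258964054624537,
      72857801,
      401],
    ![331289960109746573523233574781041407913403786335219736478798340855663755294,
      1762176491302793191721851,
      313582325,
      184]]

def nextConvNum : Fin 4 → Fin 4 → ℤ :=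
  ![![(-202868358580483930848384253494603035659325302937796640678789007272611371045821),
      (-109310007468031155538381049),
      (-2988813255),
      (-4260)],
    ![(-2762065652703494098132275530034254970519338096100227019733799998991010237248),
      (-19945181741494454879523413),
      (-747262549),
      (-406)],
    ![25464688041503753635658072458265959296832803375151163806969440235106269260769,
      218804788911314173979527803,
      2631846416,
      4253],
    ![25398301188666589781392107593621426187351452681740663417301237463944760845821,
      2592508210414047186631635577,
      7108458841,
      8450]]

def nextConvDen : Fin 4 → Fin 4 → ℤ :=
  ![![59193750792208484471402911089968624272242120148915264323518426862456095230065,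
      31894916419851922444605286,
      872088029,
      1243],
    ![5530926301572001573545248755530231763658888613007704344007739001335020001197,
      39939430902263066467143748,
      1496363449,
      813],
    ![9232671683108116586861057795574429319053704778884646433785701668573513515408,
      79331534531951961658844284,
      954222327,
      1542],
    ![2497750075925737577180484869279906436457823554104658604542185739207235945321,
      254955539399985544171686757,
      699068551,
      831]]

def heightBound : Fin 5 → ℤ := ![2 ^ 250, 3 * 10 ^ 25, 5 * 10 ^ 8, 800, 10]

theorem convergent_cert (i j : Fin 4) :
    0 < convDen i j ∧ heightBound j.castSucc ≤ nextConvDen i j ∧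
    |convNum i j * nextConvDen i j - nextConvNum i j * convDen i j| = 1 ∧
    (33 * 2 ^ 2960 <
        100 * (convNum i j * 2 ^ 2960 - convDen i j * (rootNum i + 1)) * heightBound j.succ ^ 3 ∧
      nextConvNum i j * 2 ^ 2960 ≤ nextConvDen i j * rootNum i ∨
    33 * 2 ^ 2960 <
        100 * (convDen i j * rootNum i - convNum i j * 2 ^ 2960) * heightBound j.succ ^ 3 ∧
      nextConvDen i j * (rootNum i + 1) ≤ nextConvNum i j * 2 ^ 2960) := by
  decide +kernel +revert

theorem abs_sub_mul_ge_of_convergents {θ : ℝ} {p q p' q' x y : ℤ} (hq : 0 < q) (hy : 0 < y)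
    (hyq : y < q') (hdet : |p * q' - p' * q| = 1) (hs : (p - θ * q) * (p' - θ * q') ≤ 0) :
    |p - θ * q| ≤ |x - θ * y| := by
  obtain ⟨u, v, hx, hy'⟩ : ∃ u v : ℤ, x = u * p + v * p' ∧ y = u * q + v * q' := by
    rcases abs_eq (zero_le_one (α := ℤ)) |>.mp hdet with h | h
    · refine ⟨x * q' - y * p', y * p - x * q, ?_, ?_⟩
      · linear_combination (-x) * h
      · linear_combination (-y) * h
    · refine ⟨-(x * q' - y * p'), -(y * p - x * q), ?_, ?_⟩
      · linear_combination x * h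
      · linear_combination y * h
  have hη : (x : ℝ) - θ * y = u * (p - θ * q) + v * (p' - θ * q') := by
    rw [hx, hy']; push_cast; ring
  have hu : u ≠ 0 := by
    rintro rfl
    have : 0 < v := by by_contra! hv; nlinarith
    nlinarith
  have huv : u * v ≤ 0 := by
    by_contra! h
    rcases pos_and_pos_or_neg_and_neg_of_mul_pos h with ⟨h1, h2⟩ | ⟨h1, h2⟩ <;> nlinarith
  have hu1 : (1 : ℝ) ≤ |(u : ℝ)| := by exact_mod_cast Int.one_le_abs hu
  have huvR : (u : ℝ) * v ≤ 0 := by exact_mod_cast huv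
  have hprod : 0 ≤ (u * (p - θ * q)) * (v * (p' - θ * q')) := by
    have := mul_nonneg_of_nonpos_of_nonpos huvR hs
    linarith
  calc |p - θ * q| ≤ |(u : ℝ)| * |p - θ * q| := le_mul_of_one_le_left (abs_nonneg _) hu1
    _ = |u * (p - θ * q)| := (abs_mul _ _).symm
    _ ≤ |u * (p - θ * q)| + |v * (p' - θ * q')| := le_add_of_nonneg_right (abs_nonneg _)
    _ = |x - θ * y| := by rw [hη, (abs_add_eq_add_abs_iff _ _).mpr]; exact mul_nonneg_iff.mp hprod

theorem lt_of_convergents {θ S r p q p' q' x y Y' : ℝ} (hS : 0 < S) (hr : r ≤ S * θ)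
    (hr' : S * θ ≤ r + 1) (hq : 0 < q) (hq' : 0 < q') (hy : 0 < y)
    (hη : |x - θ * y| ≤ 0.33 / y ^ 3)
    (hbest : (p - θ * q) * (p' - θ * q') ≤ 0 → |p - θ * q| ≤ |x - θ * y|)
    (h : 33 * S < 100 * (p * S - q * (r + 1)) * Y' ^ 3 ∧ p' * S ≤ q' * r ∨
      33 * S < 100 * (q * r - p * S) * Y' ^ 3 ∧ q' * (r + 1) ≤ p' * S) (hY : 0 < Y') : y < Y' := by
  by_contra! hlt
  have h3 : Y' ^ 3 ≤ y ^ 3 := by gcongr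
  have hY3 : 0 < Y' ^ 3 := by positivity
  have key : ∀ d, 0 < d → d ≤ S * |p - θ * q| → 33 * S < 100 * d * Y' ^ 3 →
      (p - θ * q) * (p' - θ * q') ≤ 0 → False := fun d hd hd1 hd2 hs ↦ by
    have h4 : |p - θ * q| * y ^ 3 ≤ 0.33 := by
      rw [← le_div_iff₀ (by positivity)]
      exact (hbest hs).trans hη
    have h5 : d * y ^ 3 ≤ S * 0.33 :=
      calc d * y ^ 3 ≤ S * |p - θ * q| * y ^ 3 := by gcongr
        _ = S * (|p - θ * q| * y ^ 3) := by ring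
        _ ≤ S * 0.33 := by gcongr
    have h6 : d * Y' ^ 3 ≤ d * y ^ 3 := by gcongr
    linarith
  have hq1 := mul_le_mul_of_nonneg_left hr hq.le
  have hq2 := mul_le_mul_of_nonneg_left hr' hq.le
  have hq1' := mul_le_mul_of_nonneg_left hr hq'.le
  have hq2' := mul_le_mul_of_nonneg_left hr' hq'.le
  rcases h with ⟨h1, h2⟩ | ⟨h1, h2⟩
  · have hd : 0 < p * S - q * (r + 1) := by
      by_contra! hd
      nlinarith
    have e1 : p * S - q * (r + 1) ≤ S * (p - θ * q) := by linarith
    have e2 : S * (p' - θ * q') ≤ 0 := by linarith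
    refine key _ hd (e1.trans (by gcongr; exact le_abs_self _)) h1
      (mul_nonpos_of_nonneg_of_nonpos ?_ ?_)
    · exact (pos_of_mul_pos_right (hd.trans_le e1) hS.le).le
    · exact nonpos_of_mul_nonpos_right e2 hS
  · have hd : 0 < q * r - p * S := by
      by_contra! hd
      nlinarith
    have e1 : q * r - p * S ≤ S * -(p - θ * q) := by linarith
    have e2 : 0 ≤ S * (p' - θ * q') := by linarith
    refine key _ hd (e1.trans (by gcongr; exact neg_le_abs _)) h1
      (mul_nonpos_of_nonpos_of_nonneg ?_ ?_)
    · exact (neg_pos.mp (pos_of_mul_pos_right (hd.trans_le e1) hS.le)).le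
    · exact nonneg_of_mul_nonneg_right e2 hS

theorem heightBound_pos (j : Fin 5) : 0 < heightBound j := by
  decide +kernel +revert

theorem lt_heightBound_succ (i j : Fin 4) {x y : ℤ} (hy : 0 < y)
    (hη : |(x : ℝ) - root i * y| ≤ 0.33 / (y : ℝ) ^ 3) (h : y < heightBound j.castSucc) :
    y < heightBound j.succ := by
  obtain ⟨hq, hq', hdet, hc⟩ := convergent_cert i j
  have hq'0 := (heightBound_pos _).trans_le hq'
  have hr := rootNum_le i
  have hr' := le_rootNum i
  have hS : (0 : ℝ) < 2 ^ 2960 := by positivity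
  have hcR : 33 * (2 : ℝ) ^ 2960 < 100 * (convNum i j * 2 ^ 2960 - convDen i j * (rootNum i + 1)) *
        heightBound j.succ ^ 3 ∧ nextConvNum i j * (2 : ℝ) ^ 2960 ≤ nextConvDen i j * rootNum i ∨
      33 * (2 : ℝ) ^ 2960 < 100 * (convDen i j * rootNum i - convNum i j * 2 ^ 2960) *
        heightBound j.succ ^ 3 ∧
        nextConvDen i j * ((rootNum i : ℝ) + 1) ≤ nextConvNum i j * 2 ^ 2960 := by
    exact_mod_cast hc
  have := lt_of_convergents hS hr hr' (by exact_mod_cast hq) (by exact_mod_cast hq'0)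
    (by exact_mod_cast hy) hη
    (abs_sub_mul_ge_of_convergents hq hy (h.trans_le hq') hdet) hcR
    (by exact_mod_cast heightBound_pos j.succ)
  exact_mod_cast this

theorem lt_ten_of_abs_prod_eq_one {x y : ℤ} (hy : 2 ≤ y)
    (h : |∏ i, ((x : ℝ) - root i * y)| = 1) : y < 10 := by
  obtain ⟨i, hη, -⟩ := exists_abs_sub_root_mul_le (x := (x : ℝ)) (y := (y : ℝ))
    (by exact_mod_cast (show 1 ≤ y by omega)) h.le
  have hy0 : 0 < y := by omega
  have h0 : y < heightBound 0 := by
    have := lt_two_pow_of_abs_prod_eq_one hy h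
    exact_mod_cast this
  exact lt_heightBound_succ i 3 hy0 hη <| lt_heightBound_succ i 2 hy0 hη <|
    lt_heightBound_succ i 1 hy0 hη <| lt_heightBound_succ i 0 hy0 hη h0

theorem quarticHom_small (y : Fin 10) (x : Fin 251) (hy : 1 ≤ (y : ℤ))
    (h : |quarticHom ((x : ℤ) - 125) y| = 1) : (x : ℤ) - 125 = -1 ∧ (y : ℤ) = 2 := by
  decide +kernel +revert

theorem prod_sub_root_mul_eq_quarticHom (x y : ℤ) :
    ∏ i, ((x : ℝ) - root i * y) = quarticHom x y := by
  rw [prod_sub_root_mul, quarticHom]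
  push_cast
  ring

theorem eq_of_abs_quarticHom_eq_one {x y : ℤ} (hy : 1 ≤ y) (h : |quarticHom x y| = 1) :
    x = -1 ∧ y = 2 := by
  have hR : |∏ i, ((x : ℝ) - root i * y)| = 1 := by
    rw [prod_sub_root_mul_eq_quarticHom]
    exact_mod_cast h
  have hyR : (1 : ℝ) ≤ y := by exact_mod_cast hy
  have hy10 : y < 10 := by
    rcases hy.eq_or_lt with rfl | hy
    · norm_num
    · exact lt_ten_of_abs_prod_eq_one hy hR
  have hx : |x| < 125 := by
    obtain ⟨i, hη, -⟩ := exists_abs_sub_root_mul_le hyR hR.le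
    have h1 : (0.33 : ℝ) / (y : ℝ) ^ 3 ≤ 1 :=
      div_le_one_of_le₀ (by linarith [one_le_pow₀ hyR (n := 3)]) (by positivity)
    have h2 : |root i * y| ≤ 10.2 * 10 := by
      rw [abs_mul, abs_of_pos (by linarith : (0 : ℝ) < y)]
      have : (y : ℝ) ≤ 10 := by exact_mod_cast hy10.le
      exact mul_le_mul (abs_root_le i) this (by linarith) (by norm_num)
    have h3 := abs_sub_abs_le_abs_sub (x : ℝ) (root i * y)
    have h4 : |(x : ℝ)| < 125 := by linarith
    exact_mod_cast h4
  obtain ⟨hx1, hx2⟩ := abs_lt.mp hx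
  have := quarticHom_small ⟨y.toNat, by omega⟩ ⟨(x + 125).toNat, by omega⟩
  simp only [Int.toNat_of_nonneg (show 0 ≤ y by omega),
    Int.toNat_of_nonneg (show 0 ≤ x + 125 by omega), add_sub_cancel_right] at this
  exact this hy h

theorem eq_zero_of_quarticHom_eq_zero_zmod (a b : ZMod 5)
    (h : a ^ 4 - 9 * a ^ 3 * b - 21 * a ^ 2 * b ^ 2 + 88 * a * b ^ 3 + 48 * b ^ 4 = 0) :
    a = 0 ∧ b = 0 := by
  decide +revert

theorem eq_zero_of_quarticHom_eq_zero {x y : ℤ} (h : quarticHom x y = 0) : x = 0 ∧ y = 0 := by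
  by_contra hne
  have hg : 0 < Int.gcd x y := Nat.pos_of_ne_zero fun h0 ↦ hne (Int.gcd_eq_zero_iff.mp h0)
  obtain ⟨a, b, hab, hx, hy⟩ := Int.exists_gcd_one hg
  have h1 : quarticHom a b = 0 := by
    have : quarticHom x y = quarticHom a b * (Int.gcd x y : ℤ) ^ 4 := by
      generalize Int.gcd x y = g at *
      subst hx hy
      rw [quarticHom, quarticHom]
      ring
    have hg' : (Int.gcd x y : ℤ) ≠ 0 := by exact_mod_cast hg.ne'
    exact (mul_eq_zero.mp (this ▸ h)).resolve_right (pow_ne_zero 4 hg')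
  have h2 := eq_zero_of_quarticHom_eq_zero_zmod (a : ZMod 5) (b : ZMod 5)
    (by rw [quarticHom] at h1; exact_mod_cast congrArg (Int.cast : ℤ → ZMod 5) h1)
  have h3 := Int.dvd_coe_gcd ((ZMod.intCast_zmod_eq_zero_iff_dvd a 5).mp h2.1)
    ((ZMod.intCast_zmod_eq_zero_iff_dvd b 5).mp h2.2)
  rw [hab] at h3
  omega

theorem stmt14 (x₂ y₂ : ℤ) :
    |x₂ ^ 4 - 9 * x₂ ^ 3 * y₂ - 21 * x₂ ^ 2 * y₂ ^ 2 + 88 * x₂ * y₂ ^ 3 + 48 * y₂ ^ 4| ≤ 1 ↔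
      ((x₂, y₂) ∈ ({(0, 0), (1, 0), (1, -2)} : Set (ℤ × ℤ)) ∨
       (-x₂, -y₂) ∈ ({(0, 0), (1, 0), (1, -2)} : Set (ℤ × ℤ))) := by
  simp only [Set.mem_insert_iff, Set.mem_singleton_iff, Prod.mk.injEq]
  constructor
  · intro h
    change |quarticHom x₂ y₂| ≤ 1 at h
    rcases (abs_nonneg (quarticHom x₂ y₂)).eq_or_lt with h0 | h0
    · exact Or.inl (Or.inl (eq_zero_of_quarticHom_eq_zero (abs_eq_zero.mp h0.symm)))
    · have h1 : |quarticHom x₂ y₂| = 1 := by omega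
      rcases lt_trichotomy y₂ 0 with hy | rfl | hy
      · have h2 : |quarticHom (-x₂) (-y₂)| = 1 := by
          rw [← h1, quarticHom, quarticHom]
          congr 1
          ring
        have := eq_of_abs_quarticHom_eq_one (by omega) h2
        omega
      · have h2 : |x₂| ^ 4 = 1 := by
          rw [← abs_pow, ← h1, quarticHom]
          congr 1
          ring
        have h3 := (pow_eq_one_iff_of_nonneg (abs_nonneg x₂) (by norm_num)).mp h2
        rcases eq_or_eq_neg_of_abs_eq h3 with rfl | rfl <;> simp
      · have := eq_of_abs_quarticHom_eq_one hy h1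
        omega
  · rintro ((⟨hx, hy⟩ | ⟨hx, hy⟩ | ⟨hx, hy⟩) | (⟨hx, hy⟩ | ⟨hx, hy⟩ | ⟨hx, hy⟩)) <;>
      first
      | (subst hx hy; norm_num)
      | (obtain rfl := neg_eq_iff_eq_neg.mp hx
         obtain rfl := neg_eq_iff_eq_neg.mp hy
         norm_num)
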